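/- Let n ≥ 3 and let A, B ⊆ S^{n-1} be Lebesgue measurable sets with non-empty interiors (relative to the sphere) and of the same measure. Then A and B are equidecomposable using rotations with pieces that are Lebesgue measurable (an exact measurable equidecomposition, with no exceptional null sets removed). -/

import Mathlib

open MeasureTheory Set Metric
open scoped ENNReal

noncomputable section

/-- `n`-dimensional Euclidean space `ℝⁿ`. -/
abbrev EucSp (n : ℕ) : Type := EuclideanSpace ℝ (Fin n)

/-- The unit sphere `S^{n-1} ⊆ ℝⁿ`. -/
abbrev Sph (n : ℕ) : Type := Metric.sphere (0 : EucSp n) 1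

/-- A linear isometry of `ℝⁿ` is a rotation (an element of `SO(n)`) if it has determinant `1`. -/
def IsRotation {n : ℕ} (γ : EucSp n ≃ₗᵢ[ℝ] EucSp n) : Prop :=
  LinearMap.det (γ.toLinearEquiv.toLinearMap) = 1

/-- The action of a linear isometry of `ℝⁿ` on the unit sphere `S^{n-1}`. -/
def rotateSphere {n : ℕ} (γ : EucSp n ≃ₗᵢ[ℝ] EucSp n) (x : Sph n) : Sph n :=
  ⟨γ x, by
    have hx : ‖(x : EucSp n)‖ = 1 := by
      have h := x.2
      rwa [Metric.mem_sphere, dist_zero_right] at h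
    rw [Metric.mem_sphere, dist_zero_right, γ.norm_map]
    exact hx⟩

namespace SphereEq
open Quaternion

/-- The quaternion with given coordinates. -/
def qmk {R : Type*} [CommRing R] (a b c d : R) : ℍ[R] := ⟨a, b, c, d⟩

section
variable {R : Type*} [CommRing R] (a b c d : R)
@[simp] theorem re_qmk : (qmk a b c d).re = a := rfl
@[simp] theorem imI_qmk : (qmk a b c d).imI = b := rfl
@[simp] theorem imJ_qmk : (qmk a b c d).imJ = c := rfl
@[simp] theorem imK_qmk : (qmk a b c d).imK = d := rfl
end

/-- The group of unit quaternions. -/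
abbrev UQ : Type := Metric.sphere (0 : ℍ[ℝ]) 1

instance : MeasurableSpace UQ := borel UQ
instance : BorelSpace UQ := ⟨rfl⟩

theorem normSq_UQ (h : UQ) : (h : ℍ[ℝ]).re ^ 2 + (h : ℍ[ℝ]).imI ^ 2 + (h : ℍ[ℝ]).imJ ^ 2
    + (h : ℍ[ℝ]).imK ^ 2 = 1 := by
  have h1 : ‖(h : ℍ[ℝ])‖ = 1 := by simp
  have h2 := Quaternion.normSq_eq_norm_mul_self (h : ℍ[ℝ])
  rw [h1, Quaternion.normSq_def'] at h2
  linarith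

theorem norm_sq_quaternion (q : ℍ[ℝ]) :
    ‖q‖ ^ 2 = q.re ^ 2 + q.imI ^ 2 + q.imJ ^ 2 + q.imK ^ 2 := by
  rw [pow_two ‖q‖, ← Quaternion.normSq_eq_norm_mul_self, Quaternion.normSq_def']

/-- A unit quaternion with prescribed coordinates. -/
def mkUQ (a b c d : ℝ) (h : a ^ 2 + b ^ 2 + c ^ 2 + d ^ 2 = 1) : UQ :=
  ⟨qmk a b c d, by
    have h2 := norm_sq_quaternion (qmk a b c d)
    simp only [re_qmk, imI_qmk, imJ_qmk, imK_qmk, h] at h2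
    have h3 : ‖qmk a b c d‖ = 1 := (pow_eq_one_iff_of_nonneg (norm_nonneg _) two_ne_zero).1 h2
    simpa using h3⟩

@[simp] theorem coe_mkUQ (a b c d : ℝ) (h) : (mkUQ a b c d h : ℍ[ℝ]) = qmk a b c d := rfl

theorem coe_inv_UQ (h : UQ) : ((h⁻¹ : UQ) : ℍ[ℝ]) = star (h : ℍ[ℝ]) := by
  rw [Metric.unitSphere.coe_inv, Quaternion.inv_def, Quaternion.normSq_eq_norm_mul_self]
  simp

/-- The imaginary quaternion with given coordinates. -/
def toQ (v : Fin 3 → ℝ) : ℍ[ℝ] := qmk 0 (v 0) (v 1) (v 2)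

/-- Conjugation by a quaternion, in coordinates. -/
def rotFun (h : ℍ[ℝ]) (v : Fin 3 → ℝ) : Fin 3 → ℝ :=
  ![(h * toQ v * star h).imI, (h * toQ v * star h).imJ, (h * toQ v * star h).imK]

theorem toQ_rotFun (h : ℍ[ℝ]) (v : Fin 3 → ℝ) : toQ (rotFun h v) = h * toQ v * star h := by
  ext <;> simp [toQ, rotFun]
  ring

theorem toQ_injective : Function.Injective toQ := by
  intro v w h
  have h1 := congrArg QuaternionAlgebra.imI h
  have h2 := congrArg QuaternionAlgebra.imJ h
  have h3 := congrArg QuaternionAlgebra.imK h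
  simp only [toQ] at h1 h2 h3
  funext i
  fin_cases i <;> assumption

theorem rotFun_mul (g h : ℍ[ℝ]) (v : Fin 3 → ℝ) : rotFun (g * h) v = rotFun g (rotFun h v) := by
  apply toQ_injective
  simp only [toQ_rotFun, star_mul, mul_assoc]

theorem rotFun_one (v : Fin 3 → ℝ) : rotFun 1 v = v := by
  apply toQ_injective
  simp [toQ_rotFun]

theorem toQ_add (v w : Fin 3 → ℝ) : toQ (v + w) = toQ v + toQ w := by
  ext <;> simp [toQ]

theorem toQ_smul (c : ℝ) (v : Fin 3 → ℝ) : toQ (c • v) = c • toQ v := by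
  ext <;> simp [toQ]

theorem rotFun_add (h : ℍ[ℝ]) (v w : Fin 3 → ℝ) : rotFun h (v + w) = rotFun h v + rotFun h w := by
  apply toQ_injective
  simp only [toQ_rotFun, toQ_add, mul_add, add_mul]

theorem rotFun_smul (h : ℍ[ℝ]) (c : ℝ) (v : Fin 3 → ℝ) : rotFun h (c • v) = c • rotFun h v := by
  apply toQ_injective
  simp only [toQ_rotFun, toQ_smul]
  simp

theorem norm_toQ_sq (v : Fin 3 → ℝ) : ‖toQ v‖ ^ 2 = ∑ i, v i ^ 2 := by
  rw [norm_sq_quaternion, Fin.sum_univ_three]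
  simp [toQ]

theorem sum_rotFun_sq (h : UQ) (v : Fin 3 → ℝ) : ∑ i, rotFun h v i ^ 2 = ∑ i, v i ^ 2 := by
  rw [← norm_toQ_sq, ← norm_toQ_sq, toQ_rotFun]
  simp

theorem continuous_toQ : Continuous toQ := by
  have : toQ = fun v => Quaternion.linearIsometryEquivTuple.symm (!₂[0, v 0, v 1, v 2]) := by
    funext v
    ext <;> simp [toQ]
  rw [this]
  apply (LinearIsometryEquiv.continuous _).comp
  apply (PiLp.continuous_toLp 2 _).comp
  apply continuous_pi
  intro i
  fin_cases i <;> simp <;> fun_prop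

theorem continuous_rotFun : Continuous fun p : ℍ[ℝ] × (Fin 3 → ℝ) => rotFun p.1 p.2 := by
  have h1 : Continuous fun p : ℍ[ℝ] × (Fin 3 → ℝ) => p.1 * toQ p.2 * star p.1 :=
    (continuous_fst.mul (continuous_toQ.comp continuous_snd)).mul continuous_fst.star
  apply continuous_pi
  intro i
  fin_cases i
  · exact Quaternion.continuous_imI.comp h1
  · exact Quaternion.continuous_imJ.comp h1
  · exact Quaternion.continuous_imK.comp h1

variable {n : ℕ}

/-- The linear map rotating the coordinates selected by `I`. -/
def blockFun (I : Fin 3 ↪ Fin n) (h : ℍ[ℝ]) (x : Fin n → ℝ) : Fin n → ℝ :=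
  Function.extend I (rotFun h (x ∘ I)) x

@[simp] theorem blockFun_apply (I : Fin 3 ↪ Fin n) (h : ℍ[ℝ]) (x : Fin n → ℝ) (a : Fin 3) :
    blockFun I h x (I a) = rotFun h (x ∘ I) a := I.injective.extend_apply _ _ _

theorem blockFun_comp (I : Fin 3 ↪ Fin n) (h : ℍ[ℝ]) (x : Fin n → ℝ) :
    blockFun I h x ∘ I = rotFun h (x ∘ I) := by
  funext a; simp

theorem blockFun_apply' (I : Fin 3 ↪ Fin n) (h : ℍ[ℝ]) (x : Fin n → ℝ) (j : Fin n)
    (hj : ¬ ∃ a, I a = j) : blockFun I h x j = x j := Function.extend_apply' _ _ _ hj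

theorem blockFun_ext (I : Fin 3 ↪ Fin n) {x y : Fin n → ℝ} (h1 : x ∘ I = y ∘ I)
    (h2 : ∀ j, (¬ ∃ a, I a = j) → x j = y j) : x = y := by
  funext j
  by_cases hj : ∃ a, I a = j
  · obtain ⟨a, rfl⟩ := hj
    exact congrFun h1 a
  · exact h2 j hj

theorem blockFun_mul (I : Fin 3 ↪ Fin n) (g h : ℍ[ℝ]) (x : Fin n → ℝ) :
    blockFun I (g * h) x = blockFun I g (blockFun I h x) := by
  apply blockFun_ext I
  · simp only [blockFun_comp, rotFun_mul]
  · intro j hj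
    simp only [blockFun_apply' I _ _ j hj]

theorem blockFun_one (I : Fin 3 ↪ Fin n) (x : Fin n → ℝ) : blockFun I 1 x = x := by
  apply blockFun_ext I
  · simp only [blockFun_comp, rotFun_one]
  · intro j hj
    simp only [blockFun_apply' I _ _ j hj]

theorem blockFun_add (I : Fin 3 ↪ Fin n) (h : ℍ[ℝ]) (x y : Fin n → ℝ) :
    blockFun I h (x + y) = blockFun I h x + blockFun I h y := by
  apply blockFun_ext I
  · rw [blockFun_comp, Pi.add_comp, Pi.add_comp, blockFun_comp, blockFun_comp, rotFun_add]
  · intro j hj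
    simp only [blockFun_apply' I _ _ j hj, Pi.add_apply]

theorem blockFun_smul (I : Fin 3 ↪ Fin n) (h : ℍ[ℝ]) (c : ℝ) (x : Fin n → ℝ) :
    blockFun I h (c • x) = c • blockFun I h x := by
  apply blockFun_ext I
  · rw [blockFun_comp, Pi.smul_comp, Pi.smul_comp, blockFun_comp, rotFun_smul]
  · intro j hj
    simp only [blockFun_apply' I _ _ j hj, Pi.smul_apply]

theorem sum_split (I : Fin 3 ↪ Fin n) (f : Fin n → ℝ) :
    ∑ j, f j = ∑ a, f (I a) + ∑ j ∈ (Finset.univ.map I)ᶜ, f j := by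
  rw [← Finset.sum_map Finset.univ I f, Finset.sum_add_sum_compl]

theorem sum_blockFun_sq (I : Fin 3 ↪ Fin n) (h : UQ) (x : Fin n → ℝ) :
    ∑ j, blockFun I h x j ^ 2 = ∑ j, x j ^ 2 := by
  rw [sum_split I, sum_split I (fun j => x j ^ 2)]
  congr 1
  · simp only [blockFun_apply]
    rw [sum_rotFun_sq]
    rfl
  · apply Finset.sum_congr rfl
    intro j hj
    rw [blockFun_apply']
    simpa using hj

/-- The linear isometry of `ℝⁿ` rotating the coordinates selected by `I`. -/
def bl (I : Fin 3 ↪ Fin n) : UQ →* (EucSp n ≃ₗᵢ[ℝ] EucSp n) where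
  toFun h :=
    { toFun := fun x => WithLp.toLp 2 (blockFun I h x)
      invFun := fun x => WithLp.toLp 2 (blockFun I (h⁻¹ : UQ) x)
      map_add' := fun x y => by
        ext1 j
        exact congrFun (blockFun_add I h x y) j
      map_smul' := fun c x => by
        ext1 j
        exact congrFun (blockFun_smul I h c x) j
      left_inv := fun x => by
        ext1 j
        simp only [← blockFun_mul]
        rw [← Metric.unitSphere.coe_mul, inv_mul_cancel, Metric.unitSphere.coe_one, blockFun_one]
      right_inv := fun x => by
        ext1 j
        simp only [← blockFun_mul]
        rw [← Metric.unitSphere.coe_mul, mul_inv_cancel, Metric.unitSphere.coe_one, blockFun_one]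
      norm_map' := fun x => by
        rw [EuclideanSpace.norm_eq, EuclideanSpace.norm_eq]
        congr 1
        simp only [Real.norm_eq_abs, sq_abs]
        exact sum_blockFun_sq I h x }
  map_one' := by
    ext x j
    simp [blockFun_one]
  map_mul' g h := by
    ext x j
    simp [blockFun_mul]

theorem bl_apply (I : Fin 3 ↪ Fin n) (h : UQ) (x : EucSp n) (j : Fin n) :
    bl I h x j = blockFun I h x j := rfl

theorem exists_sqrt_UQ (h : UQ) : ∃ g : UQ, g * g = h := by
  have hn := normSq_UQ h
  by_cases hr : (h : ℍ[ℝ]).re = -1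
  · refine ⟨mkUQ 0 1 0 0 (by norm_num), ?_⟩
    have h1 : (h : ℍ[ℝ]).imI = 0 := by
      nlinarith [sq_nonneg (h : ℍ[ℝ]).imJ, sq_nonneg (h : ℍ[ℝ]).imK]
    have h2 : (h : ℍ[ℝ]).imJ = 0 := by
      nlinarith [sq_nonneg (h : ℍ[ℝ]).imI, sq_nonneg (h : ℍ[ℝ]).imK]
    have h3 : (h : ℍ[ℝ]).imK = 0 := by
      nlinarith [sq_nonneg (h : ℍ[ℝ]).imJ, sq_nonneg (h : ℍ[ℝ]).imI]
    apply Subtype.ext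
    rw [Metric.unitSphere.coe_mul]
    ext <;> simp [hr, h1, h2, h3]
  · set a := (h : ℍ[ℝ]).re with ha
    have ha1 : -1 < a := by
      have : -1 ≤ a := by
        nlinarith [sq_nonneg (h : ℍ[ℝ]).imI, sq_nonneg (h : ℍ[ℝ]).imJ, sq_nonneg (h : ℍ[ℝ]).imK]
      exact lt_of_le_of_ne this (Ne.symm hr)
    obtain ⟨r, hr0, hr2⟩ : ∃ r : ℝ, 0 < r ∧ r ^ 2 = 2 + 2 * a :=
      ⟨√(2 + 2 * a), Real.sqrt_pos.2 (by linarith), Real.sq_sqrt (by linarith)⟩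
    refine ⟨mkUQ ((1 + a) / r) ((h : ℍ[ℝ]).imI / r) ((h : ℍ[ℝ]).imJ / r) ((h : ℍ[ℝ]).imK / r) ?_,
      ?_⟩
    · field_simp
      nlinarith
    · apply Subtype.ext
      rw [Metric.unitSphere.coe_mul]
      ext
      · simp
        field_simp
        nlinarith
      all_goals
        simp
        field_simp
        rw [hr2]
        ring

theorem isRotation_mul {γ δ : EucSp n ≃ₗᵢ[ℝ] EucSp n} (h1 : IsRotation γ) (h2 : IsRotation δ) :
    IsRotation (γ * δ) := by
  unfold IsRotation at *
  have : (γ * δ).toLinearEquiv.toLinearMap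
      = γ.toLinearEquiv.toLinearMap * δ.toLinearEquiv.toLinearMap := rfl
  rw [this, map_mul, h1, h2, one_mul]

theorem isRotation_one : IsRotation (1 : EucSp n ≃ₗᵢ[ℝ] EucSp n) := by
  unfold IsRotation
  exact LinearMap.det_id

theorem isRotation_inv {γ : EucSp n ≃ₗᵢ[ℝ] EucSp n} (h1 : IsRotation γ) : IsRotation γ⁻¹ := by
  unfold IsRotation at *
  have : (γ⁻¹ : EucSp n ≃ₗᵢ[ℝ] EucSp n).toLinearEquiv.toLinearMap
      * γ.toLinearEquiv.toLinearMap = 1 := by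
    ext1 x
    exact γ.symm_apply_apply x
  have := congrArg LinearMap.det this
  rwa [map_mul, h1, mul_one, map_one] at this

theorem det_mul_self_isometry (γ : EucSp n ≃ₗᵢ[ℝ] EucSp n) :
    LinearMap.det γ.toLinearEquiv.toLinearMap * LinearMap.det γ.toLinearEquiv.toLinearMap = 1 := by
  have h := LinearIsometry.normDet_eq_one γ.toLinearIsometry
  rw [LinearMap.normDet_eq_abs_det] at h
  change |LinearMap.det γ.toLinearEquiv.toLinearMap| = 1 at h
  rw [← abs_mul_abs_self, h, one_mul]

theorem isRotation_bl (I : Fin 3 ↪ Fin n) (h : UQ) : IsRotation (bl I h) := by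
  obtain ⟨g, rfl⟩ := exists_sqrt_UQ h
  rw [map_mul]
  unfold IsRotation
  have : (bl I g * bl I g).toLinearEquiv.toLinearMap
      = (bl I g).toLinearEquiv.toLinearMap * (bl I g).toLinearEquiv.toLinearMap := rfl
  rw [this, map_mul]
  exact det_mul_self_isometry _

end SphereEq

namespace SphereEq
open Quaternion

/-- The six generators: a coordinate axis and a sign. -/
abbrev Letter : Type := Fin 3 × Bool

/-- The formal inverse of a letter. -/
def linv (s : Letter) : Letter := (s.1, !s.2)

@[simp] theorem linv_linv (s : Letter) : linv (linv s) = s := by simp [linv]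

theorem linv_inj {s t : Letter} : linv s = linv t ↔ s = t :=
  ⟨fun h => by rw [← linv_linv s, h, linv_linv], fun h => by rw [h]⟩

/-- Reduced words: no letter is followed by its inverse. -/
def Red : List Letter → Prop
  | [] => True
  | s :: w => w.head? ≠ some (linv s) ∧ Red w

theorem red_cons {s : Letter} {w : List Letter} :
    Red (s :: w) ↔ w.head? ≠ some (linv s) ∧ Red w := Iff.rfl

theorem red_append {u v : List Letter} (hu : Red u) (hv : Red v)
    (h : ∀ s ∈ u.getLast?, v.head? ≠ some (linv s)) : Red (u ++ v) := by
  induction u with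
  | nil => simpa using hv
  | cons s u ih =>
    rw [List.cons_append, red_cons]
    rw [red_cons] at hu
    cases u with
    | nil =>
      refine ⟨?_, by simpa using hv⟩
      simpa using h s (by simp)
    | cons t u =>
      exact ⟨by simpa using hu.1, ih hu.2 (fun s hs => h s (by simpa using hs))⟩

/-- The formal inverse of a word. -/
def winv (w : List Letter) : List Letter := (w.map linv).reverse

theorem winv_cons (s : Letter) (w : List Letter) : winv (s :: w) = winv w ++ [linv s] := by
  simp [winv]

theorem length_winv (w : List Letter) : (winv w).length = w.length := by simp [winv]

theorem red_winv {w : List Letter} (hw : Red w) : Red (winv w) := by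
  induction w with
  | nil => exact hw
  | cons s w ih =>
    rw [winv_cons]
    refine red_append (ih hw.2) ⟨by simp, trivial⟩ ?_
    intro t ht
    have h1 := hw.1
    cases w with
    | nil => simp [winv] at ht
    | cons r w =>
      have ht' : linv r = t := by simpa [winv_cons] using ht
      subst ht'
      intro h2
      simp only [List.head?_cons, Option.some.injEq, linv_linv] at h2
      apply h1
      simp [h2]

/-- The quaternion `1 ± 2 e` attached to a letter. -/
def ql (R : Type*) [CommRing R] (s : Letter) : ℍ[R] :=
  qmk 1 (if s.1 = 0 then (if s.2 then 2 else -2) else 0)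
    (if s.1 = 1 then (if s.2 then 2 else -2) else 0)
    (if s.1 = 2 then (if s.2 then 2 else -2) else 0)

/-- The product of the quaternions attached to the letters of a word. -/
def ev (R : Type*) [CommRing R] : List Letter → ℍ[R]
  | [] => 1
  | s :: w => ql R s * ev R w

section
variable {R : Type*} [CommRing R]

theorem ev_cons (s : Letter) (w : List Letter) : ev R (s :: w) = ql R s * ev R w := rfl

theorem ev_append (u v : List Letter) : ev R (u ++ v) = ev R u * ev R v := by
  induction u with
  | nil => simp [ev]
  | cons s u ih => rw [List.cons_append, ev_cons, ih, ev_cons, mul_assoc]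

theorem ql_linv (s : Letter) : ql R (linv s) = star (ql R s) := by
  obtain ⟨i, b⟩ := s
  fin_cases i <;> cases b <;> ext <;> simp [ql, linv]

theorem ql_linv_mul (s : Letter) (x : ℍ[R]) : ql R (linv s) * (ql R s * x) = (5 : R) • x := by
  obtain ⟨i, b⟩ := s
  fin_cases i <;> cases b <;> ext <;> simp [ql, linv] <;> ring

theorem ev_winv (w : List Letter) : ev R (winv w) = star (ev R w) := by
  induction w with
  | nil => simp [winv, ev]
  | cons s w ih => rw [winv_cons, ev_append, ih, ev_cons s w, star_mul]; simp [ev, ql_linv]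

theorem normSq_ql (s : Letter) : normSq (ql R s) = 5 := by
  obtain ⟨i, b⟩ := s
  rw [Quaternion.normSq_def']
  fin_cases i <;> cases b <;> simp [ql] <;> norm_num

theorem normSq_ev (w : List Letter) : normSq (ev R w) = 5 ^ w.length := by
  induction w with
  | nil => simp [ev]
  | cons s w ih => rw [ev_cons, map_mul, ih, normSq_ql, List.length_cons, pow_succ, mul_comm]

theorem ev_cast (w : List Letter) :
    ev R w = qmk (((ev ℤ w).re : ℤ) : R) (((ev ℤ w).imI : ℤ) : R) (((ev ℤ w).imJ : ℤ) : R)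
      (((ev ℤ w).imK : ℤ) : R) := by
  induction w with
  | nil => ext <;> simp [ev]
  | cons s w ih =>
    rw [ev_cons, ev_cons, ih]
    have h2 : ql R s = qmk (((ql ℤ s).re : ℤ) : R) (((ql ℤ s).imI : ℤ) : R)
        (((ql ℤ s).imJ : ℤ) : R) (((ql ℤ s).imK : ℤ) : R) := by
      obtain ⟨i, b⟩ := s
      fin_cases i <;> cases b <;> simp [ql]
    rw [h2]
    ext <;> simp
end

theorem ql_mul_mul (s t : Letter) (h : t ≠ linv s) :
    ∃ c : ZMod 5, c ≠ 0 ∧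
      ql (ZMod 5) t * (ql (ZMod 5) s * ql (ZMod 5) t) = c • ql (ZMod 5) t := by
  obtain ⟨i, b⟩ := s
  obtain ⟨j, d⟩ := t
  by_cases hij : i = j
  · subst hij
    have : d = b := by
      by_contra h2
      apply h
      cases b <;> cases d <;> simp_all [linv]
    subst this
    refine ⟨4, by decide, ?_⟩
    fin_cases i <;> cases d <;> ext <;> simp [ql] <;> decide
  · refine ⟨2, by decide, ?_⟩
    fin_cases i <;> fin_cases j <;> first | (exact absurd rfl hij) | skip
    all_goals cases b <;> cases d <;> ext <;> simp [ql] <;> decide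

theorem ev_zmod_ne_zero {w : List Letter} (hw : Red w) : ev (ZMod 5) w ≠ 0 := by
  induction w with
  | nil =>
    intro h
    have := congrArg QuaternionAlgebra.re h
    simp only [ev, re_one, re_zero] at this
    exact absurd this (by decide)
  | cons s w ih =>
    cases w with
    | nil =>
      intro h
      have := congrArg QuaternionAlgebra.re h
      simp only [ev, ql, mul_one, re_qmk, re_zero] at this
      exact absurd this (by decide)
    | cons t w =>
      obtain ⟨c, hc, hcq⟩ := ql_mul_mul s t (by
        intro h
        exact hw.1 (by simp [h]))
      intro h
      apply ih hw.2
      have h2 : ql (ZMod 5) t * ev (ZMod 5) (s :: t :: w) = 0 := by rw [h, mul_zero]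
      rw [ev_cons, ev_cons, ← mul_assoc (ql _ s), ← mul_assoc, hcq, smul_mul_assoc] at h2
      rw [ev_cons]
      have : Fact (Nat.Prime 5) := ⟨by norm_num⟩
      exact (smul_eq_zero.1 h2).resolve_left hc

theorem ev_int_ne_five_mul {w : List Letter} (hw : Red w) (x : ℍ[ℤ]) : ev ℤ w ≠ (5 : ℤ) • x := by
  intro h
  apply ev_zmod_ne_zero hw
  rw [ev_cast, h]
  have h6 : (5 : ZMod 5) = 0 := by decide
  ext <;> simp [h6, -zsmul_eq_mul]

theorem five_mul_cancel {x y : ℍ[ℤ]} (h : (5 : ℤ) • x = (5 : ℤ) • y) : x = y := by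
  ext
  · have := congrArg QuaternionAlgebra.re h; simpa [-zsmul_eq_mul] using this
  · have := congrArg QuaternionAlgebra.imI h; simpa [-zsmul_eq_mul] using this
  · have := congrArg QuaternionAlgebra.imJ h; simpa [-zsmul_eq_mul] using this
  · have := congrArg QuaternionAlgebra.imK h; simpa [-zsmul_eq_mul] using this

theorem ev_injective {w w' : List Letter} (hw : Red w) (hw' : Red w')
    (hl : w.length = w'.length) (h : ev ℤ w = ev ℤ w') : w = w' := by
  induction w generalizing w' with
  | nil => exact (List.length_eq_zero_iff.1 hl.symm).symm
  | cons s w ih =>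
    cases w' with
    | nil => simp at hl
    | cons s' w' =>
      rw [ev_cons, ev_cons] at h
      by_cases hs : s = s'
      · subst hs
        rw [ih hw.2 hw'.2 (by simpa using hl)]
        apply five_mul_cancel
        rw [← ql_linv_mul s, h, ql_linv_mul]
      · exfalso
        refine ev_int_ne_five_mul (w := linv s :: s' :: w') ⟨?_, hw'⟩ (ev ℤ w) ?_
        · simpa using fun h => hs h.symm
        · rw [ev_cons, ev_cons, ← h, ql_linv_mul]

/-- The unit quaternion attached to a letter. -/
def qU (s : Letter) : UQ :=
  ⟨(√5)⁻¹ • ql ℝ s, by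
    have h := Quaternion.normSq_eq_norm_mul_self (ql ℝ s)
    rw [normSq_ql] at h
    have h2 : ‖ql ℝ s‖ = √5 := by rw [h, Real.sqrt_mul_self (norm_nonneg _)]
    rw [mem_sphere_zero_iff_norm, norm_smul, h2, norm_inv, Real.norm_of_nonneg (Real.sqrt_nonneg _)]
    exact inv_mul_cancel₀ (by positivity)⟩

/-- The unit quaternion attached to a word. -/
def evU : List Letter → UQ
  | [] => 1
  | s :: w => qU s * evU w

theorem evU_cons (s : Letter) (w : List Letter) : evU (s :: w) = qU s * evU w := rfl

theorem coe_evU (w : List Letter) : (evU w : ℍ[ℝ]) = ((√5)⁻¹) ^ w.length • ev ℝ w := by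
  induction w with
  | nil => simp [ev, evU]
  | cons s w ih =>
    rw [evU_cons, Metric.unitSphere.coe_mul, ih, ev_cons, List.length_cons, pow_succ]
    simp only [qU, smul_mul_assoc, mul_smul_comm, smul_smul]

theorem qU_linv (s : Letter) : qU (linv s) = (qU s)⁻¹ := by
  apply Subtype.ext
  rw [coe_inv_UQ]
  simp [qU, ql_linv]

theorem evU_append (u v : List Letter) : evU (u ++ v) = evU u * evU v := by
  induction u with
  | nil => simp [evU]
  | cons s u ih => rw [List.cons_append, evU_cons, ih, evU_cons, mul_assoc]

theorem evU_winv (w : List Letter) : evU (winv w) = (evU w)⁻¹ := by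
  induction w with
  | nil => simp [winv, evU]
  | cons s w ih => rw [winv_cons, evU_append, ih, evU_cons s w, mul_inv_rev]; simp [evU, qU_linv]

/-- The reduced words of length `m`. -/
def W : ℕ → Finset (List Letter)
  | 0 => {[]}
  | m + 1 => ((Finset.univ ×ˢ W m).filter
      (fun p : Letter × List Letter => p.2.head? ≠ some (linv p.1))).image (fun p => p.1 :: p.2)

theorem mem_W {m : ℕ} {w : List Letter} : w ∈ W m ↔ w.length = m ∧ Red w := by
  induction m generalizing w with
  | zero =>
    simp only [W, Finset.mem_singleton]
    constructor
    · rintro rfl; exact ⟨rfl, trivial⟩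
    · intro h; exact List.length_eq_zero_iff.1 h.1
  | succ m ih =>
    simp only [W, Finset.mem_image, Finset.mem_filter, Finset.mem_product, Finset.mem_univ,
      true_and, ih]
    constructor
    · rintro ⟨⟨s, u⟩, ⟨⟨h1, h2⟩, h3⟩, rfl⟩
      exact ⟨by simp [h1], h3, h2⟩
    · rintro ⟨h1, h2⟩
      cases w with
      | nil => simp at h1
      | cons s u => exact ⟨⟨s, u⟩, ⟨⟨by simpa using h1, h2.2⟩, h2.1⟩, rfl⟩

end SphereEq

namespace SphereEq
open Quaternion

theorem sub_inner_pos {n x y x' y' : ℤ} (h : x ^ 2 + y ^ 2 = n) (h' : x' ^ 2 + y' ^ 2 = n)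
    (hne : (x, y) ≠ (x', y')) : 0 < n - (x * x' + y * y') := by
  by_contra hc
  push Not at hc
  have h4 : (x - x') ^ 2 + (y - y') ^ 2 ≤ 0 := by
    have : (x - x') ^ 2 + (y - y') ^ 2 =
        (x ^ 2 + y ^ 2) + (x' ^ 2 + y' ^ 2) - 2 * (x * x' + y * y') := by ring
    rw [this, h, h']
    linarith
  have h5 : x - x' = 0 := by
    have : (x - x') ^ 2 = 0 := le_antisymm (by linarith [sq_nonneg (y - y')]) (sq_nonneg _)
    exact pow_eq_zero_iff two_ne_zero |>.1 this
  have h6 : y - y' = 0 := by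
    have : (y - y') ^ 2 = 0 := le_antisymm (by linarith [sq_nonneg (x - x')]) (sq_nonneg _)
    exact pow_eq_zero_iff two_ne_zero |>.1 this
  exact hne (by rw [Prod.mk.injEq]; constructor <;> linarith)

theorem gram_circle (n x₁ y₁ x₂ y₂ x₃ y₃ : ℤ) :
    n * (x₁ * (y₂ - y₃) - x₂ * (y₁ - y₃) + x₃ * (y₁ - y₂)) ^ 2 =
      2 * (n - (x₁ * x₂ + y₁ * y₂)) * (n - (x₂ * x₃ + y₂ * y₃)) * (n - (x₃ * x₁ + y₃ * y₁)) -
      (x₁ ^ 2 + y₁ ^ 2 - n) * (x₂ ^ 2 + y₂ ^ 2 - n) * (x₃ ^ 2 + y₃ ^ 2 - n) +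
      (x₁ ^ 2 + y₁ ^ 2 - n) * (n - (x₂ * x₃ + y₂ * y₃)) ^ 2 +
      (x₂ ^ 2 + y₂ ^ 2 - n) * (n - (x₃ * x₁ + y₃ * y₁)) ^ 2 +
      (x₃ ^ 2 + y₃ ^ 2 - n) * (n - (x₁ * x₂ + y₁ * y₂)) ^ 2 := by
  ring

/-- A short arc of a circle contains at most two lattice points. -/
theorem le_of_three_lattice_points {n l x₁ y₁ x₂ y₂ x₃ y₃ : ℤ}
    (h1 : x₁ ^ 2 + y₁ ^ 2 = n) (h2 : x₂ ^ 2 + y₂ ^ 2 = n) (h3 : x₃ ^ 2 + y₃ ^ 2 = n)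
    (d12 : (x₁, y₁) ≠ (x₂, y₂)) (d23 : (x₂, y₂) ≠ (x₃, y₃)) (d31 : (x₃, y₃) ≠ (x₁, y₁))
    (a12 : (x₁ - x₂) ^ 2 + (y₁ - y₂) ^ 2 ≤ 2 * l) (a23 : (x₂ - x₃) ^ 2 + (y₂ - y₃) ^ 2 ≤ 2 * l)
    (a31 : (x₃ - x₁) ^ 2 + (y₃ - y₁) ^ 2 ≤ 2 * l) : 0 < n ∧ n ≤ 2 * l ^ 3 := by
  have hα := sub_inner_pos h1 h2 d12
  have hβ := sub_inner_pos h2 h3 d23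
  have hγ := sub_inner_pos h3 h1 d31
  have lt : ∀ x y x' y' : ℤ, x ^ 2 + y ^ 2 = n → x' ^ 2 + y' ^ 2 = n →
      (x - x') ^ 2 + (y - y') ^ 2 ≤ 2 * l → n - (x * x' + y * y') ≤ l := by
    intro x y x' y' h h' hl
    have : (x - x') ^ 2 + (y - y') ^ 2 =
        (x ^ 2 + y ^ 2) + (x' ^ 2 + y' ^ 2) - 2 * (x * x' + y * y') := by ring
    rw [this, h, h'] at hl
    linarith
  have lα := lt _ _ _ _ h1 h2 a12
  have lβ := lt _ _ _ _ h2 h3 a23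
  have lγ := lt _ _ _ _ h3 h1 a31
  have key := gram_circle n x₁ y₁ x₂ y₂ x₃ y₃
  have hn0 : 0 ≤ n := by rw [← h1]; exact add_nonneg (sq_nonneg _) (sq_nonneg _)
  rw [h1, h2, h3, sub_self] at key
  clear lt a12 a23 a31
  generalize x₁ * (y₂ - y₃) - x₂ * (y₁ - y₃) + x₃ * (y₁ - y₂) = D at key
  generalize n - (x₁ * x₂ + y₁ * y₂) = α at *
  generalize n - (x₂ * x₃ + y₂ * y₃) = β at *
  generalize n - (x₃ * x₁ + y₃ * y₁) = γ at *
  have key : n * D ^ 2 = 2 * (α * β * γ) := by linarith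
  have hαβ : 0 < α * β := mul_pos hα hβ
  have hαβγ : 0 < α * β * γ := mul_pos hαβ hγ
  have hD0 : D ^ 2 ≠ 0 := by
    intro h
    rw [h, mul_zero] at key
    linarith
  have hD : 1 ≤ D ^ 2 := (sq_nonneg D).lt_of_ne' hD0
  have hnpos : n ≠ 0 := by
    intro h
    rw [h, zero_mul] at key
    linarith
  refine ⟨hn0.lt_of_ne' hnpos, ?_⟩
  have hl : 0 ≤ l := hα.le.trans lα
  calc n ≤ n * D ^ 2 := le_mul_of_one_le_right hn0 hD
    _ = 2 * (α * β * γ) := key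
    _ ≤ 2 * (l * l * l) := by
      have h1 : α * β ≤ l * l := mul_le_mul lα lβ hβ.le hl
      have h2 : α * β * γ ≤ l * l * l := mul_le_mul h1 lγ hγ.le (mul_nonneg hl hl)
      linarith
    _ = 2 * l ^ 3 := by ring

theorem sector_sub_sq_le {x y x' y' n : ℤ} (h : x ^ 2 + y ^ 2 = n) (h' : x' ^ 2 + y' ^ 2 = n)
    (hs : |x| ≤ y) (hs' : |x'| ≤ y') : (y - y') ^ 2 ≤ (x - x') ^ 2 := by
  have h1 : (y - y') * (y + y') = (x' - x) * (x' + x) := by nlinarith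
  have hy : 0 ≤ y := (abs_nonneg _).trans hs
  have hy' : 0 ≤ y' := (abs_nonneg _).trans hs'
  have h2 : (x' + x) ^ 2 ≤ (y + y') ^ 2 := by
    apply sq_le_sq'
    · have := neg_abs_le x; have := neg_abs_le x'; linarith
    · have := le_abs_self x; have := le_abs_self x'; linarith
  rcases (add_nonneg hy hy').lt_or_eq with hp | hp
  · have h3 : (y - y') ^ 2 * (y + y') ^ 2 ≤ (x - x') ^ 2 * (y + y') ^ 2 := by
      calc (y - y') ^ 2 * (y + y') ^ 2 = ((y - y') * (y + y')) ^ 2 := by ring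
        _ = (x - x') ^ 2 * (x' + x) ^ 2 := by rw [h1]; ring
        _ ≤ _ := by gcongr
    exact le_of_mul_le_mul_right h3 (by positivity)
  · have e1 : y = 0 := by linarith
    have e2 : y' = 0 := by linarith
    rw [e1, e2]
    simpa using sq_nonneg (x - x')

theorem card_sector_le {n t : ℕ} (hn : n ≤ t ^ 6) (ht : 1 ≤ t) (S : Finset (ℤ × ℤ))
    (hS : ∀ p ∈ S, p.1 ^ 2 + p.2 ^ 2 = n ∧ |p.1| ≤ p.2) : S.card ≤ 10 * t ^ 2 := by
  obtain ⟨b, hb1, hbt, hbn, hbl⟩ : ∃ b : ℕ, 1 ≤ b ∧ b ≤ t ∧ n ≤ 2 * b ^ 6 ∧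
      (0 < n → 2 * (b - 1) ^ 6 < n) := by
    have hex : ∃ b : ℕ, 1 ≤ b ∧ n ≤ 2 * b ^ 6 := ⟨t, ht, by omega⟩
    refine ⟨Nat.find hex, (Nat.find_spec hex).1, Nat.find_min' hex ⟨ht, by omega⟩,
      (Nat.find_spec hex).2, fun hn0 => ?_⟩
    by_contra hc
    push Not at hc
    rcases Nat.lt_or_ge (Nat.find hex - 1) 1 with h | h
    · have : Nat.find hex - 1 = 0 := by omega
      rw [this] at hc
      simp at hc
      omega
    · exact Nat.find_min hex (m := Nat.find hex - 1) (by omega) ⟨h, hc⟩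
  have hbpos : (0 : ℤ) < b := by exact_mod_cast hb1
  have hfib : ∀ a ∈ S.image (fun p => p.1 / (b : ℤ)),
      (S.filter (fun p => p.1 / (b : ℤ) = a)).card ≤ 2 := by
    intro a _
    by_contra hc
    push Not at hc
    obtain ⟨p, q, r, hp, hq, hr, hpq, hpr, hqr⟩ := Finset.two_lt_card_iff.1 hc
    rw [Finset.mem_filter] at hp hq hr
    have close : ∀ p q : ℤ × ℤ, p ∈ S ∧ p.1 / (b : ℤ) = a → q ∈ S ∧ q.1 / (b : ℤ) = a →
        (p.1 - q.1) ^ 2 + (p.2 - q.2) ^ 2 ≤ 2 * ((b : ℤ) - 1) ^ 2 := by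
      intro p q hp hq
      have h1 := sector_sub_sq_le (hS p hp.1).1 (hS q hq.1).1 (hS p hp.1).2 (hS q hq.1).2
      have e1 := Int.mul_ediv_add_emod p.1 b
      have e2 := Int.mul_ediv_add_emod q.1 b
      rw [hp.2] at e1
      rw [hq.2] at e2
      have m1 := Int.emod_nonneg p.1 hbpos.ne'
      have m2 := Int.emod_nonneg q.1 hbpos.ne'
      have m3 := Int.emod_lt_of_pos p.1 hbpos
      have m4 := Int.emod_lt_of_pos q.1 hbpos
      have : (p.1 - q.1) ^ 2 ≤ ((b : ℤ) - 1) ^ 2 := sq_le_sq' (by linarith) (by linarith)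
      linarith
    obtain ⟨hn0, hle⟩ := le_of_three_lattice_points (hS p hp.1).1 (hS q hq.1).1 (hS r hr.1).1
      hpq hqr hpr.symm (close p q hp hq) (close q r hq hr) (close r p hr hp)
    have := hbl (by exact_mod_cast hn0)
    have h2 : (2 : ℤ) * ((b : ℤ) - 1) ^ 6 < n := by
      have h3 : ((b - 1 : ℕ) : ℤ) = (b : ℤ) - 1 := by push_cast [hb1]; ring
      rw [← h3]
      exact_mod_cast this
    have h4 : (((b : ℤ) - 1) ^ 2) ^ 3 = ((b : ℤ) - 1) ^ 6 := by ring
    rw [h4] at hle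
    linarith
  have himg : S.image (fun p => p.1 / (b : ℤ)) ⊆
      Finset.Icc (-(2 * (b : ℤ) ^ 2)) (2 * (b : ℤ) ^ 2) := by
    intro a ha
    obtain ⟨p, hp, rfl⟩ := Finset.mem_image.1 ha
    have h1 : p.1 ^ 2 ≤ (2 * (b : ℤ) ^ 3) ^ 2 := by
      have h2 : (n : ℤ) ≤ 2 * (b : ℤ) ^ 6 := by exact_mod_cast hbn
      have h3 := (hS p hp).1
      have h4 : (0 : ℤ) < (b : ℤ) ^ 6 := by positivity
      nlinarith [sq_nonneg p.2]
    have h5 := abs_le_of_sq_le_sq' h1 (by positivity)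
    rw [Finset.mem_Icc]
    constructor
    · rw [Int.le_ediv_iff_mul_le hbpos]
      nlinarith [h5.1]
    · apply Int.ediv_le_of_le_mul hbpos
      nlinarith [h5.2]
  have h1 := Finset.card_le_mul_card_image S 2 hfib
  have h2 := Finset.card_le_card himg
  rw [Int.card_Icc] at h2
  have h3 : ((2 * (b : ℤ) ^ 2 + 1 - -(2 * (b : ℤ) ^ 2)).toNat) = 4 * b ^ 2 + 1 := by
    have : (2 * (b : ℤ) ^ 2 + 1 - -(2 * (b : ℤ) ^ 2)) = ((4 * b ^ 2 + 1 : ℕ) : ℤ) := by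
      push_cast; ring
    rw [this, Int.toNat_natCast]
  rw [h3] at h2
  have h4 : b ^ 2 ≤ t ^ 2 := Nat.pow_le_pow_left hbt 2
  have h5 : 1 ≤ b ^ 2 := Nat.one_le_pow _ _ hb1
  omega

theorem card_circle_le {n t : ℕ} (hn : n ≤ t ^ 6) (ht : 1 ≤ t) (S : Finset (ℤ × ℤ))
    (hS : ∀ p ∈ S, p.1 ^ 2 + p.2 ^ 2 = n) : S.card ≤ 40 * t ^ 2 := by
  have main : ∀ f : ℤ × ℤ → ℤ × ℤ, Function.Injective f →
      (∀ p, (f p).1 ^ 2 + (f p).2 ^ 2 = p.1 ^ 2 + p.2 ^ 2) →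
      (S.filter (fun p => |(f p).1| ≤ (f p).2)).card ≤ 10 * t ^ 2 := by
    intro f hf hfs
    rw [← Finset.card_image_of_injective _ hf]
    apply card_sector_le hn ht
    intro q hq
    obtain ⟨p, hp, rfl⟩ := Finset.mem_image.1 hq
    rw [Finset.mem_filter] at hp
    exact ⟨by rw [hfs, hS p hp.1], hp.2⟩
  have m1 := main id Function.injective_id (fun _ => rfl)
  have m2 := main (fun p => (p.1, -p.2)) (fun p q h => by
    simp only [Prod.mk.injEq, neg_inj] at h; exact Prod.ext h.1 h.2) (fun p => by simp)
  have m3 := main (fun p => (p.2, p.1)) (fun p q h => by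
    simp only [Prod.mk.injEq] at h; exact Prod.ext h.2 h.1) (fun p => by simp [add_comm])
  have m4 := main (fun p => (p.2, -p.1)) (fun p q h => by
    simp only [Prod.mk.injEq, neg_inj] at h; exact Prod.ext h.2 h.1) (fun p => by simp [add_comm])
  have hsub : S ⊆ (S.filter (fun p => |p.1| ≤ p.2) ∪ S.filter (fun p => |p.1| ≤ -p.2)) ∪
      (S.filter (fun p => |p.2| ≤ p.1) ∪ S.filter (fun p => |p.2| ≤ -p.1)) := by
    intro p hp
    simp only [Finset.mem_union, Finset.mem_filter, hp, true_and]
    rcases le_total |p.1| |p.2| with h | h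
    · left
      rcases abs_choice p.2 with h2 | h2 <;> rw [h2] at h
      · exact Or.inl h
      · exact Or.inr h
    · right
      rcases abs_choice p.1 with h2 | h2 <;> rw [h2] at h
      · exact Or.inl h
      · exact Or.inr h
  have h1 := Finset.card_le_card hsub
  have h2 := Finset.card_union_le
    (S.filter (fun p => |p.1| ≤ p.2) ∪ S.filter (fun p => |p.1| ≤ -p.2))
    (S.filter (fun p => |p.2| ≤ p.1) ∪ S.filter (fun p => |p.2| ≤ -p.1))
  have h3 := Finset.card_union_le (S.filter (fun p => |p.1| ≤ p.2))
    (S.filter (fun p => |p.1| ≤ -p.2))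
  have h4 := Finset.card_union_le (S.filter (fun p => |p.2| ≤ p.1))
    (S.filter (fun p => |p.2| ≤ -p.1))
  simp only [id] at m1
  simp only at m2 m3 m4
  omega

theorem card_sphere_le {n t : ℕ} (hn : n ≤ t ^ 6) (ht : 1 ≤ t) (S : Finset (ℤ × ℤ × ℤ))
    (hS : ∀ p ∈ S, p.1 ^ 2 + p.2.1 ^ 2 + p.2.2 ^ 2 = n) : S.card ≤ 120 * t ^ 5 := by
  have hfib : ∀ a ∈ S.image (fun p => p.1),
      (S.filter (fun p => p.1 = a)).card ≤ 40 * t ^ 2 := by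
    intro a _
    by_cases ha : a.natAbs ^ 2 ≤ n
    · rw [← Finset.card_image_of_injOn (f := fun p => p.2)]
      · apply card_circle_le (n := n - a.natAbs ^ 2) (by omega) ht
        intro q hq
        obtain ⟨p, hp, rfl⟩ := Finset.mem_image.1 hq
        rw [Finset.mem_filter] at hp
        have := hS p hp.1
        rw [hp.2] at this
        push_cast [ha]
        rw [sq_abs]
        linarith
      · intro p hp q hq h
        simp only [Finset.coe_filter, Set.mem_ofPred_eq] at hp hq
        exact Prod.ext (by rw [hp.2, hq.2]) h
    · rw [Finset.filter_false_of_mem]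
      · simp
      · intro p hp h
        apply ha
        have := hS p hp
        rw [h] at this
        zify
        rw [sq_abs]
        nlinarith [sq_nonneg p.2.1, sq_nonneg p.2.2]
  have himg : S.image (fun p => p.1) ⊆ Finset.Icc (-((t : ℤ) ^ 3)) ((t : ℤ) ^ 3) := by
    intro a ha
    obtain ⟨p, hp, rfl⟩ := Finset.mem_image.1 ha
    have h1 : p.1 ^ 2 ≤ ((t : ℤ) ^ 3) ^ 2 := by
      have h2 : (n : ℤ) ≤ (t : ℤ) ^ 6 := by exact_mod_cast hn
      have h3 := hS p hp
      nlinarith [sq_nonneg p.2.1, sq_nonneg p.2.2]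
    rw [Finset.mem_Icc]
    exact abs_le_of_sq_le_sq' h1 (by positivity)
  have h1 := Finset.card_le_mul_card_image S _ hfib
  have h2 := Finset.card_le_card himg
  rw [Int.card_Icc] at h2
  have h3 : (((t : ℤ) ^ 3 + 1 - -((t : ℤ) ^ 3)).toNat) = 2 * t ^ 3 + 1 := by
    have : ((t : ℤ) ^ 3 + 1 - -((t : ℤ) ^ 3)) = ((2 * t ^ 3 + 1 : ℕ) : ℤ) := by
      push_cast; ring
    rw [this, Int.toNat_natCast]
  rw [h3] at h2
  have h4 : 1 ≤ t ^ 3 := Nat.one_le_pow _ _ ht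
  calc S.card ≤ 40 * t ^ 2 * (S.image (fun p => p.1)).card := h1
    _ ≤ 40 * t ^ 2 * (3 * t ^ 3) := Nat.mul_le_mul_left _ (by omega)
    _ = 120 * t ^ 5 := by ring

/-- Integral quaternions of norm `M ^ 2` close to the scalar `M`. -/
theorem card_near_scalar_le {M D t : ℕ} (hM : 2 * M * D ≤ t ^ 6) (ht : 1 ≤ t) (S : Finset ℍ[ℤ])
    (hS : ∀ x ∈ S, normSq x = (M : ℤ) ^ 2 ∧ x.re < M ∧ (M : ℤ) ≤ x.re + D) :
    S.card ≤ 120 * t ^ 5 * D := by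
  have hfib : ∀ a ∈ S.image (fun x => x.re), (S.filter (fun x => x.re = a)).card ≤ 120 * t ^ 5 := by
    intro a ha
    obtain ⟨x₀, hx₀, hxa⟩ := Finset.mem_image.1 ha
    obtain ⟨h1, h2, h3⟩ := hS x₀ hx₀
    rw [hxa] at h2 h3
    rw [Quaternion.normSq_def', hxa] at h1
    obtain ⟨n, hn⟩ : ∃ n : ℕ, (n : ℤ) = (M : ℤ) ^ 2 - a ^ 2 :=
      ⟨((M : ℤ) ^ 2 - a ^ 2).toNat, Int.toNat_of_nonneg
        (by nlinarith [sq_nonneg x₀.imI, sq_nonneg x₀.imJ, sq_nonneg x₀.imK])⟩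
    rw [← Finset.card_image_of_injOn (f := fun x : ℍ[ℤ] => (x.imI, x.imJ, x.imK))]
    · apply card_sphere_le (n := n) _ ht
      · intro q hq
        obtain ⟨x, hx, rfl⟩ := Finset.mem_image.1 hq
        rw [Finset.mem_filter] at hx
        have h4 := (hS x hx.1).1
        rw [Quaternion.normSq_def', hx.2] at h4
        simp only
        linarith
      · zify
        have hM' : (2 : ℤ) * M * D ≤ t ^ 6 := by exact_mod_cast hM
        have : (M : ℤ) + a ≤ 2 * M := by linarith
        rcases le_or_gt 0 ((M : ℤ) + a) with h | h <;> nlinarith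
    · intro x hx y hy h
      simp only [Finset.coe_filter, Set.mem_ofPred_eq] at hx hy
      simp only [Prod.mk.injEq] at h
      ext
      · rw [hx.2, hy.2]
      · exact h.1
      · exact h.2.1
      · exact h.2.2
  have himg : S.image (fun x => x.re) ⊆ Finset.Ico ((M : ℤ) - D) M := by
    intro a ha
    obtain ⟨x, hx, rfl⟩ := Finset.mem_image.1 ha
    obtain ⟨h1, h2, h3⟩ := hS x hx
    rw [Finset.mem_Ico]
    constructor <;> linarith
  have h1 := Finset.card_le_mul_card_image S _ hfib
  have h2 := Finset.card_le_card himg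
  rw [Int.card_Ico] at h2
  have h3 : ((M : ℤ) - (M - D)).toNat = D := by
    rw [sub_sub_cancel, Int.toNat_natCast]
  rw [h3] at h2
  exact h1.trans (Nat.mul_le_mul_left _ h2)

end SphereEq

namespace SphereEq
open Quaternion

theorem winv_injective : Function.Injective winv := by
  intro u v h
  simp only [winv, List.reverse_inj] at h
  exact List.map_injective_iff.2 (fun a b => linv_inj.1) h

theorem head?_winv_getLast? {s : Letter} {w : List Letter} :
    (winv (s :: w)).getLast? = some (linv s) := by
  rw [winv_cons]; simp

/-- The pairs of reduced words of length `m` whose values are `δ`-close. -/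
def closePairs (m : ℕ) (δ : ℝ) : Finset (List Letter × List Letter) := by
  classical
  exact (W m ×ˢ W m).filter (fun p => ‖(evU p.1 : ℍ[ℝ]) - evU p.2‖ < δ)

theorem mem_closePairs {m : ℕ} {δ : ℝ} {p : List Letter × List Letter} :
    p ∈ closePairs m δ ↔ p.1 ∈ W m ∧ p.2 ∈ W m ∧ ‖(evU p.1 : ℍ[ℝ]) - evU p.2‖ < δ := by
  unfold closePairs
  rw [Finset.mem_filter, Finset.mem_product, and_assoc]

theorem norm_sub_sq_UQ (g h : UQ) :
    ‖(g : ℍ[ℝ]) - h‖ ^ 2 = 2 - 2 * (star (g : ℍ[ℝ]) * h).re := by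
  have h1 := normSq_UQ g
  have h2 := normSq_UQ h
  rw [norm_sq_quaternion]
  simp
  linarith

theorem re_ev_winv_append {m : ℕ} {w w' : List Letter} (hw : w.length = m) (hw' : w'.length = m) :
    5 ^ m * (star (evU w : ℍ[ℝ]) * evU w').re = ((ev ℤ (winv w ++ w')).re : ℝ) := by
  have h1 : ((ev ℤ (winv w ++ w')).re : ℝ) = (ev ℝ (winv w ++ w')).re := by
    rw [ev_cast (R := ℝ)]; simp
  rw [h1, ev_append, ev_winv, coe_evU, coe_evU, hw, hw']
  have h5 : (5 : ℝ) ^ m * ((√5)⁻¹ ^ m * (√5)⁻¹ ^ m) = 1 := by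
    rw [← mul_pow, ← mul_pow, ← mul_inv, Real.mul_self_sqrt (by norm_num)]
    norm_num
  rw [Quaternion.star_smul, smul_mul_smul_comm, Quaternion.re_smul, smul_eq_mul, ← mul_assoc, h5,
    one_mul]

theorem card_closePairs_head_ne {m t : ℕ} (hm : 1 ≤ m) (ht : 1 ≤ t) {δ : ℝ}
    (hδ : δ ^ 2 * 25 ^ m ≤ t ^ 6) :
    (((closePairs m δ).filter (fun p => p.1.head? ≠ p.2.head?)).card : ℝ) ≤
      60 * t ^ 5 * δ ^ 2 * 5 ^ m := by
  classical
  obtain ⟨D, hD⟩ : ∃ D, D = ⌊δ ^ 2 * 5 ^ m / 2⌋₊ := ⟨_, rfl⟩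
  have hDle : (D : ℝ) ≤ δ ^ 2 * 5 ^ m / 2 := by rw [hD]; exact Nat.floor_le (by positivity)
  set S := (closePairs m δ).filter (fun p => p.1.head? ≠ p.2.head?) with hS
  have hSm : ∀ p ∈ S, p.1.length = m ∧ p.2.length = m ∧ Red p.1 ∧ Red p.2 ∧
      ‖(evU p.1 : ℍ[ℝ]) - evU p.2‖ < δ ∧ Red (winv p.1 ++ p.2) := by
    intro p hp
    rw [hS, Finset.mem_filter, mem_closePairs, mem_W, mem_W] at hp
    obtain ⟨⟨⟨h1, h2⟩, ⟨h3, h4⟩, h5⟩, h6⟩ := hp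
    refine ⟨h1, h3, h2, h4, h5, red_append (red_winv h2) h4 ?_⟩
    obtain ⟨u, v⟩ := p
    cases u with
    | nil => simp at h1; omega
    | cons s u =>
      intro s' hs'
      rw [head?_winv_getLast?] at hs'
      simp only [Option.mem_def, Option.some.injEq] at hs'
      rw [← hs', linv_linv]
      simpa using h6.symm
  have hinj : Set.InjOn (fun p : List Letter × List Letter => ev ℤ (winv p.1 ++ p.2)) S := by
    intro p hp q hq h
    obtain ⟨a1, a2, a3, a4, a5, a6⟩ := hSm p hp
    obtain ⟨b1, b2, b3, b4, b5, b6⟩ := hSm q hq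
    have h1 := ev_injective a6 b6 (by simp [length_winv, a1, a2, b1, b2]) h
    have h2 := List.append_inj h1 (by simp [length_winv, a1, b1])
    exact Prod.ext (winv_injective h2.1) h2.2
  have hcard : S.card ≤ 120 * t ^ 5 * D := by
    rw [← Finset.card_image_of_injOn hinj]
    apply card_near_scalar_le (M := 5 ^ m) _ ht
    · intro z hz
      obtain ⟨p, hp, rfl⟩ := Finset.mem_image.1 hz
      obtain ⟨a1, a2, a3, a4, a5, a6⟩ := hSm p hp
      have hn : normSq (ev ℤ (winv p.1 ++ p.2)) = ((5 ^ m : ℕ) : ℤ) ^ 2 := by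
        rw [normSq_ev, List.length_append, length_winv, a1, a2]
        push_cast
        ring
      refine ⟨hn, ?_, ?_⟩
      · rw [Quaternion.normSq_def'] at hn
        generalize hx : ev ℤ (winv p.1 ++ p.2) = x at hn ⊢
        have hle : x.re ≤ ((5 ^ m : ℕ) : ℤ) := by
          apply le_of_sq_le_sq _ (by positivity)
          nlinarith [sq_nonneg x.imI, sq_nonneg x.imJ, sq_nonneg x.imK]
        refine lt_of_le_of_ne hle fun he => ?_
        rw [he] at hn
        have i1 : x.imI = 0 := by
          nlinarith [sq_nonneg x.imI, sq_nonneg x.imJ, sq_nonneg x.imK]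
        have i2 : x.imJ = 0 := by
          nlinarith [sq_nonneg x.imI, sq_nonneg x.imJ, sq_nonneg x.imK]
        have i3 : x.imK = 0 := by
          nlinarith [sq_nonneg x.imI, sq_nonneg x.imJ, sq_nonneg x.imK]
        obtain ⟨k, rfl⟩ : ∃ k, m = k + 1 := ⟨m - 1, by omega⟩
        apply ev_int_ne_five_mul a6 (qmk (5 ^ k) 0 0 0)
        rw [hx]
        ext
        · rw [he]; simp [-zsmul_eq_mul, pow_succ, mul_comm]
        · rw [i1]; simp [-zsmul_eq_mul]
        · rw [i2]; simp [-zsmul_eq_mul]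
        · rw [i3]; simp [-zsmul_eq_mul]
      · have h1 := norm_sub_sq_UQ (evU p.1) (evU p.2)
        have h2 := re_ev_winv_append a1 a2
        have h3 : ‖(evU p.1 : ℍ[ℝ]) - evU p.2‖ ^ 2 < δ ^ 2 := by
          apply pow_lt_pow_left₀ a5 (norm_nonneg _) two_ne_zero
        rw [h1] at h3
        have h4 : (5 : ℝ) ^ m * (2 - 2 * (star (evU p.1 : ℍ[ℝ]) * evU p.2).re) ≤ 5 ^ m * δ ^ 2 := by
          gcongr
        have h5 : ((((5 ^ m : ℕ) : ℤ) - (ev ℤ (winv p.1 ++ p.2)).re : ℤ) : ℝ) ≤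
            δ ^ 2 * 5 ^ m / 2 := by
          push_cast
          rw [← h2]
          linarith
        have h6 : ((5 ^ m : ℕ) : ℤ) - (ev ℤ (winv p.1 ++ p.2)).re ≤ ⌊δ ^ 2 * 5 ^ m / 2⌋ :=
          Int.le_floor.2 h5
        rw [hD, Int.natCast_floor_eq_floor (by positivity)]
        linarith
    · have : ((2 * 5 ^ m * D : ℕ) : ℝ) ≤ ((t ^ 6 : ℕ) : ℝ) := by
        push_cast
        refine le_trans ?_ hδ
        have e : (25 : ℝ) ^ m = 5 ^ m * 5 ^ m := by rw [← mul_pow]; norm_num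
        calc (2 : ℝ) * 5 ^ m * D ≤ 2 * 5 ^ m * (δ ^ 2 * 5 ^ m / 2) := by gcongr
          _ = δ ^ 2 * 25 ^ m := by rw [e]; ring
      exact_mod_cast this
  calc (S.card : ℝ) ≤ ((120 * t ^ 5 * D : ℕ) : ℝ) := by exact_mod_cast hcard
    _ = 120 * t ^ 5 * D := by push_cast; ring
    _ ≤ 120 * t ^ 5 * (δ ^ 2 * 5 ^ m / 2) := by gcongr
    _ = 60 * t ^ 5 * δ ^ 2 * 5 ^ m := by ring

theorem card_letters_le (o : Option Letter) (ho : o ≠ none) :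
    (Finset.univ.filter (fun s : Letter => o ≠ some (linv s))).card ≤ 5 := by
  revert o; decide

theorem card_closePairs_head_eq (m : ℕ) (δ : ℝ) :
    ((closePairs (m + 1) δ).filter (fun p => p.1.head? = p.2.head?)).card ≤
      (if m = 0 then 6 else 5) * (closePairs m δ).card := by
  classical
  set S := (closePairs (m + 1) δ).filter (fun p => p.1.head? = p.2.head?) with hS
  have hSm : ∀ p ∈ S, ∃ s u v, p = (s :: u, s :: v) ∧ (u, v) ∈ closePairs m δ ∧
      u.head? ≠ some (linv s) := by
    intro p hp
    rw [hS, Finset.mem_filter, mem_closePairs, mem_W, mem_W] at hp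
    obtain ⟨⟨⟨h1, h2⟩, ⟨h3, h4⟩, h5⟩, h6⟩ := hp
    obtain ⟨u, v⟩ := p
    cases u with
    | nil => simp at h1
    | cons s u =>
    cases v with
    | nil => simp at h3
    | cons s' v =>
    simp only [List.head?_cons, Option.some.injEq] at h6
    subst h6
    refine ⟨s, u, v, rfl, ?_, h2.1⟩
    rw [mem_closePairs, mem_W, mem_W]
    refine ⟨⟨by simpa using h1, h2.2⟩, ⟨by simpa using h3, h4.2⟩, ?_⟩
    simp only [evU_cons] at h5
    have : ((qU s * evU u : UQ) : ℍ[ℝ]) - ((qU s * evU v : UQ) : ℍ[ℝ]) =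
      (qU s : ℍ[ℝ]) * ((evU u : ℍ[ℝ]) - evU v) := by
      simp [mul_sub]
    rw [this, norm_mul] at h5
    simpa using h5
  have himg : S.image (fun p => (p.1.tail, p.2.tail)) ⊆ closePairs m δ := by
    intro q hq
    obtain ⟨p, hp, rfl⟩ := Finset.mem_image.1 hq
    obtain ⟨s, u, v, rfl, h, -⟩ := hSm p hp
    exact h
  refine (Finset.card_le_mul_card_image S (if m = 0 then 6 else 5) ?_).trans
    (Nat.mul_le_mul_left _ (Finset.card_le_card himg))
  intro a ha
  have ha' := himg ha
  have hsub : (S.filter (fun p => (p.1.tail, p.2.tail) = a)) ⊆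
      (Finset.univ.filter (fun s : Letter => a.1.head? ≠ some (linv s))).image
        (fun s => (s :: a.1, s :: a.2)) := by
    intro p hp
    rw [Finset.mem_filter] at hp
    obtain ⟨s, u, v, rfl, h, h'⟩ := hSm p hp.1
    rw [← hp.2]
    rw [Finset.mem_image]
    exact ⟨s, Finset.mem_filter.2 ⟨Finset.mem_univ _, h'⟩, rfl⟩
  refine (Finset.card_le_card hsub).trans (Finset.card_image_le.trans ?_)
  split_ifs with h
  · exact (Finset.card_le_univ _).trans (by decide)
  · apply card_letters_le
    intro hn
    rw [mem_closePairs, mem_W, mem_W] at ha'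
    rw [List.head?_eq_none_iff] at hn
    rw [hn] at ha'
    exact h ha'.1.1.symm

theorem card_closePairs_le {m t : ℕ} (ht : 1 ≤ t) {δ : ℝ} (hδ0 : 0 ≤ δ)
    (hδ : δ ^ 2 * 25 ^ m ≤ t ^ 6) (hδt : δ ^ 2 * t ^ 5 ≤ 1) :
    ((closePairs m δ).card : ℝ) ≤ (2 + 60 * m) * 5 ^ m := by
  induction m with
  | zero =>
    have : (closePairs 0 δ).card ≤ 1 := by
      unfold closePairs
      refine (Finset.card_filter_le _ _).trans ?_
      simp [W]
    have : ((closePairs 0 δ).card : ℝ) ≤ 1 := by exact_mod_cast this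
    simp
    linarith
  | succ m ih =>
    have h1 : ((closePairs (m + 1) δ).card : ℝ) ≤
        (if m = 0 then 6 else 5) * (closePairs m δ).card + 60 * t ^ 5 * δ ^ 2 * 5 ^ (m + 1) := by
      rw [← Finset.card_filter_add_card_filter_not (fun p => p.1.head? = p.2.head?)]
      push_cast
      gcongr
      · exact_mod_cast card_closePairs_head_eq m δ
      · exact card_closePairs_head_ne (by omega) ht hδ
    have h2 : 60 * t ^ 5 * δ ^ 2 * 5 ^ (m + 1) ≤ (60 : ℝ) * 5 ^ (m + 1) := by
      have : 60 * t ^ 5 * δ ^ 2 * 5 ^ (m + 1) = 60 * (δ ^ 2 * t ^ 5) * 5 ^ (m + 1) := by ring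
      rw [this]
      have : 60 * (δ ^ 2 * t ^ 5) * 5 ^ (m + 1) ≤ 60 * 1 * (5 : ℝ) ^ (m + 1) := by gcongr
      linarith
    by_cases hm : m = 0
    · subst hm
      have : (closePairs 0 δ).card ≤ 1 := by
        unfold closePairs
        refine (Finset.card_filter_le _ _).trans ?_
        simp [W]
      have : ((closePairs 0 δ).card : ℝ) ≤ 1 := by exact_mod_cast this
      simp at h1 h2 ⊢
      linarith
    · have h3 := ih (le_trans (by gcongr <;> norm_num) hδ)
      rw [if_neg hm] at h1
      push_cast
      have e : (5 : ℝ) ^ (m + 1) = 5 * 5 ^ m := by ring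
      rw [e] at h1 h2 ⊢
      linarith

end SphereEq

namespace SphereEq
open Quaternion

theorem sum_W_succ {M : Type*} [AddCommMonoid M] (m : ℕ) (F : List Letter → M) :
    ∑ w ∈ W (m + 1), F w = ∑ p ∈ (Finset.univ ×ˢ W m).filter
      (fun p : Letter × List Letter => p.2.head? ≠ some (linv p.1)), F (p.1 :: p.2) := by
  rw [W, Finset.sum_image]
  intro p _ q _ h
  simp only [List.cons.injEq] at h
  exact Prod.ext h.1 h.2

theorem sum_letters_W {M : Type*} [AddCommMonoid M] (m : ℕ) (f : UQ → M) :
    ∑ s, ∑ w ∈ W (m + 1), f (qU s * evU w) = ∑ w ∈ W (m + 2), f (evU w) +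
      (if m = 0 then 6 else 5) • ∑ u ∈ W m, f (evU u) := by
  classical
  rw [← Finset.sum_product', ← Finset.sum_filter_add_sum_filter_not _
    (fun p : Letter × List Letter => p.2.head? ≠ some (linv p.1)),
    sum_W_succ (m + 1) (fun w => f (evU w))]
  congr 1
  have h1 : ∑ p ∈ ((Finset.univ ×ˢ W (m + 1)).filter
      (fun p : Letter × List Letter => ¬ p.2.head? ≠ some (linv p.1))), f (qU p.1 * evU p.2) =
      ∑ p ∈ ((Finset.univ ×ˢ W m).filter
      (fun p : Letter × List Letter => p.2.head? ≠ some p.1)), f (evU p.2) := by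
    symm
    apply Finset.sum_bij (fun p _ => (p.1, linv p.1 :: p.2))
    · rintro ⟨s, u⟩ h
      simp only [Finset.mem_filter, Finset.mem_product, Finset.mem_univ, true_and, mem_W] at h ⊢
      simp only [List.length_cons, List.head?_cons, ne_eq, not_true_eq_false, not_false_eq_true,
        and_true]
      exact ⟨by rw [h.1.1], by rw [red_cons, linv_linv]; exact ⟨h.2, h.1.2⟩⟩
    · rintro ⟨s, u⟩ _ ⟨s', u'⟩ _ h
      simp only [Prod.mk.injEq, List.cons.injEq] at h
      rw [h.1, h.2.2]
    · rintro ⟨s, w⟩ h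
      simp only [Finset.mem_filter, Finset.mem_product, Finset.mem_univ, true_and, mem_W,
        not_not, ne_eq] at h
      cases w with
      | nil => simp at h
      | cons s' u =>
        simp only [List.head?_cons, Option.some.injEq] at h
        obtain ⟨⟨h1, h2⟩, h3⟩ := h
        subst h3
        refine ⟨(s, u), ?_, rfl⟩
        simp only [Finset.mem_filter, Finset.mem_product, Finset.mem_univ, true_and, mem_W]
        rw [red_cons, linv_linv] at h2
        exact ⟨⟨by simpa using h1, h2.2⟩, h2.1⟩
    · rintro ⟨s, u⟩ _
      simp only [evU_cons, qU_linv, mul_inv_cancel_left]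
  rw [h1, Finset.sum_filter, Finset.sum_product_right, Finset.smul_sum]
  apply Finset.sum_congr rfl
  intro u hu
  simp only
  rw [← Finset.sum_filter, Finset.sum_const]
  congr 1
  rw [mem_W] at hu
  cases u with
  | nil =>
    simp only [List.length_nil] at hu
    rw [if_pos hu.1.symm]
    decide
  | cons s u =>
    simp only [List.length_cons] at hu
    rw [if_neg (by omega)]
    have h5 : ∀ o : Option Letter, o ≠ none →
        (Finset.univ.filter (fun a : Letter => o ≠ some a)).card = 5 := by
      decide
    convert h5 (s :: u).head? (by simp) using 2

/-- Haar probability measure on the unit quaternions. -/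
def nu : Measure UQ := Measure.haarMeasure ⊤

instance : nu.IsHaarMeasure := by unfold nu; infer_instance

instance : IsProbabilityMeasure nu := ⟨by
  have := Measure.haarMeasure_self (G := UQ) (K₀ := ⊤)
  simpa [nu] using this⟩

theorem nu_eq_of_left_invariant (ρ : Measure UQ) [IsProbabilityMeasure ρ] [ρ.IsMulLeftInvariant] :
    ρ = nu := by
  have := Measure.isMulInvariant_eq_smul_of_compactSpace ρ nu
  rw [this]
  have h1 : ρ univ = 1 := measure_univ
  rw [this] at h1
  simp only [Measure.smul_apply, measure_univ] at h1
  have h2 : Measure.haarScalarFactor ρ nu = 1 := by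
    have : ((Measure.haarScalarFactor ρ nu : NNReal) : ℝ≥0∞) = 1 := by
      simpa [ENNReal.smul_def] using h1
    exact_mod_cast this
  rw [h2, one_smul]

instance : nu.IsMulRightInvariant := ⟨fun g => by
  have h : Measurable fun x : UQ => x * g := measurable_mul_const g
  have : IsProbabilityMeasure (Measure.map (fun x => x * g) nu) :=
    Measure.isProbabilityMeasure_map h.aemeasurable
  have : (Measure.map (fun x => x * g) nu).IsMulLeftInvariant := ⟨fun a => by
    rw [Measure.map_map (measurable_const_mul a) h]
    have : ((fun x => a * x) ∘ fun x => x * g) = (fun x => x * g) ∘ fun x => a * x := by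
      funext x; simp [mul_assoc]
    rw [this, ← Measure.map_map h (measurable_const_mul a), map_mul_left_eq_self]⟩
  exact nu_eq_of_left_invariant _⟩

instance : nu.IsInvInvariant := ⟨by
  have : IsProbabilityMeasure nu.inv :=
    Measure.isProbabilityMeasure_map measurable_inv.aemeasurable
  exact nu_eq_of_left_invariant _⟩

/-- The ball of radius `δ` around `1`. -/
def cap (δ : ℝ) : Set UQ := {h | ‖(h : ℍ[ℝ]) - 1‖ < δ}

theorem isOpen_cap (δ : ℝ) : IsOpen (cap δ) :=
  isOpen_lt (by fun_prop) continuous_const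

theorem norm_mul_UQ (g : UQ) (x : ℍ[ℝ]) : ‖(g : ℍ[ℝ]) * x‖ = ‖x‖ := by simp

theorem norm_UQ_mul (g : UQ) (x : ℍ[ℝ]) : ‖x * (g : ℍ[ℝ])‖ = ‖x‖ := by simp

theorem mul_inv_mem_cap {δ : ℝ} {g h : UQ} :
    h * g⁻¹ ∈ cap δ ↔ ‖(h : ℍ[ℝ]) - g‖ < δ := by
  unfold cap
  rw [Set.mem_ofPred_eq, ← norm_UQ_mul g]
  have : (((h * g⁻¹ : UQ) : ℍ[ℝ]) - 1) * g = (h : ℍ[ℝ]) - g := by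
    have h2 : ((h * g⁻¹ : UQ) : ℍ[ℝ]) * g = ((h * g⁻¹ * g : UQ) : ℍ[ℝ]) := rfl
    rw [sub_mul, h2, inv_mul_cancel_right, one_mul]
  rw [this]

theorem conj_mem_cap {δ : ℝ} {g h : UQ} : g * h * g⁻¹ ∈ cap δ ↔ h ∈ cap δ := by
  rw [mul_inv_mem_cap]
  have : ((g * h : UQ) : ℍ[ℝ]) - g = g * ((h : ℍ[ℝ]) - 1) := by simp [mul_sub]
  rw [this, norm_mul_UQ]
  rfl

theorem inv_mem_cap {δ : ℝ} {h : UQ} : h⁻¹ ∈ cap δ ↔ h ∈ cap δ := by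
  rw [← one_mul h⁻¹, mul_inv_mem_cap, norm_sub_rev]
  rfl

/-- The coordinates of a quaternion. -/
def co (x : ℍ[ℝ]) : Fin 4 → ℝ := ![x.re, x.imI, x.imJ, x.imK]

theorem sum_co_sq (x : ℍ[ℝ]) : ∑ i, co x i ^ 2 = ‖x‖ ^ 2 := by
  rw [norm_sq_quaternion, Fin.sum_univ_four]; simp [co]

theorem co_sub (x y : ℍ[ℝ]) (i : Fin 4) : co (x - y) i = co x i - co y i := by
  fin_cases i <;> simp [co]

theorem sq_co_le (h : UQ) (i : Fin 4) : co h i ^ 2 ≤ 1 := by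
  have h1 := sum_co_sq h
  have h2 := Finset.single_le_sum (f := fun i => co h i ^ 2) (fun i _ => sq_nonneg _)
    (Finset.mem_univ i)
  simp only [norm_eq_of_mem_sphere] at h1
  linarith

/-- Unit quaternions in a common cell of a grid are close. -/
theorem norm_sub_lt_of_cell {N : ℕ} (hN : 1 ≤ N) (i : Fin 4) {g h : UQ}
    (hg : 1 / 4 ≤ co g i ^ 2) (hh : 1 / 4 ≤ co h i ^ 2) (hs : 0 ≤ co g i ↔ 0 ≤ co h i)
    (hj : ∀ j : Fin 3, ⌊N * co g (i.succAbove j)⌋ = ⌊N * co h (i.succAbove j)⌋) :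
    ‖(h : ℍ[ℝ]) - g‖ < 10 / N := by
  have hN' : (0 : ℝ) < N := by exact_mod_cast hN
  have d : ∀ j : Fin 3, |co h (i.succAbove j) - co g (i.succAbove j)| ≤ 1 / N := by
    intro j
    have := (Int.abs_sub_lt_one_of_floor_eq_floor (hj j)).le
    rw [← mul_sub, abs_mul, abs_of_pos hN', abs_sub_comm] at this
    rw [le_div_iff₀ hN', mul_comm]
    exact this
  have s : ∀ j, |co h j + co g j| ≤ 2 := by
    intro j
    have h1 := (sq_le_one_iff_abs_le_one _).1 (sq_co_le h j)
    have h2 := (sq_le_one_iff_abs_le_one _).1 (sq_co_le g j)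
    exact (abs_add_le _ _).trans (by linarith)
  have e : (co h i - co g i) * (co h i + co g i) =
      -∑ j : Fin 3, (co h (i.succAbove j) - co g (i.succAbove j)) *
        (co h (i.succAbove j) + co g (i.succAbove j)) := by
    have h1 := sum_co_sq h
    have h2 := sum_co_sq g
    rw [Fin.sum_univ_succAbove _ i, norm_eq_of_mem_sphere] at h1 h2
    have h3 : ∑ j : Fin 3, (co h (i.succAbove j) - co g (i.succAbove j)) *
        (co h (i.succAbove j) + co g (i.succAbove j)) =
        ∑ j : Fin 3, co h (i.succAbove j) ^ 2 - ∑ j : Fin 3, co g (i.succAbove j) ^ 2 := by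
      rw [← Finset.sum_sub_distrib]
      apply Finset.sum_congr rfl
      intro j _
      ring
    rw [h3]
    linarith
  have hi : 1 ≤ |co h i + co g i| := by
    have a1 : 1 / 2 ≤ |co g i| := by
      by_contra hc
      nlinarith [sq_abs (co g i), abs_nonneg (co g i)]
    have a2 : 1 / 2 ≤ |co h i| := by
      by_contra hc
      nlinarith [sq_abs (co h i), abs_nonneg (co h i)]
    by_cases h0 : 0 ≤ co g i
    · have h1 := hs.1 h0
      rw [abs_of_nonneg h0] at a1
      rw [abs_of_nonneg h1] at a2
      rw [abs_of_nonneg (add_nonneg h1 h0)]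
      linarith
    · have h1 := not_le.1 fun h => h0 (hs.2 h)
      rw [not_le] at h0
      rw [abs_of_neg h0] at a1
      rw [abs_of_neg h1] at a2
      rw [abs_of_neg (by linarith)]
      linarith
  have di : |co h i - co g i| ≤ 6 / N := by
    calc |co h i - co g i| ≤ |co h i - co g i| * |co h i + co g i| :=
          le_mul_of_one_le_right (abs_nonneg _) hi
      _ = |∑ j : Fin 3, (co h (i.succAbove j) - co g (i.succAbove j)) *
        (co h (i.succAbove j) + co g (i.succAbove j))| := by rw [← abs_mul, e, abs_neg]
      _ ≤ ∑ j : Fin 3, |(co h (i.succAbove j) - co g (i.succAbove j)) *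
        (co h (i.succAbove j) + co g (i.succAbove j))| := Finset.abs_sum_le_sum_abs _ _
      _ ≤ ∑ j : Fin 3, 1 / (N : ℝ) * 2 := by
        apply Finset.sum_le_sum
        intro j _
        rw [abs_mul]
        exact mul_le_mul (d j) (s _) (abs_nonneg _) (by positivity)
      _ = 6 / N := by rw [Fin.sum_const]; simp; ring
  have h1 := sum_co_sq ((h : ℍ[ℝ]) - g)
  rw [Fin.sum_univ_succAbove _ i] at h1
  simp only [co_sub] at h1
  have h2 : (co h i - co g i) ^ 2 ≤ (6 / N) ^ 2 :=
    sq_le_sq' (by linarith [neg_abs_le (co h i - co g i)])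
    (le_trans (le_abs_self _) di)
  have h3 : ∑ j : Fin 3, (co h (i.succAbove j) - co g (i.succAbove j)) ^ 2 ≤
      ∑ j : Fin 3, (1 / (N : ℝ)) ^ 2 := by
    apply Finset.sum_le_sum
    intro j _
    rw [← sq_abs]
    exact pow_le_pow_left₀ (abs_nonneg _) (d j) 2
  rw [Fin.sum_const] at h3
  apply lt_of_pow_lt_pow_left₀ 2 (by positivity)
  rw [← h1]
  have h4 : (6 / (N : ℝ)) ^ 2 + 3 • (1 / (N : ℝ)) ^ 2 < (10 / N) ^ 2 := by
    have : (0 : ℝ) < (1 / N) ^ 2 := by positivity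
    have e1 : (6 / (N : ℝ)) ^ 2 = 36 * (1 / N) ^ 2 := by ring
    have e2 : (10 / (N : ℝ)) ^ 2 = 100 * (1 / N) ^ 2 := by ring
    rw [e1, e2, nsmul_eq_mul]
    push_cast
    linarith
  linarith

theorem nu_cap_grid (N : ℕ) (hN : 1 ≤ N) : 1 ≤ 216 * (N : ℝ≥0∞) ^ 3 * nu (cap (10 / N)) := by
  have hN' : (0 : ℝ) < N := by exact_mod_cast hN
  set cell : Fin 4 → Bool → (Fin 3 → ℤ) → Set UQ := fun i b z =>
    {h | 1 / 4 ≤ co h i ^ 2 ∧ (0 ≤ co h i ↔ b = true) ∧ ∀ j, ⌊N * co h (i.succAbove j)⌋ = z j}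
    with hcell
  have hle : ∀ i b z, nu (cell i b z) ≤ nu (cap (10 / N)) := by
    intro i b z
    rcases (cell i b z).eq_empty_or_nonempty with he | ⟨g, hg⟩
    · rw [he]; simp
    · rw [← measure_preimage_mul_right nu g⁻¹ (cap (10 / N))]
      apply measure_mono
      intro h hh
      rw [mem_preimage, mul_inv_mem_cap]
      exact norm_sub_lt_of_cell hN i hg.1 hh.1 (hg.2.1.trans hh.2.1.symm)
        (fun j => (hg.2.2 j).trans (hh.2.2 j).symm)
  set T : Finset (Fin 4 × Bool × (Fin 3 → ℤ)) := Finset.univ ×ˢ Finset.univ ×ˢ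
    Fintype.piFinset (fun _ : Fin 3 => Finset.Icc (-(N : ℤ)) N) with hT
  have hcov : (univ : Set UQ) ⊆ ⋃ p ∈ T, cell p.1 p.2.1 p.2.2 := by
    intro h _
    obtain ⟨i, hi⟩ : ∃ i, 1 / 4 ≤ co h i ^ 2 := by
      by_contra hc
      push Not at hc
      have h1 := sum_co_sq h
      rw [norm_eq_of_mem_sphere, Fin.sum_univ_four] at h1
      linarith [hc 0, hc 1, hc 2, hc 3]
    rw [mem_iUnion₂]
    refine ⟨(i, decide (0 ≤ co h i), fun j => ⌊N * co h (i.succAbove j)⌋), ?_, hi, by simp,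
      fun j => rfl⟩
    rw [hT]
    simp only [Finset.mem_product, Finset.mem_univ, true_and, Fintype.mem_piFinset, Finset.mem_Icc]
    intro j
    have h1 := abs_le.1 ((sq_le_one_iff_abs_le_one _).1 (sq_co_le h (i.succAbove j)))
    constructor
    · rw [Int.le_floor]
      push_cast
      nlinarith
    · rw [Int.floor_le_iff]
      push_cast
      nlinarith
  have hTc : T.card = 8 * (2 * N + 1) ^ 3 := by
    rw [hT, Finset.card_product, Finset.card_product, Fintype.card_piFinset_const, Int.card_Icc]
    have : ((N : ℤ) + 1 - -(N : ℤ)).toNat = 2 * N + 1 := by omega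
    rw [this]
    simp
    ring
  calc (1 : ℝ≥0∞) = nu univ := measure_univ.symm
    _ ≤ nu (⋃ p ∈ T, cell p.1 p.2.1 p.2.2) := measure_mono hcov
    _ ≤ ∑ p ∈ T, nu (cell p.1 p.2.1 p.2.2) := measure_biUnion_finset_le _ _
    _ ≤ ∑ p ∈ T, nu (cap (10 / N)) := Finset.sum_le_sum fun p _ => hle _ _ _
    _ = ((8 * (2 * N + 1) ^ 3 : ℕ) : ℝ≥0∞) * nu (cap (10 / N)) := by
      rw [Finset.sum_const, hTc, nsmul_eq_mul]
    _ ≤ 216 * (N : ℝ≥0∞) ^ 3 * nu (cap (10 / N)) := by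
      gcongr
      have : 8 * (2 * N + 1) ^ 3 ≤ 216 * N ^ 3 := by
        calc 8 * (2 * N + 1) ^ 3 ≤ 8 * (3 * N) ^ 3 := by gcongr; omega
          _ = 216 * N ^ 3 := by ring
      exact_mod_cast this

/-- The ball of radius `δ` has measure at least a constant times `δ ^ 3`. -/
theorem nu_cap_ge {N : ℕ} (hN : 1 ≤ N) :
    (1 : ℝ) ≤ 216000 * (N : ℝ) ^ 3 * nu.real (cap (1 / N)) := by
  have h := nu_cap_grid (10 * N) (by omega)
  have e : (10 : ℝ) / ((10 * N : ℕ) : ℝ) = 1 / N := by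
    push_cast
    rw [← div_div, div_self (by norm_num)]
  rw [e] at h
  have h2 := ENNReal.toReal_mono (by finiteness) h
  rw [ENNReal.toReal_mul, ENNReal.toReal_mul, ENNReal.toReal_pow] at h2
  simp only [ENNReal.toReal_one, ENNReal.toReal_ofNat, ENNReal.toReal_natCast] at h2
  push_cast at h2
  unfold Measure.real
  linarith

end SphereEq

namespace SphereEq
open Quaternion

open scoped RealInnerProductSpace

section Rep

variable {V : Type*} [NormedAddCommGroup V] [InnerProductSpace ℝ V]

/-- The number `a` with `(∑ w ∈ W (j + 1), π w) v = a v` when `v` is an eigenvector with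
eigenvalue `l`. -/
def wordEig (l : ℝ) : ℕ → ℝ
  | 0 => l
  | 1 => l ^ 2 - 6
  | j + 2 => l * wordEig l (j + 1) - 5 * wordEig l j

theorem wordEig_ge {l : ℝ} (hl : 5.93 ≤ l) (j : ℕ) : 4.9 ^ (j + 1) ≤ wordEig l j := by
  have h : 4.9 ^ (j + 1) ≤ wordEig l j ∧ 4.9 * wordEig l j ≤ wordEig l (j + 1) := by
    induction j with
    | zero =>
      simp only [wordEig]
      constructor
      · norm_num; linarith
      · nlinarith
    | succ j ih =>
      have hp : (0 : ℝ) < 4.9 ^ (j + 1) := by positivity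
      constructor
      · rw [pow_succ]; linarith [ih.1, ih.2]
      · simp only [wordEig]
        nlinarith [ih.1, ih.2]
  exact h.1

/-- The sum of the six generators in a representation. -/
def genSum (π : UQ →* (V ≃ₗᵢ[ℝ] V)) : V →ₗ[ℝ] V :=
  ∑ s : Letter, ((π (qU s)).toLinearEquiv : V →ₗ[ℝ] V)

theorem genSum_apply (π : UQ →* (V ≃ₗᵢ[ℝ] V)) (v : V) :
    genSum π v = ∑ s : Letter, π (qU s) v := by
  simp [genSum, LinearMap.sum_apply]

theorem rep_mul (π : UQ →* (V ≃ₗᵢ[ℝ] V)) (g h : UQ) (v : V) : π (g * h) v = π g (π h v) := by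
  rw [map_mul]; rfl

theorem inner_rep (π : UQ →* (V ≃ₗᵢ[ℝ] V)) (g : UQ) (u v : V) :
    ⟪π g u, v⟫ = ⟪u, π g⁻¹ v⟫ := by
  rw [← (π g⁻¹).inner_map_map, ← rep_mul, inv_mul_cancel, map_one]
  rfl

theorem genSum_isSymmetric (π : UQ →* (V ≃ₗᵢ[ℝ] V)) : (genSum π).IsSymmetric := by
  intro u v
  rw [genSum_apply, genSum_apply, sum_inner, inner_sum]
  apply Finset.sum_bij (fun s _ => linv s)
  · simp
  · intro a _ b _ h; exact linv_inj.1 h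
  · intro b _; exact ⟨linv b, by simp, by simp⟩
  · intro s _
    rw [inner_rep, qU_linv]

theorem sum_W_rep {π : UQ →* (V ≃ₗᵢ[ℝ] V)} {l : ℝ} {v : V} (hv : genSum π v = l • v) (j : ℕ) :
    ∑ w ∈ W (j + 1), π (evU w) v = wordEig l j • v := by
  have key : ∀ m, genSum π (∑ w ∈ W (m + 1), π (evU w) v) = ∑ w ∈ W (m + 2), π (evU w) v +
      (if m = 0 then 6 else 5) • ∑ u ∈ W m, π (evU u) v := by
    intro m
    rw [← sum_letters_W m (fun g => π g v), genSum_apply]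
    apply Finset.sum_congr rfl
    intro s _
    rw [map_sum]
    apply Finset.sum_congr rfl
    intro w _
    rw [rep_mul]
  have h0 : ∑ w ∈ W 0, π (evU w) v = v := by simp [W, evU]
  have h1 : ∑ w ∈ W 1, π (evU w) v = l • v := by
    rw [← hv, genSum_apply, sum_W_succ]
    simp [W, Finset.sum_filter, evU]
  suffices h : ∑ w ∈ W (j + 1), π (evU w) v = wordEig l j • v ∧
      ∑ w ∈ W (j + 2), π (evU w) v = wordEig l (j + 1) • v from h.1
  induction j with
  | zero =>
    refine ⟨h1, ?_⟩
    have := key 0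
    rw [zero_add, h0, h1, map_smul, hv, if_pos rfl] at this
    replace this := eq_sub_of_add_eq this.symm
    rw [this]
    simp only [wordEig, sub_smul, smul_smul, pow_two]
    congr 1
    rw [← Nat.cast_smul_eq_nsmul ℝ]
    norm_num
  | succ j ih =>
    refine ⟨ih.2, ?_⟩
    have := key (j + 1)
    rw [ih.1, ih.2, map_smul, hv, if_neg (by omega)] at this
    replace this := eq_sub_of_add_eq this.symm
    rw [this]
    simp only [wordEig, sub_smul, smul_smul]
    rw [mul_comm]
    congr 1
    rw [← Nat.cast_smul_eq_nsmul ℝ, smul_smul]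
    norm_num

/-- Symmetric operators commuting with the representation are scalars. -/
def SchurProp (π : UQ →* (V ≃ₗᵢ[ℝ] V)) : Prop :=
  ∀ L : V →ₗ[ℝ] V, L.IsSymmetric → (∀ g v, L (π g v) = π g (L v)) → ∃ c : ℝ, ∀ v, L v = c • v

theorem integrable_nu {F : Type*} [NormedAddCommGroup F] {f : UQ → F} (hf : Continuous f) :
    Integrable f nu := by
  rw [← integrableOn_univ]
  exact hf.continuousOn.integrableOn_compact isCompact_univ

variable [FiniteDimensional ℝ V]

theorem integral_sq_inner {π : UQ →* (V ≃ₗᵢ[ℝ] V)} (hc : ∀ v, Continuous fun h => π h v)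
    (hS : SchurProp π) (v : V) :
    Module.finrank ℝ V * ∫ h, ⟪π h v, v⟫ ^ 2 ∂nu = ‖v‖ ^ 4 := by
  have hci : ∀ u, Continuous fun h => ⟪π h v, u⟫ := fun u => (hc v).inner continuous_const
  have hcs : ∀ u, Continuous fun h => ⟪π h v, u⟫ • π h v := fun u => (hci u).smul (hc v)
  let L : V →ₗ[ℝ] V :=
    { toFun := fun u => ∫ h, ⟪π h v, u⟫ • π h v ∂nu
      map_add' := fun u u' => by
        simp only [inner_add_right, add_smul]
        rw [integral_add (integrable_nu (hcs u)) (integrable_nu (hcs u'))]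
      map_smul' := fun c u => by
        simp only [inner_smul_right, mul_smul, RingHom.id_apply]
        rw [integral_smul] }
  have hLi : ∀ u u', ⟪L u, u'⟫ = ∫ h, ⟪π h v, u⟫ * ⟪π h v, u'⟫ ∂nu := by
    intro u u'
    have := integral_inner (𝕜 := ℝ) (integrable_nu (hcs u)) u'
    rw [real_inner_comm]
    change ⟪u', ∫ h, ⟪π h v, u⟫ • π h v ∂nu⟫ = _
    rw [← this]
    congr 1
    funext h
    rw [inner_smul_right, real_inner_comm u']
  obtain ⟨c, hcL⟩ := hS L (by
      intro u u'
      rw [hLi, real_inner_comm, hLi]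
      simp only [mul_comm]) (by
      intro g u
      change ∫ h, ⟪π h v, π g u⟫ • π h v ∂nu = π g (∫ h, ⟪π h v, u⟫ • π h v ∂nu)
      have h1 := (π g).toContinuousLinearEquiv.integral_comp_comm (μ := nu)
        (fun h => ⟪π h v, u⟫ • π h v)
      rw [← integral_mul_left_eq_self (fun h => ⟪π h v, π g u⟫ • π h v) g]
      refine Eq.trans ?_ h1
      congr 1
      funext h
      simp only [rep_mul, LinearIsometryEquiv.inner_map_map,
        LinearIsometryEquiv.coe_toContinuousLinearEquiv,
        map_smul])
  have htr : ∑ i, ⟪L (stdOrthonormalBasis ℝ V i), stdOrthonormalBasis ℝ V i⟫ = ‖v‖ ^ 2 := by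
    simp only [hLi]
    rw [← integral_finsetSum]
    swap
    · exact fun i _ => integrable_nu ((hci _).mul (hci _))
    have : ∀ h, ∑ i, ⟪π h v, stdOrthonormalBasis ℝ V i⟫ * ⟪π h v, stdOrthonormalBasis ℝ V i⟫ =
        ‖v‖ ^ 2 := by
      intro h
      have := (stdOrthonormalBasis ℝ V).sum_inner_mul_inner (π h v) (π h v)
      rw [real_inner_self_eq_norm_sq, LinearIsometryEquiv.norm_map] at this
      rw [← this]
      apply Finset.sum_congr rfl
      intro i _
      rw [real_inner_comm (π h v) (stdOrthonormalBasis ℝ V i)]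
    simp only [this]
    simp
  simp only [hcL, inner_smul_left, real_inner_self_eq_norm_sq, OrthonormalBasis.norm_eq_one] at htr
  simp at htr
  have h2 := hLi v v
  rw [hcL, inner_smul_left, real_inner_self_eq_norm_sq] at h2
  simp only [← pow_two] at h2
  rw [← h2]
  simp only [conj_trivial]
  rw [← mul_assoc, htr]
  ring

theorem nu_cap_pos {δ : ℝ} (hδ : 0 < δ) : 0 < nu.real (cap δ) := by
  apply ENNReal.toReal_pos
  · exact (isOpen_cap δ).measure_ne_zero nu ⟨1, by simp [cap, hδ]⟩
  · exact measure_ne_top _ _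

/-- Averages over a ball act as a scalar, which is bounded below by testing on one vector. -/
theorem exists_avg_scalar {π : UQ →* (V ≃ₗᵢ[ℝ] V)} (hc : ∀ v, Continuous fun h => π h v)
    (hS : SchurProp π) {δ : ℝ} (hδ : 0 < δ) (φ : V →ₗ[ℝ] ℝ) (v₀ : V) (hv₀ : φ v₀ = 1)
    (hφ : ∀ h ∈ cap δ, 1 / 2 ≤ φ (π h v₀)) :
    ∃ κ : ℝ, 1 / 2 ≤ κ ∧ ∀ v, ∫ h in cap δ, π h v ∂nu = (κ * nu.real (cap δ)) • v := by
  have hi : ∀ v, Integrable (fun h => π h v) (nu.restrict (cap δ)) :=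
    fun v => (integrable_nu (hc v)).restrict
  let L : V →ₗ[ℝ] V :=
    { toFun := fun u => ∫ h in cap δ, π h u ∂nu
      map_add' := fun u u' => by
        simp only [map_add]
        rw [integral_add (hi u) (hi u')]
      map_smul' := fun c u => by
        simp only [map_smul, RingHom.id_apply]
        rw [integral_smul] }
  have hLi : ∀ u u', ⟪L u, u'⟫ = ∫ h in cap δ, ⟪π h u, u'⟫ ∂nu := by
    intro u u'
    rw [real_inner_comm]
    change ⟪u', ∫ h in cap δ, π h u ∂nu⟫ = _
    rw [← integral_inner (𝕜 := ℝ) (hi u) u']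
    congr 1
    funext h
    rw [real_inner_comm]
  obtain ⟨c, hcL⟩ := hS L (by
      intro u u'
      rw [hLi, real_inner_comm, hLi]
      have h1 : ∀ h, ⟪π h u', u⟫ = ⟪π h⁻¹ u, u'⟫ := by
        intro h
        rw [inner_rep, real_inner_comm]
      simp only [h1]
      rw [← integral_indicator (isOpen_cap δ).measurableSet,
        ← integral_indicator (isOpen_cap δ).measurableSet, ← integral_inv_eq_self]
      congr 1
      funext h
      by_cases hh : h ∈ cap δ
      · rw [indicator_of_mem hh, indicator_of_mem (inv_mem_cap.2 hh)]
      · rw [indicator_of_notMem hh, indicator_of_notMem (fun h' => hh (inv_mem_cap.1 h'))]) (by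
      intro g u
      change ∫ h in cap δ, π h (π g u) ∂nu = π g (∫ h in cap δ, π h u ∂nu)
      have h1 := (π g).toContinuousLinearEquiv.integral_comp_comm (μ := nu.restrict (cap δ))
        (fun h => π h u)
      refine Eq.trans ?_ h1
      rw [← integral_indicator (isOpen_cap δ).measurableSet,
        ← integral_indicator (isOpen_cap δ).measurableSet, ← integral_mul_left_eq_self _ g,
        ← integral_mul_right_eq_self _ g⁻¹]
      congr 1
      funext h
      rw [← mul_assoc]
      by_cases hh : h ∈ cap δ
      · rw [indicator_of_mem hh, indicator_of_mem (conj_mem_cap.2 hh), ← rep_mul,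
          inv_mul_cancel_right, rep_mul]
        rfl
      · rw [indicator_of_notMem hh, indicator_of_notMem (fun h' => hh (conj_mem_cap.1 h'))])
  have hp := nu_cap_pos hδ
  refine ⟨c / nu.real (cap δ), ?_, fun v => ?_⟩
  · have h1 : φ (L v₀) = c := by rw [hcL, map_smul, hv₀]; simp
    have h2 : φ (L v₀) = ∫ h in cap δ, φ (π h v₀) ∂nu := by
      have := (LinearMap.toContinuousLinearMap φ).integral_comp_comm (hi v₀)
      exact this.symm
    rw [le_div_iff₀ hp, ← h1, h2]
    have h3 : ∫ h in cap δ, (1 / 2 : ℝ) ∂nu ≤ ∫ h in cap δ, φ (π h v₀) ∂nu := by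
      apply setIntegral_mono_on (by simp) _ (isOpen_cap δ).measurableSet hφ
      exact (LinearMap.toContinuousLinearMap φ).integrable_comp (hi v₀)
    simpa [mul_comm] using h3
  · rw [div_mul_cancel₀ _ hp.ne']
    exact hcL v

theorem sq_integral_mul_le {α : Type*} [MeasurableSpace α] {ρ : Measure α} {f g : α → ℝ}
    (hff : Integrable (fun x => f x ^ 2) ρ) (hfg : Integrable (fun x => f x * g x) ρ)
    (hgg : Integrable (fun x => g x ^ 2) ρ) :
    (∫ x, f x * g x ∂ρ) ^ 2 ≤ (∫ x, f x ^ 2 ∂ρ) * ∫ x, g x ^ 2 ∂ρ := by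
  have h : ∀ t : ℝ, 0 ≤ (∫ x, g x ^ 2 ∂ρ) * (t * t) + (-2 * ∫ x, f x * g x ∂ρ) * t +
      ∫ x, f x ^ 2 ∂ρ := by
    intro t
    have h1 : (∫ x, g x ^ 2 ∂ρ) * (t * t) + (-2 * ∫ x, f x * g x ∂ρ) * t + ∫ x, f x ^ 2 ∂ρ =
        ∫ x, (f x - t * g x) ^ 2 ∂ρ := by
      have h2 : ∀ x, (f x - t * g x) ^ 2 = (t * t) * g x ^ 2 + (-2 * t) * (f x * g x) + f x ^ 2 :=
        fun x => by ring
      simp only [h2]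
      have i1 : Integrable (fun x => (t * t) * g x ^ 2) ρ := hgg.const_mul _
      have i2 : Integrable (fun x => (-2 * t) * (f x * g x)) ρ := hfg.const_mul _
      have i3 : Integrable (fun x => (t * t) * g x ^ 2 + (-2 * t) * (f x * g x)) ρ := i1.add i2
      rw [integral_add i3 hff, integral_add i1 i2, integral_const_mul, integral_const_mul]
      ring
    rw [h1]
    exact integral_nonneg fun x => sq_nonneg _
  have := discrim_le_zero h
  unfold discrim at this
  nlinarith

theorem wordEig_sq_mul_le {π : UQ →* (V ≃ₗᵢ[ℝ] V)} (hc : ∀ v, Continuous fun h => π h v)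
    (hS : SchurProp π) {δ : ℝ} (hδ : 0 < δ) (φ : V →ₗ[ℝ] ℝ) (v₀ : V) (hv₀ : φ v₀ = 1)
    (hφ : ∀ h ∈ cap δ, 1 / 2 ≤ φ (π h v₀)) {l : ℝ} {v : V} (hv : genSum π v = l • v)
    (hv0 : v ≠ 0) (j : ℕ) :
    wordEig l j ^ 2 * (Module.finrank ℝ V * nu.real (cap δ)) ≤
      4 * (closePairs (j + 1) (2 * δ)).card := by
  classical
  obtain ⟨κ, hκ, hK⟩ := exists_avg_scalar hc hS hδ φ v₀ hv₀ hφ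
  have hp := nu_cap_pos hδ
  set I : UQ → ℝ := (cap δ).indicator 1 with hI
  have hIm : Measurable I := measurable_one.indicator (isOpen_cap δ).measurableSet
  have hIw : ∀ g : UQ, Measurable fun h => I (h * g⁻¹) :=
    fun g => hIm.comp (measurable_mul_const _)
  have hI01 : ∀ h, 0 ≤ I h ∧ I h ≤ 1 := fun h =>
    ⟨indicator_nonneg (fun _ _ => zero_le_one) h, indicator_le_self' (fun _ _ => zero_le_one) h⟩
  have hIb : ∀ h, ‖I h‖ ≤ 1 := fun h => by
    rw [Real.norm_eq_abs, abs_of_nonneg (hI01 h).1]; exact (hI01 h).2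
  set F : UQ → ℝ := fun h => ⟪π h v, v⟫ with hF
  have hFc : Continuous F := (hc v).inner continuous_const
  set G : UQ → ℝ := fun h => ∑ w ∈ W (j + 1), I (h * (evU w)⁻¹) with hG
  have hinteg1 : ∀ g : UQ, Integrable (fun h => I (h * g⁻¹) * F h) nu := fun g =>
    (integrable_nu hFc).bdd_mul (hIw g).aestronglyMeasurable
      (Filter.Eventually.of_forall fun h => hIb _)
  have hinteg2 : ∀ g g' : UQ, Integrable (fun h => I (h * g⁻¹) * I (h * g'⁻¹)) nu := fun g g' =>
    (Integrable.of_bound (hIw g').aestronglyMeasurable 1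
      (Filter.Eventually.of_forall fun h => hIb _)).bdd_mul
      (hIw g).aestronglyMeasurable
      (Filter.Eventually.of_forall fun h => hIb _)
  have hGF : ∫ h, G h * F h ∂nu = κ * nu.real (cap δ) * (wordEig l j * ‖v‖ ^ 2) := by
    simp only [hG, Finset.sum_mul]
    rw [integral_finsetSum _ (fun w _ => hinteg1 (evU w))]
    have h1 : ∀ w, ∫ h, I (h * (evU w)⁻¹) * F h ∂nu =
        κ * nu.real (cap δ) * ⟪π (evU w) v, v⟫ := by
      intro w
      rw [← integral_mul_right_eq_self _ (evU w)]
      simp only [mul_inv_cancel_right]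
      have h2 : ∀ h, I h * F (h * evU w) =
          (cap δ).indicator (fun h => ⟪v, π h (π (evU w) v)⟫) h := by
        intro h
        rw [hI, hF]
        by_cases hh : h ∈ cap δ
        · rw [indicator_of_mem hh, indicator_of_mem hh]
          change 1 * ⟪π (h * evU w) v, v⟫ = _
          rw [rep_mul, real_inner_comm, one_mul]
        · rw [indicator_of_notMem hh, indicator_of_notMem hh, zero_mul]
      simp only [h2]
      rw [integral_indicator (isOpen_cap δ).measurableSet,
        integral_inner (𝕜 := ℝ) (integrable_nu (hc _)).restrict, hK,
        inner_smul_right, real_inner_comm]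
    simp only [h1]
    rw [← Finset.mul_sum, ← sum_inner, sum_W_rep hv, inner_smul_left, real_inner_self_eq_norm_sq]
    simp
  have hGG : ∫ h, G h ^ 2 ∂nu ≤ (closePairs (j + 1) (2 * δ)).card * nu.real (cap δ) := by
    simp only [hG, pow_two, Finset.sum_mul_sum]
    simp only [← Finset.sum_product']
    rw [integral_finsetSum _ (fun p _ => hinteg2 _ _), ← nsmul_eq_mul, ← Finset.sum_const]
    rw [closePairs, Finset.sum_filter]
    apply Finset.sum_le_sum
    intro p _
    split_ifs with hcl
    · have h1 : ∫ h, I (h * (evU p.1)⁻¹) ∂nu = nu.real (cap δ) := by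
        rw [integral_mul_right_eq_self I, hI, integral_indicator_one (isOpen_cap δ).measurableSet]
      rw [← h1]
      apply integral_mono (hinteg2 _ _)
      · exact Integrable.of_bound (hIw _).aestronglyMeasurable 1
          (Filter.Eventually.of_forall fun h => hIb _)
      · intro h
        exact mul_le_of_le_one_right (hI01 _).1 (hI01 _).2
    · apply le_of_eq
      rw [← integral_zero UQ ℝ]
      congr 1
      funext h
      rw [mul_eq_zero]
      by_contra hcon
      push Not at hcon
      have a1 := mul_inv_mem_cap.1 (mem_of_indicator_ne_zero hcon.1)
      have a2 := mul_inv_mem_cap.1 (mem_of_indicator_ne_zero hcon.2)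
      apply hcl
      calc ‖(evU p.1 : ℍ[ℝ]) - evU p.2‖ ≤ ‖(evU p.1 : ℍ[ℝ]) - h‖ + ‖(h : ℍ[ℝ]) - evU p.2‖ :=
            norm_sub_le_norm_sub_add_norm_sub _ _ _
        _ < 2 * δ := by rw [norm_sub_rev]; linarith
  have hFF := integral_sq_inner hc hS v
  have hcs := sq_integral_mul_le (f := G) (g := F) (ρ := nu)
    (by
      simp only [hG, pow_two, Finset.sum_mul_sum]
      exact integrable_finsetSum _ fun w _ => integrable_finsetSum _ fun w' _ => hinteg2 _ _)
    (by
      simp only [hG, Finset.sum_mul]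
      exact integrable_finsetSum _ fun w _ => hinteg1 _) (integrable_nu (hFc.pow 2))
  rw [hGF] at hcs
  have hN : 0 < ‖v‖ ^ 4 := by positivity
  set X := ∫ h, F h ^ 2 ∂nu with hX
  set a := wordEig l j
  set p := nu.real (cap δ)
  set C : ℝ := ((closePairs (j + 1) (2 * δ)).card : ℝ)
  set D : ℝ := (Module.finrank ℝ V : ℝ)
  have hX0 : 0 ≤ X := integral_nonneg fun h => sq_nonneg _
  have hD0 : 0 ≤ D := Nat.cast_nonneg _
  have h1 : (κ * p * (a * ‖v‖ ^ 2)) ^ 2 * D ≤ C * p * ‖v‖ ^ 4 := by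
    calc (κ * p * (a * ‖v‖ ^ 2)) ^ 2 * D ≤ (C * p * X) * D := by
          gcongr
          exact hcs.trans (by gcongr)
      _ = C * p * ‖v‖ ^ 4 := by rw [← hFF]; ring
  have h2 : (κ ^ 2 * (a ^ 2 * (D * p))) * (p * ‖v‖ ^ 4) ≤ C * (p * ‖v‖ ^ 4) := by
    calc _ = (κ * p * (a * ‖v‖ ^ 2)) ^ 2 * D := by ring
      _ ≤ _ := h1
      _ = _ := by ring
  have h3 := le_of_mul_le_mul_right h2 (by positivity)
  have h4 : (1 / 2) ^ 2 * (a ^ 2 * (D * p)) ≤ κ ^ 2 * (a ^ 2 * (D * p)) := by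
    gcongr
  linarith

end Rep

end SphereEq

namespace SphereEq
open Quaternion

open scoped RealInnerProductSpace

theorem exists_three_pow_gt (C : ℝ) : ∃ t₁ : ℕ, ∀ t ≥ t₁, C * (2 + 660 * t) < 3 ^ t := by
  have h1 : Filter.Tendsto (fun n : ℕ => (n : ℝ) ^ 1 / 3 ^ n) Filter.atTop (nhds 0) :=
    tendsto_pow_const_div_const_pow_of_one_lt 1 (by norm_num)
  have h2 : Filter.Tendsto (fun n : ℕ => (n : ℝ) ^ 0 / 3 ^ n) Filter.atTop (nhds 0) :=
    tendsto_pow_const_div_const_pow_of_one_lt 0 (by norm_num)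
  have h3 : Filter.Tendsto (fun n : ℕ => C * (2 * ((n : ℝ) ^ 0 / 3 ^ n) +
      660 * ((n : ℝ) ^ 1 / 3 ^ n))) Filter.atTop (nhds (C * (2 * 0 + 660 * 0))) :=
    ((h2.const_mul 2).add (h1.const_mul 660)).const_mul C
  rw [show C * (2 * 0 + 660 * 0) = (0 : ℝ) by ring] at h3
  obtain ⟨t₁, ht₁⟩ := Filter.eventually_atTop.1 (h3.eventually (gt_mem_nhds one_pos))
  refine ⟨t₁, fun t ht => ?_⟩
  have h4 := ht₁ t ht
  have hp : (0 : ℝ) < 3 ^ t := by positivity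
  have h5 : C * (2 * ((t : ℝ) ^ 0 / 3 ^ t) + 660 * ((t : ℝ) ^ 1 / 3 ^ t)) =
      C * (2 + 660 * t) / 3 ^ t := by
    field_simp
  rw [h5, div_lt_one hp] at h4
  exact h4

/-- For representations of large degree `k` the generators have a uniform spectral gap. -/
theorem exists_eig_le : ∃ k₀ : ℕ, ∀ k ≥ k₀, ∀ (V : Type) [NormedAddCommGroup V]
    [InnerProductSpace ℝ V] [FiniteDimensional ℝ V] (π : UQ →* (V ≃ₗᵢ[ℝ] V))
    (_ : ∀ v, Continuous fun h => π h v) (_ : SchurProp π) (φ : V →ₗ[ℝ] ℝ) (v₀ : V)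
    (_ : φ v₀ = 1) (_ : ∀ h : UQ, k * ‖(h : ℍ[ℝ]) - 1‖ ≤ 1 / 4 → 1 / 2 ≤ φ (π h v₀))
    (_ : k + 1 ≤ Module.finrank ℝ V) (l : ℝ) (v : V) (_ : genSum π v = l • v) (_ : v ≠ 0),
    l ≤ 5.93 := by
  obtain ⟨t₁, ht₁⟩ := exists_three_pow_gt (4 * 216000 * 64 * 5 ^ 15)
  refine ⟨5 ^ (5 * (t₁ + 1)), fun k hk V _ _ _ π hc hS φ v₀ hv₀ hφ hD l v hv hv0 => ?_⟩
  by_contra hl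
  push Not at hl
  obtain ⟨t, htt, hk1, hk2⟩ : ∃ t, t₁ + 1 ≤ t ∧ 5 ^ (5 * t) ≤ k ∧ k < 5 ^ (5 * t + 5) := by
    refine ⟨Nat.log (5 ^ 5) k, ?_, ?_, ?_⟩
    · apply Nat.le_log_of_pow_le (by norm_num)
      rwa [← pow_mul]
    · rw [pow_mul]
      exact Nat.pow_log_le_self _ (by have : 0 < 5 ^ (5 * (t₁ + 1)) := by positivity
                                      omega)
    · have := Nat.lt_pow_succ_log_self (b := 5 ^ 5) (by norm_num) k
      rwa [← pow_mul] at this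
  have hN : 1 ≤ 4 * 5 ^ (5 * t + 5) := by
    have : 0 < 5 ^ (5 * t + 5) := by positivity
    omega
  set P : ℝ := 5 ^ t with hP
  have hP1 : 1 ≤ P := one_le_pow₀ (by norm_num)
  have hNr : ((4 * 5 ^ (5 * t + 5) : ℕ) : ℝ) = 12500 * P ^ 5 := by
    push_cast
    rw [hP, pow_add, ← pow_mul, mul_comm 5 t]; ring
  have hcap := nu_cap_ge hN
  rw [hNr] at hcap
  have hδ : (0 : ℝ) < 1 / (12500 * P ^ 5) := by positivity
  have hmain := wordEig_sq_mul_le hc hS hδ φ v₀ hv₀ (by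
    intro h hh
    apply hφ
    have h1 : ‖(h : ℍ[ℝ]) - 1‖ < 1 / (12500 * P ^ 5) := hh
    have h2 : (k : ℝ) ≤ 3125 * P ^ 5 := by
      have : (k : ℝ) ≤ ((5 ^ (5 * t + 5) : ℕ) : ℝ) := by exact_mod_cast hk2.le
      refine this.trans (le_of_eq ?_)
      push_cast
      rw [hP, pow_add, ← pow_mul, mul_comm 5 t]; ring
    calc (k : ℝ) * ‖(h : ℍ[ℝ]) - 1‖ ≤ 3125 * P ^ 5 * (1 / (12500 * P ^ 5)) := by gcongr
      _ = 1 / 4 := by field_simp; norm_num) hv hv0 (11 * t - 1)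
  rw [show 11 * t - 1 + 1 = 11 * t by omega] at hmain
  have hcl := card_closePairs_le (m := 11 * t) (t := 5 ^ (2 * t)) (δ := 2 * (1 / (12500 * P ^ 5)))
    (one_le_pow₀ (by norm_num)) (by positivity) (by
      have e1 : (25 : ℝ) ^ (11 * t) = P ^ 22 := by
        rw [hP, ← pow_mul, show (25 : ℝ) = 5 ^ 2 by norm_num, ← pow_mul]; ring_nf
      have e2 : ((5 : ℝ) ^ (2 * t)) ^ 6 = P ^ 12 := by
        rw [hP, ← pow_mul, ← pow_mul]; ring_nf
      push_cast
      rw [e1, e2]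
      have : (2 * (1 / (12500 * P ^ 5))) ^ 2 * P ^ 22 = P ^ 12 * (1 / 39062500) := by
        field_simp; norm_num
      rw [this]
      nlinarith [pow_pos (lt_of_lt_of_le one_pos hP1) 12]) (by
      have e2 : ((5 : ℝ) ^ (2 * t)) ^ 5 = P ^ 10 := by
        rw [hP, ← pow_mul, ← pow_mul]; ring_nf
      push_cast
      rw [e2]
      have : (2 * (1 / (12500 * P ^ 5))) ^ 2 * P ^ 10 = 1 / 39062500 := by
        field_simp; norm_num
      rw [this]
      norm_num)
  have hge := wordEig_ge hl.le (11 * t - 1)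
  rw [show 11 * t - 1 + 1 = 11 * t by omega] at hge
  set a := wordEig l (11 * t - 1)
  set p := nu.real (cap (1 / (12500 * P ^ 5)))
  have ha2 : 3 ^ t * P ^ 21 ≤ a ^ 2 := by
    calc (3 : ℝ) ^ t * P ^ 21 = (3 * 5 ^ 21) ^ t := by
          rw [hP, mul_pow, ← pow_mul, ← pow_mul, mul_comm 21]
      _ ≤ (4.9 ^ 22) ^ t := by gcongr; norm_num
      _ = (4.9 ^ (11 * t)) ^ 2 := by rw [← pow_mul, ← pow_mul]; ring_nf
      _ ≤ a ^ 2 := by gcongr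
  have hDr : P ^ 5 ≤ (Module.finrank ℝ V : ℝ) := by
    have : ((5 ^ (5 * t) : ℕ) : ℝ) ≤ (Module.finrank ℝ V : ℝ) := by exact_mod_cast (by omega)
    refine le_trans (le_of_eq ?_) this
    push_cast
    rw [hP, ← pow_mul, mul_comm 5 t]
  have hp0 : 0 ≤ p := measureReal_nonneg
  have h1 : 3 ^ t * P ^ 21 * (P ^ 5 * p) ≤ 4 * ((2 + 660 * t) * P ^ 11) := by
    calc 3 ^ t * P ^ 21 * (P ^ 5 * p) ≤ a ^ 2 * (Module.finrank ℝ V * p) := by gcongr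
      _ ≤ _ := hmain
      _ ≤ 4 * ((2 + 660 * t) * P ^ 11) := by
        gcongr
        refine hcl.trans (le_of_eq ?_)
        push_cast
        rw [hP, ← pow_mul, mul_comm 11 t]; ring
  have h2 := ht₁ t (by omega)
  have h3 : 3 ^ t * P ^ 26 * 1 ≤ 3 ^ t * P ^ 26 * (216000 * (12500 * P ^ 5) ^ 3 * p) := by
    gcongr
  have h4 : (3 ^ t : ℝ) * P ^ 26 ≤ 4 * 216000 * 12500 ^ 3 * (2 + 660 * t) * P ^ 26 := by
    calc (3 ^ t : ℝ) * P ^ 26 ≤ 3 ^ t * P ^ 26 * (216000 * (12500 * P ^ 5) ^ 3 * p) := by linarith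
      _ = 216000 * 12500 ^ 3 * P ^ 15 * (3 ^ t * P ^ 21 * (P ^ 5 * p)) := by ring
      _ ≤ 216000 * 12500 ^ 3 * P ^ 15 * (4 * ((2 + 660 * t) * P ^ 11)) := by gcongr
      _ = _ := by ring
  have h5 := le_of_mul_le_mul_right h4 (by positivity)
  norm_num at h5 h2
  linarith

end SphereEq

namespace SphereEq
open Quaternion

open scoped RealInnerProductSpace

section Action

variable {n : ℕ}

/-- The action of unit quaternions on the sphere through a block of three coordinates. -/
def ac (I : Fin 3 ↪ Fin n) (h : UQ) (x : Sph n) : Sph n := rotateSphere (bl I h) x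

theorem rotateSphere_mul (γ δ : EucSp n ≃ₗᵢ[ℝ] EucSp n) (x : Sph n) :
    rotateSphere (γ * δ) x = rotateSphere γ (rotateSphere δ x) := rfl

theorem rotateSphere_one (x : Sph n) : rotateSphere (1 : EucSp n ≃ₗᵢ[ℝ] EucSp n) x = x := rfl

theorem rotateSphere_inv_apply (γ : EucSp n ≃ₗᵢ[ℝ] EucSp n) (x : Sph n) :
    rotateSphere γ⁻¹ (rotateSphere γ x) = x := by
  rw [← rotateSphere_mul, inv_mul_cancel]; rfl

theorem rotateSphere_apply_inv (γ : EucSp n ≃ₗᵢ[ℝ] EucSp n) (x : Sph n) :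
    rotateSphere γ (rotateSphere γ⁻¹ x) = x := by
  rw [← rotateSphere_mul, mul_inv_cancel]; rfl

theorem continuous_rotateSphere (γ : EucSp n ≃ₗᵢ[ℝ] EucSp n) : Continuous (rotateSphere γ) :=
  Continuous.subtype_mk (γ.continuous.comp continuous_subtype_val) _

theorem ac_mul (I : Fin 3 ↪ Fin n) (g h : UQ) (x : Sph n) :
    ac I (g * h) x = ac I g (ac I h x) := by
  unfold ac; rw [map_mul]; rfl

theorem ac_one (I : Fin 3 ↪ Fin n) (x : Sph n) : ac I 1 x = x := by
  unfold ac; rw [map_one]; rfl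

theorem ac_inv_apply (I : Fin 3 ↪ Fin n) (g : UQ) (x : Sph n) : ac I g⁻¹ (ac I g x) = x := by
  rw [← ac_mul, inv_mul_cancel, ac_one]

theorem ac_apply_inv (I : Fin 3 ↪ Fin n) (g : UQ) (x : Sph n) : ac I g (ac I g⁻¹ x) = x := by
  rw [← ac_mul, mul_inv_cancel, ac_one]

theorem coe_ac (I : Fin 3 ↪ Fin n) (h : UQ) (x : Sph n) (j : Fin n) :
    (ac I h x : EucSp n) j = blockFun I h (x : EucSp n) j := rfl

theorem continuous_coord (j : Fin n) : Continuous fun x : Sph n => (x : EucSp n) j := by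
  fun_prop

theorem continuous_ac (I : Fin 3 ↪ Fin n) : Continuous fun p : UQ × Sph n => ac I p.1 p.2 := by
  apply Continuous.subtype_mk
  apply (PiLp.continuous_toLp 2 _).comp
  apply continuous_pi
  intro j
  by_cases hj : ∃ a, I a = j
  · obtain ⟨a, rfl⟩ := hj
    have h1 : Continuous fun p : UQ × Sph n =>
        ((p.1 : ℍ[ℝ]), ((p.2 : EucSp n) : Fin n → ℝ) ∘ I) := by
      refine (continuous_subtype_val.comp continuous_fst).prodMk ?_
      apply continuous_pi
      intro b
      exact (continuous_coord (I b)).comp continuous_snd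
    have h2 : Continuous fun p : UQ × Sph n =>
        rotFun (p.1 : ℍ[ℝ]) (((p.2 : EucSp n) : Fin n → ℝ) ∘ I) a := by
      have h3 := continuous_rotFun.comp h1
      exact continuous_pi_iff.1 h3 a
    refine h2.congr fun p => ?_
    exact (blockFun_apply I _ _ a).symm
  · refine ((continuous_coord j).comp continuous_snd).congr fun p => ?_
    exact (blockFun_apply' I _ _ j hj).symm

end Action

/-- The action of unit quaternions on `S²`. -/
def rs (h : UQ) (x : Sph 3) : Sph 3 := ac (Function.Embedding.refl _) h x

theorem rs_mul (g h : UQ) (x : Sph 3) : rs (g * h) x = rs g (rs h x) := ac_mul _ _ _ _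
theorem rs_one (x : Sph 3) : rs 1 x = x := ac_one _ _
theorem rs_inv_apply (g : UQ) (x : Sph 3) : rs g⁻¹ (rs g x) = x := ac_inv_apply _ _ _
theorem rs_apply_inv (g : UQ) (x : Sph 3) : rs g (rs g⁻¹ x) = x := ac_apply_inv _ _ _

theorem continuous_rs : Continuous fun p : UQ × Sph 3 => rs p.1 p.2 := continuous_ac _

theorem continuous_rs_right (h : UQ) : Continuous (rs h) :=
  by
  have : Continuous fun x : Sph 3 => (h, x) := by fun_prop
  have h2 := continuous_rs.comp this
  exact h2

theorem continuous_rs_left (x : Sph 3) : Continuous fun h => rs h x :=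
  by
  have : Continuous fun h : UQ => (h, x) := by fun_prop
  have h2 := continuous_rs.comp this
  exact h2

theorem coe_rs (h : UQ) (x : Sph 3) (j : Fin 3) :
    (rs h x : EucSp 3) j = rotFun h (x : EucSp 3) j :=
  blockFun_apply (Function.Embedding.refl _) _ _ j

/-- A point of `S²` from its coordinates. -/
def mkS2 (a b c : ℝ) (h : a ^ 2 + b ^ 2 + c ^ 2 = 1) : Sph 3 :=
  ⟨!₂[a, b, c], by
    rw [mem_sphere_zero_iff_norm, EuclideanSpace.norm_eq, Fin.sum_univ_three]
    simp [h]⟩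

theorem sq_S2 (x : Sph 3) :
    (x : EucSp 3) 0 ^ 2 + (x : EucSp 3) 1 ^ 2 + (x : EucSp 3) 2 ^ 2 = 1 := by
  have h := norm_eq_of_mem_sphere x
  rw [EuclideanSpace.norm_eq, Real.sqrt_eq_one, Fin.sum_univ_three] at h
  simpa using h

theorem ext_S2 {x y : Sph 3} (h0 : (x : EucSp 3) 0 = (y : EucSp 3) 0)
    (h1 : (x : EucSp 3) 1 = (y : EucSp 3) 1) (h2 : (x : EucSp 3) 2 = (y : EucSp 3) 2) : x = y := by
  apply Subtype.ext
  ext j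
  fin_cases j <;> assumption

/-- Rotation by the angle `θ` around the third axis. -/
def torZ (θ : ℝ) : UQ :=
  mkUQ (Real.cos (θ / 2)) 0 0 (Real.sin (θ / 2)) (by
    have := Real.cos_sq_add_sin_sq (θ / 2); linarith)

/-- Rotation by the angle `θ` around the second axis. -/
def torY (θ : ℝ) : UQ :=
  mkUQ (Real.cos (θ / 2)) 0 (Real.sin (θ / 2)) 0 (by
    have := Real.cos_sq_add_sin_sq (θ / 2); linarith)

theorem cos_half (θ : ℝ) : Real.cos θ = Real.cos (θ / 2) ^ 2 - Real.sin (θ / 2) ^ 2 := by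
  rw [← Real.cos_two_mul']; ring_nf

theorem sin_half (θ : ℝ) : Real.sin θ = 2 * Real.sin (θ / 2) * Real.cos (θ / 2) := by
  rw [← Real.sin_two_mul]; ring_nf

theorem torZ_0 (θ : ℝ) (x : Sph 3) : (rs (torZ θ) x : EucSp 3) 0 =
    Real.cos θ * (x : EucSp 3) 0 - Real.sin θ * (x : EucSp 3) 1 := by
  rw [coe_rs, cos_half θ, sin_half θ]
  simp [rotFun, torZ, toQ]; ring

theorem torZ_1 (θ : ℝ) (x : Sph 3) : (rs (torZ θ) x : EucSp 3) 1 =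
    Real.sin θ * (x : EucSp 3) 0 + Real.cos θ * (x : EucSp 3) 1 := by
  rw [coe_rs, cos_half θ, sin_half θ]
  simp [rotFun, torZ, toQ]; ring

theorem torZ_2 (θ : ℝ) (x : Sph 3) : (rs (torZ θ) x : EucSp 3) 2 = (x : EucSp 3) 2 := by
  have h := Real.cos_sq_add_sin_sq (θ / 2)
  rw [coe_rs]
  simp [rotFun, torZ, toQ]
  linear_combination ((x : EucSp 3) 2) * h

theorem torY_0 (θ : ℝ) (x : Sph 3) : (rs (torY θ) x : EucSp 3) 0 =
    Real.cos θ * (x : EucSp 3) 0 + Real.sin θ * (x : EucSp 3) 2 := by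
  rw [coe_rs, cos_half θ, sin_half θ]
  simp [rotFun, torY, toQ]; ring

theorem torY_1 (θ : ℝ) (x : Sph 3) : (rs (torY θ) x : EucSp 3) 1 = (x : EucSp 3) 1 := by
  have h := Real.cos_sq_add_sin_sq (θ / 2)
  rw [coe_rs]
  simp [rotFun, torY, toQ]
  linear_combination ((x : EucSp 3) 1) * h

theorem torY_2 (θ : ℝ) (x : Sph 3) : (rs (torY θ) x : EucSp 3) 2 =
    - Real.sin θ * (x : EucSp 3) 0 + Real.cos θ * (x : EucSp 3) 2 := by
  rw [coe_rs, cos_half θ, sin_half θ]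
  simp [rotFun, torY, toQ]; ring

theorem exists_polar (a b : ℝ) :
    ∃ θ, a = √(a ^ 2 + b ^ 2) * Real.cos θ ∧ b = √(a ^ 2 + b ^ 2) * Real.sin θ := by
  refine ⟨Complex.arg ⟨a, b⟩, ?_, ?_⟩
  · have := Complex.norm_mul_cos_arg ⟨a, b⟩
    rw [Complex.norm_eq_sqrt_sq_add_sq] at this
    exact this.symm
  · have := Complex.norm_mul_sin_arg ⟨a, b⟩
    rw [Complex.norm_eq_sqrt_sq_add_sq] at this
    exact this.symm

/-- The north pole. -/
def ez : Sph 3 := mkS2 0 0 1 (by norm_num)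

@[simp] theorem ez_0 : (ez : EucSp 3) 0 = 0 := rfl
@[simp] theorem ez_1 : (ez : EucSp 3) 1 = 0 := rfl
@[simp] theorem ez_2 : (ez : EucSp 3) 2 = 1 := rfl

/-- A point on the meridian through the first axis. -/
def mer (x : Sph 3) : Sph 3 :=
  mkS2 (√((x : EucSp 3) 0 ^ 2 + (x : EucSp 3) 1 ^ 2)) 0 ((x : EucSp 3) 2) (by
    rw [Real.sq_sqrt (by positivity)]; linarith [sq_S2 x])

theorem exists_torZ_mer (x : Sph 3) : ∃ θ, rs (torZ θ) (mer x) = x := by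
  obtain ⟨θ, h1, h2⟩ := exists_polar ((x : EucSp 3) 0) ((x : EucSp 3) 1)
  refine ⟨θ, ext_S2 ?_ ?_ ?_⟩
  · rw [torZ_0]; simp [mer, mkS2]; linarith
  · rw [torZ_1]; simp [mer, mkS2]; linarith
  · rw [torZ_2]; rfl

theorem exists_rs_ez (x : Sph 3) : ∃ h, rs h ez = x := by
  obtain ⟨θ, h⟩ := exists_torZ_mer x
  set r := √((x : EucSp 3) 0 ^ 2 + (x : EucSp 3) 1 ^ 2) with hr
  have hs : r ^ 2 = (x : EucSp 3) 0 ^ 2 + (x : EucSp 3) 1 ^ 2 := Real.sq_sqrt (by positivity)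
  obtain ⟨ψ, h1, h2⟩ := exists_polar ((x : EucSp 3) 2) r
  have h3 : √((x : EucSp 3) 2 ^ 2 + r ^ 2) = 1 := by
    rw [Real.sqrt_eq_one, hs]; linarith [sq_S2 x]
  rw [h3, one_mul] at h1 h2
  refine ⟨torZ θ * torY ψ, ?_⟩
  have e : rs (torY ψ) ez = mer x := by
    apply ext_S2
    · rw [torY_0]; simp [mer, mkS2, ← hr]; linarith
    · rw [torY_1]; simp [mer, mkS2]
    · rw [torY_2]; simp [mer, mkS2]; linarith
  rw [rs_mul, e, h]

/-- The rotation-invariant probability measure on `S²`. -/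
def sig : Measure (Sph 3) := nu.map fun h => rs h ez

instance : IsProbabilityMeasure sig :=
  Measure.isProbabilityMeasure_map (continuous_rs_left ez).measurable.aemeasurable

theorem map_rs_eq_sig (x : Sph 3) : nu.map (fun h => rs h x) = sig := by
  obtain ⟨g, rfl⟩ := exists_rs_ez x
  simp only [← rs_mul]
  have := (measurePreserving_mul_right nu g).map_eq
  unfold sig
  nth_rw 2 [← this]
  rw [Measure.map_map (continuous_rs_left ez).measurable (measurable_mul_const g)]
  rfl

theorem measurePreserving_rs (g : UQ) : MeasurePreserving (rs g) sig sig := by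
  refine ⟨(continuous_rs_right g).measurable, ?_⟩
  unfold sig
  rw [Measure.map_map (continuous_rs_right g).measurable (continuous_rs_left ez).measurable]
  have := (measurePreserving_mul_left nu g).map_eq
  nth_rw 2 [← this]
  rw [Measure.map_map (continuous_rs_left ez).measurable (measurable_const_mul g)]
  congr 1
  funext h
  exact (rs_mul g h ez).symm

instance : sig.IsOpenPosMeasure := ⟨fun U hU hne => by
  rw [sig, Measure.map_apply (continuous_rs_left ez).measurable hU.measurableSet]
  apply (hU.preimage (continuous_rs_left ez)).measure_ne_zero nu
  obtain ⟨x, hx⟩ := hne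
  obtain ⟨h, rfl⟩ := exists_rs_ez x
  exact ⟨h, hx⟩⟩

theorem norm_rs_sub_le (h : UQ) (x : Sph 3) :
    ‖(rs h x : EucSp 3) - x‖ ≤ 2 * ‖(h : ℍ[ℝ]) - 1‖ := by
  have key : ∀ v : EucSp 3, ‖v‖ = ‖toQ v‖ := by
    intro v
    rw [← Real.sqrt_sq (norm_nonneg (toQ v)), norm_toQ_sq, EuclideanSpace.norm_eq]
    simp
  have h1 : toQ ((rs h x : EucSp 3) - x : EucSp 3) = h * toQ (x : EucSp 3) * star (h : ℍ[ℝ])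
      - toQ (x : EucSp 3) := by
    rw [← toQ_rotFun]
    have : ((rs h x : EucSp 3) : Fin 3 → ℝ) = rotFun h (x : EucSp 3) := by
      funext j; exact coe_rs h x j
    rw [← this]
    ext <;> simp [toQ]
  rw [key, h1]
  have hx : ‖toQ (x : EucSp 3)‖ = 1 := by rw [← key]; exact norm_eq_of_mem_sphere x
  have hh : star (h : ℍ[ℝ]) * h = 1 := by
    rw [← coe_inv_UQ]
    exact congrArg Subtype.val (inv_mul_cancel h)
  set p := toQ (x : EucSp 3)
  have h2 : ‖(h : ℍ[ℝ]) * p * star (h : ℍ[ℝ]) - p‖ = ‖(h : ℍ[ℝ]) * p - p * h‖ := by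
    rw [← norm_UQ_mul h, sub_mul, mul_assoc, hh, mul_one]
  rw [h2]
  calc ‖(h : ℍ[ℝ]) * p - p * h‖ = ‖((h : ℍ[ℝ]) - 1) * p - p * (h - 1)‖ := by
        congr 1; noncomm_ring
    _ ≤ ‖((h : ℍ[ℝ]) - 1) * p‖ + ‖p * (h - 1)‖ := norm_sub_le _ _
    _ = 2 * ‖(h : ℍ[ℝ]) - 1‖ := by rw [norm_mul, norm_mul, hx]; ring

end SphereEq

namespace SphereEq
open Quaternion

open scoped RealInnerProductSpace

/-- Continuous real functions on `S²`, to be equipped with the `L²` inner product. -/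
def CS : Type := C(Sph 3, ℝ)

instance : CommRing CS := inferInstanceAs (CommRing C(Sph 3, ℝ))
instance : Algebra ℝ CS := inferInstanceAs (Algebra ℝ C(Sph 3, ℝ))
instance : FunLike CS (Sph 3) ℝ := inferInstanceAs (FunLike C(Sph 3, ℝ) (Sph 3) ℝ)

theorem CS.continuous (f : CS) : Continuous f := ContinuousMap.continuous f
@[ext] theorem CS.ext {f g : CS} (h : ∀ x, f x = g x) : f = g := ContinuousMap.ext h
@[simp] theorem CS.add_apply (f g : CS) (x : Sph 3) : (f + g) x = f x + g x := rfl
@[simp] theorem CS.sub_apply (f g : CS) (x : Sph 3) : (f - g) x = f x - g x := rfl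
@[simp] theorem CS.mul_apply (f g : CS) (x : Sph 3) : (f * g) x = f x * g x := rfl
@[simp] theorem CS.smul_apply (c : ℝ) (f : CS) (x : Sph 3) : (c • f) x = c * f x := rfl
@[simp] theorem CS.one_apply (x : Sph 3) : (1 : CS) x = 1 := rfl
@[simp] theorem CS.zero_apply (x : Sph 3) : (0 : CS) x = 0 := rfl

theorem CS.integrable {f : Sph 3 → ℝ} (hf : Continuous f) : Integrable f sig := by
  rw [← integrableOn_univ]
  exact hf.continuousOn.integrableOn_compact isCompact_univ

/-- The `L²` inner product on continuous functions. -/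
@[reducible] def CS.core : InnerProductSpace.Core ℝ CS where
  inner f g := ∫ x, f x * g x ∂sig
  conj_inner_symm f g := by simp [mul_comm]
  re_inner_nonneg f := integral_nonneg fun x => mul_self_nonneg (f x)
  definite f h := by
    have h1 := (integral_eq_zero_iff_of_nonneg (fun x => mul_self_nonneg (f x))
      (CS.integrable (f.continuous.mul f.continuous))).1 h
    have h2 := (Continuous.ae_eq_iff_eq sig (f.continuous.mul f.continuous) continuous_zero).1 h1
    ext x
    exact mul_self_eq_zero.1 (congrFun h2 x)
  add_left f g h := by
    simp only [CS.add_apply, add_mul]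
    exact integral_add (CS.integrable (f.continuous.mul h.continuous))
      (CS.integrable (g.continuous.mul h.continuous))
  smul_left f g c := by
    simp only [CS.smul_apply, mul_assoc]
    exact integral_const_mul _ _

instance : NormedAddCommGroup CS := CS.core.toNormedAddCommGroup
instance : InnerProductSpace ℝ CS := InnerProductSpace.ofCore CS.core.toCore

theorem CS.inner_def (f g : CS) : ⟪f, g⟫ = ∫ x, f x * g x ∂sig := rfl

/-- Left translation on continuous functions. -/
def tl (h : UQ) (f : CS) : CS :=
  (⟨fun x => f (rs h⁻¹ x), f.continuous.comp (continuous_rs_right _)⟩ : C(Sph 3, ℝ))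

@[simp] theorem tl_apply (h : UQ) (f : CS) (x : Sph 3) : tl h f x = f (rs h⁻¹ x) := rfl

theorem tl_mul (g h : UQ) (f : CS) : tl (g * h) f = tl g (tl h f) := by
  ext x; simp [rs_mul]

theorem tl_one (f : CS) : tl 1 f = f := by
  ext x; simp [rs_one]

theorem inner_tl (h : UQ) (f g : CS) : ⟪tl h f, tl h g⟫ = ⟪f, g⟫ := by
  rw [CS.inner_def, CS.inner_def]
  simp only [tl_apply]
  have := (measurePreserving_rs h⁻¹).map_eq
  nth_rw 2 [← this]
  rw [integral_map (f := fun x => f x * g x) (continuous_rs_right _).measurable.aemeasurable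
    (by rw [this]; exact (CS.integrable (f.continuous.mul g.continuous)).aestronglyMeasurable)]

theorem norm_tl (h : UQ) (f : CS) : ‖tl h f‖ = ‖f‖ := by
  rw [norm_eq_sqrt_real_inner, norm_eq_sqrt_real_inner, inner_tl]

/-- The representation of unit quaternions on continuous functions on `S²`. -/
def tlRep : UQ →* (CS ≃ₗᵢ[ℝ] CS) where
  toFun h :=
    { toFun := tl h
      invFun := tl h⁻¹
      map_add' := fun f g => rfl
      map_smul' := fun c f => rfl
      left_inv := fun f => by rw [← tl_mul, inv_mul_cancel, tl_one]
      right_inv := fun f => by rw [← tl_mul, mul_inv_cancel, tl_one]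
      norm_map' := norm_tl h }
  map_one' := by
    ext1 f
    exact tl_one f
  map_mul' g h := by
    ext1 f
    exact tl_mul g h f

@[simp] theorem tlRep_apply (h : UQ) (f : CS) : tlRep h f = tl h f := rfl

theorem CS.norm_le {f : CS} {C : ℝ} (hC : 0 ≤ C) (h : ∀ x, |f x| ≤ C) : ‖f‖ ≤ C := by
  apply le_of_sq_le_sq _ hC
  rw [← real_inner_self_eq_norm_sq, CS.inner_def]
  calc ∫ x, f x * f x ∂sig ≤ ∫ x, C ^ 2 ∂sig := by
        apply integral_mono (CS.integrable (f.continuous.mul f.continuous)) (integrable_const _)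
        intro x
        have := h x
        change f x * f x ≤ C ^ 2
        rw [← pow_two, ← sq_abs]
        gcongr
    _ = C ^ 2 := by simp

theorem continuous_tl (f : CS) : Continuous fun h => tl h f := by
  let F : C(UQ × Sph 3, ℝ) := ⟨fun p => f (rs p.1⁻¹ p.2), by
    have h1 : Continuous fun p : UQ × Sph 3 => (p.1⁻¹, p.2) := by fun_prop
    have h2 := continuous_rs.comp h1
    exact f.continuous.comp h2⟩
  have hF : Continuous fun h => F.curry h := F.curry.continuous
  rw [Metric.continuous_iff]
  intro h ε hε
  obtain ⟨δ, hδ, H⟩ := Metric.continuous_iff.1 hF h (ε / 2) (by linarith)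
  refine ⟨δ, hδ, fun g hg => ?_⟩
  have h1 := H g hg
  rw [dist_eq_norm]
  refine lt_of_le_of_lt (CS.norm_le (C := ε / 2) (by linarith) fun x => ?_) (by linarith)
  have h2 := ContinuousMap.dist_apply_le_dist (f := F.curry g) (g := F.curry h) x
  rw [Real.dist_eq] at h2
  exact h2.trans h1.le

/-- The coordinate functions. -/
def crd (i : Fin 3) : CS :=
  (⟨fun x => (x : EucSp 3) i, continuous_coord i⟩ : C(Sph 3, ℝ))

@[simp] theorem crd_apply (i : Fin 3) (x : Sph 3) : crd i x = (x : EucSp 3) i := rfl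

/-- Polynomial functions of degree at most one. -/
def P1 : Submodule ℝ CS := Submodule.span ℝ (Set.range (Fin.cons 1 crd : Fin 4 → CS))

theorem one_mem_P1 : (1 : CS) ∈ P1 := Submodule.subset_span ⟨0, rfl⟩

theorem crd_mem_P1 (i : Fin 3) : crd i ∈ P1 := Submodule.subset_span ⟨i.succ, rfl⟩

theorem P1_induction {p : CS → Prop} (h1 : p 1) (hc : ∀ i, p (crd i))
    (ha : ∀ f g, p f → p g → p (f + g)) (hs : ∀ (c : ℝ) f, p f → p (c • f)) {f : CS}
    (hf : f ∈ P1) : p f := by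
  refine Submodule.span_induction ?_ ?_ (fun f g _ _ hf hg => ha f g hf hg)
    (fun c f _ hf => hs c f hf) hf
  · rintro _ ⟨i, rfl⟩
    refine Fin.cases ?_ ?_ i
    · exact h1
    · exact hc
  · have := hs 0 1 h1
    rwa [zero_smul] at this

/-- Polynomial functions of degree at most `k`. -/
def PP (k : ℕ) : Submodule ℝ CS := P1 ^ k

theorem one_mem_PP (k : ℕ) : (1 : CS) ∈ PP k := by
  unfold PP
  have := Submodule.pow_mem_pow P1 one_mem_P1 k
  rwa [one_pow] at this

theorem mul_mem_PP {j k : ℕ} {f g : CS} (hf : f ∈ PP j) (hg : g ∈ PP k) : f * g ∈ PP (j + k) := by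
  unfold PP at *
  rw [pow_add]
  exact Submodule.mul_mem_mul hf hg

theorem PP_mono {j k : ℕ} (h : j ≤ k) : PP j ≤ PP k := by
  intro f hf
  obtain ⟨d, rfl⟩ := Nat.exists_eq_add_of_le h
  have := mul_mem_PP hf (one_mem_PP d)
  rwa [mul_one] at this

theorem crd_mem_PP (i : Fin 3) : crd i ∈ PP 1 := by
  unfold PP; rw [pow_one]; exact crd_mem_P1 i

instance (k : ℕ) : FiniteDimensional ℝ (PP k) := by
  have h : P1.FG := Submodule.fg_span (Set.finite_range _)
  exact Module.Finite.iff_fg.2 (h.pow k)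

/-- Induction on polynomial functions along multiplication by coordinates. -/
theorem PP_induction {p : ℕ → CS → Prop} (h1 : p 0 1)
    (ha : ∀ k f g, p k f → p k g → p k (f + g)) (hs : ∀ k (c : ℝ) f, p k f → p k (c • f))
    (hm : ∀ k f, p k f → p (k + 1) f) (hc : ∀ k i f, p k f → p (k + 1) (crd i * f))
    {k : ℕ} {f : CS} (hf : f ∈ PP k) : p k f := by
  unfold PP at hf
  induction hf using Submodule.pow_induction_on_left' with
  | algebraMap r =>
    rw [Algebra.algebraMap_eq_smul_one]
    exact hs _ _ _ h1
  | add x y i hx hy h1 h2 => exact ha _ _ _ h1 h2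
  | mem_mul m hm' i x hx hp =>
    refine P1_induction (p := fun m => p (i + 1) (m * x)) ?_ ?_ ?_ ?_ hm'
    · rw [one_mul]; exact hm _ _ hp
    · exact fun j => hc _ _ _ hp
    · intro f g hf hg; rw [add_mul]; exact ha _ _ _ hf hg
    · intro c f hf; rw [smul_mul_assoc]; exact hs _ _ _ hf

theorem tl_crd_mem (h : UQ) (i : Fin 3) : tl h (crd i) ∈ PP 1 := by
  have hl : ∃ a : Fin 3 → ℝ, ∀ v : Fin 3 → ℝ, rotFun ((h⁻¹ : UQ) : ℍ[ℝ]) v i = ∑ j, a j * v j := by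
    refine ⟨fun j => rotFun ((h⁻¹ : UQ) : ℍ[ℝ]) (Pi.single j 1) i, fun v => ?_⟩
    have : v = ∑ j, v j • (Pi.single j 1 : Fin 3 → ℝ) := by
      rw [← Finset.univ_sum_single v]
      apply Finset.sum_congr rfl
      intro j _
      ext m
      simp [Pi.single_apply]
    conv_lhs => rw [this]
    simp only [Fin.sum_univ_three, rotFun_add, rotFun_smul, Pi.add_apply,
      Pi.smul_apply, smul_eq_mul]
    ring
  obtain ⟨a, ha⟩ := hl
  have : tl h (crd i) = ∑ j, a j • crd j := by
    ext x
    rw [tl_apply, crd_apply, coe_rs, ha, Fin.sum_univ_three, Fin.sum_univ_three]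
    simp
  rw [this]
  exact Submodule.sum_mem _ fun j _ => Submodule.smul_mem _ _ (crd_mem_PP j)

theorem tl_mem_PP (h : UQ) {k : ℕ} {f : CS} (hf : f ∈ PP k) : tl h f ∈ PP k := by
  refine PP_induction (p := fun k f => tl h f ∈ PP k) ?_ ?_ ?_ ?_ ?_ hf
  · exact one_mem_PP 0
  · exact fun k f g hf hg => Submodule.add_mem _ hf hg
  · exact fun k c f hf => Submodule.smul_mem _ _ hf
  · exact fun k f hf => PP_mono (Nat.le_succ k) hf
  · intro k i f hf
    rw [add_comm]
    exact mul_mem_PP (tl_crd_mem h i) hf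

open Polynomial in
/-- Polynomial functions restricted to great circles. -/
theorem exists_circle_poly (u w : EucSp 3) {k : ℕ} {f : CS} (hf : f ∈ PP k) :
    ∃ p q : ℝ[X], p.degree < (k + 1 : ℕ) ∧ q.degree < (k : ℕ) ∧ ∀ (t s : ℝ) (x : Sph 3),
      t ^ 2 + s ^ 2 = 1 → (x : EucSp 3) = t • u + s • w → f x = p.eval t + s * q.eval t := by
  refine PP_induction (p := fun k f => ∃ p q : ℝ[X], p.degree < (k + 1 : ℕ) ∧
    q.degree < (k : ℕ) ∧ ∀ (t s : ℝ) (x : Sph 3), t ^ 2 + s ^ 2 = 1 →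
      (x : EucSp 3) = t • u + s • w → f x = p.eval t + s * q.eval t) ?_ ?_ ?_ ?_ ?_ hf
  · refine ⟨1, 0, ?_, ?_, ?_⟩
    · simp
    · simp
    · intros; simp
  · rintro k f g ⟨p, q, hp, hq, h⟩ ⟨p', q', hp', hq', h'⟩
    refine ⟨p + p', q + q', ?_, ?_, ?_⟩
    · exact (degree_add_le _ _).trans_lt (max_lt hp hp')
    · exact (degree_add_le _ _).trans_lt (max_lt hq hq')
    · intro t s x h1 h2
      rw [CS.add_apply, h t s x h1 h2, h' t s x h1 h2]
      simp; ring
  · rintro k c f ⟨p, q, hp, hq, h⟩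
    refine ⟨c • p, c • q, (degree_smul_le _ _).trans_lt hp, (degree_smul_le _ _).trans_lt hq, ?_⟩
    intro t s x h1 h2
    rw [CS.smul_apply, h t s x h1 h2]
    simp; ring
  · rintro k f ⟨p, q, hp, hq, h⟩
    exact ⟨p, q, hp.trans (by exact_mod_cast Nat.lt_succ_self _),
      hq.trans (by exact_mod_cast Nat.lt_succ_self _), h⟩
  · rintro k i f ⟨p, q, hp, hq, h⟩
    have mX : ∀ {p : ℝ[X]} {k : ℕ}, p.degree < ((k : ℕ) : WithBot ℕ) →
        (X * p).degree < ((k + 1 : ℕ) : WithBot ℕ) := by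
      intro p k hp
      rcases eq_or_ne p 0 with rfl | h0
      · rw [mul_zero, degree_zero]
        exact WithBot.bot_lt_coe _
      · rw [degree_eq_natDegree h0] at hp
        rw [degree_eq_natDegree (mul_ne_zero X_ne_zero h0), natDegree_X_mul h0]
        exact_mod_cast Nat.succ_lt_succ (by exact_mod_cast hp)
    have mS : ∀ (c : ℝ) {p : ℝ[X]} {k : ℕ}, p.degree < (k : ℕ) →
        (c • p).degree < ((k : ℕ) : WithBot ℕ) :=
      fun c p k hp => (degree_smul_le _ _).trans_lt hp
    have mA : ∀ {p q : ℝ[X]} {k : ℕ}, p.degree < (k : ℕ) → q.degree < (k : ℕ) →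
        (p + q).degree < ((k : ℕ) : WithBot ℕ) :=
      fun hp hq => (degree_add_le _ _).trans_lt (max_lt hp hq)
    have mU : ∀ {p : ℝ[X]} {k : ℕ}, p.degree < (k : ℕ) → p.degree < ((k + 1 : ℕ) : WithBot ℕ) :=
      fun hp => hp.trans (by exact_mod_cast Nat.lt_succ_self _)
    refine ⟨u i • (X * p) + (w i • q + (- w i) • (X * (X * q))),
      u i • (X * q) + w i • p, ?_, ?_, ?_⟩
    · exact mA (mS _ (mX hp)) (mA (mS _ (mU (mU hq))) (mS _ (mX (mX hq))))
    · exact mA (mS _ (mX hq)) (mS _ hp)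
    · intro t s x h1 h2
      have h3 : (x : EucSp 3) i = t * u i + s * w i := by rw [h2]; simp
      rw [CS.mul_apply, h t s x h1 h2, crd_apply, h3]
      simp
      linear_combination (w i * eval t q) * h1

end SphereEq

namespace SphereEq
open Quaternion

open scoped RealInnerProductSpace

section SubRep

variable {H : Type*} [NormedAddCommGroup H] [InnerProductSpace ℝ H]

/-- The restriction of a representation to an invariant subspace. -/
def subRep (π : UQ →* (H ≃ₗᵢ[ℝ] H)) (W : Submodule ℝ H) (hW : ∀ g, ∀ v ∈ W, π g v ∈ W) :
    UQ →* (W ≃ₗᵢ[ℝ] W) where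
  toFun g :=
    { toFun := fun v => ⟨π g v, hW g v v.2⟩
      invFun := fun v => ⟨π g⁻¹ v, hW g⁻¹ v v.2⟩
      map_add' := fun u v => by ext; simp
      map_smul' := fun c v => by ext; simp
      left_inv := fun v => by
        apply Subtype.ext
        change π g⁻¹ (π g v) = v
        rw [← rep_mul, inv_mul_cancel, map_one]; rfl
      right_inv := fun v => by
        apply Subtype.ext
        change π g (π g⁻¹ v) = v
        rw [← rep_mul, mul_inv_cancel, map_one]; rfl
      norm_map' := fun v => (π g).norm_map v }
  map_one' := by
    ext v
    change π 1 v = v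
    rw [map_one]; rfl
  map_mul' g h := by
    ext v
    exact rep_mul π g h v

@[simp] theorem coe_subRep (π : UQ →* (H ≃ₗᵢ[ℝ] H)) (W : Submodule ℝ H)
    (hW : ∀ g, ∀ v ∈ W, π g v ∈ W) (g : UQ) (v : W) : (subRep π W hW g v : H) = π g v := rfl

theorem coe_genSum_subRep (π : UQ →* (H ≃ₗᵢ[ℝ] H)) (W : Submodule ℝ H)
    (hW : ∀ g, ∀ v ∈ W, π g v ∈ W) (v : W) :
    (genSum (subRep π W hW) v : H) = genSum π v := by
  rw [genSum_apply, genSum_apply]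
  simp

theorem rep_mem_orthogonal (π : UQ →* (H ≃ₗᵢ[ℝ] H)) {W : Submodule ℝ H}
    (hW : ∀ g, ∀ v ∈ W, π g v ∈ W) (g : UQ) {v : H} (hv : v ∈ Wᗮ) : π g v ∈ Wᗮ := by
  rw [Submodule.mem_orthogonal'] at *
  intro u hu
  rw [inner_rep]
  exact hv _ (hW _ _ hu)

end SubRep

/-- Evaluation at a point as an algebra homomorphism. -/
def evx (x : Sph 3) : CS →ₐ[ℝ] ℝ where
  toFun f := f x
  map_one' := rfl
  map_mul' _ _ := rfl
  map_zero' := rfl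
  map_add' _ _ := rfl
  commutes' _ := rfl

@[simp] theorem evx_apply (x : Sph 3) (f : CS) : evx x f = f x := rfl

theorem CS.sum_apply {ι : Type*} (s : Finset ι) (f : ι → CS) (x : Sph 3) :
    (∑ i ∈ s, f i) x = ∑ i ∈ s, f i x := map_sum (evx x) f s

theorem CS.pow_apply (f : CS) (k : ℕ) (x : Sph 3) : (f ^ k) x = f x ^ k := map_pow (evx x) f k

/-- Spherical harmonics of degree `k + 1`. -/
def VV (k : ℕ) : Submodule ℝ CS := PP (k + 1) ⊓ (PP k)ᗮ

theorem tl_mem_VV (k : ℕ) (g : UQ) (v : CS) (hv : v ∈ VV k) : tlRep g v ∈ VV k :=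
  ⟨tl_mem_PP g hv.1, rep_mem_orthogonal tlRep (fun g _ h => tl_mem_PP g h) g hv.2⟩

instance (k : ℕ) : FiniteDimensional ℝ (VV k) :=
  Submodule.finiteDimensional_of_le (inf_le_left : VV k ≤ PP (k + 1))

theorem exists_add_mem_VV {k : ℕ} {f : CS} (hf : f ∈ PP (k + 1)) :
    ∃ g ∈ PP k, ∃ v ∈ VV k, f = g + v := by
  have : CompleteSpace (PP k) := FiniteDimensional.complete ℝ _
  refine ⟨(PP k).starProjection f, Submodule.starProjection_apply_mem _ _,
    f - (PP k).starProjection f, ⟨?_, ?_⟩, by abel⟩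
  · exact Submodule.sub_mem _ hf (PP_mono (Nat.le_succ k) (Submodule.starProjection_apply_mem _ _))
  · exact Submodule.sub_starProjection_mem_orthogonal f

open Polynomial in
theorem exists_poly_mem_PP (p : ℝ[X]) {k : ℕ} (hp : p.degree < ((k + 1 : ℕ) : WithBot ℕ))
    (i : Fin 3) :
    ∃ g ∈ PP k, ∀ x : Sph 3, g x = p.eval ((x : EucSp 3) i) := by
  refine ⟨∑ j ∈ Finset.range (k + 1), p.coeff j • crd i ^ j, ?_, ?_⟩
  · apply Submodule.sum_mem
    intro j hj
    apply Submodule.smul_mem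
    apply PP_mono (Nat.lt_succ_iff.1 (Finset.mem_range.1 hj))
    exact Submodule.pow_mem_pow P1 (crd_mem_P1 i) j
  · intro x
    rw [CS.sum_apply]
    rcases eq_or_ne p 0 with rfl | h0
    · simp
    rw [degree_eq_natDegree h0] at hp
    rw [eval_eq_sum_range' (n := k + 1) (by exact_mod_cast hp)]
    simp [CS.pow_apply]

open Polynomial in
theorem exists_poly_of_zonal {k : ℕ} {f : CS} (hf : f ∈ PP k) (hz : ∀ θ, tl (torZ θ) f = f) :
    ∃ p : ℝ[X], p.degree < ((k + 1 : ℕ) : WithBot ℕ) ∧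
      ∀ x : Sph 3, f x = p.eval ((x : EucSp 3) 2) := by
  obtain ⟨p, q, hp, -, h⟩ := exists_circle_poly (!₂[0, 0, 1]) (!₂[1, 0, 0]) hf
  refine ⟨p, hp, fun x => ?_⟩
  have hz' : ∀ θ y, f (rs (torZ θ) y) = f y := by
    intro θ y
    conv_lhs => rw [← hz θ]
    rw [tl_apply, rs_inv_apply]
  obtain ⟨θ, hθ⟩ := exists_torZ_mer x
  have h1 : f x = f (mer x) := by rw [← hz' θ (mer x), hθ]
  set r := √((x : EucSp 3) 0 ^ 2 + (x : EucSp 3) 1 ^ 2) with hr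
  have hs : r ^ 2 = (x : EucSp 3) 0 ^ 2 + (x : EucSp 3) 1 ^ 2 := Real.sq_sqrt (by positivity)
  have h2 := h ((x : EucSp 3) 2) r (mer x) (by rw [hs]; linarith [sq_S2 x]) (by
    ext j; fin_cases j <;> simp [mer, mkS2, hr])
  have h3 := h ((x : EucSp 3) 2) (-r) (rs (torZ Real.pi) (mer x))
    (by rw [neg_sq, hs]; linarith [sq_S2 x]) (by
      ext j
      fin_cases j
      · simp only [Fin.zero_eta]; rw [torZ_0]; simp [mer, mkS2, hr]
      · simp only [Fin.mk_one]; rw [torZ_1]; simp [mer, mkS2]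
      · simp only [Fin.reduceFinMk]; rw [torZ_2]; simp [mer, mkS2])
  rw [hz'] at h3
  linarith

open Polynomial in
theorem zonal_unique {k : ℕ} {f g : CS} (hf : f ∈ VV k) (hg : g ∈ VV k)
    (hzf : ∀ θ, tl (torZ θ) f = f) (hzg : ∀ θ, tl (torZ θ) g = g) :
    ∃ a b : ℝ, (a ≠ 0 ∨ b ≠ 0) ∧ a • f + b • g = 0 := by
  obtain ⟨p, hp, hpf⟩ := exists_poly_of_zonal hf.1 hzf
  obtain ⟨q, hq, hqg⟩ := exists_poly_of_zonal hg.1 hzg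
  have key : ∀ a b : ℝ, a * p.coeff (k + 1) + b * q.coeff (k + 1) = 0 → a • f + b • g = 0 := by
    intro a b hab
    have hd : (a • p + b • q).degree < ((k + 1 : ℕ) : WithBot ℕ) := by
      rw [degree_lt_iff_coeff_zero]
      intro m hm
      rcases hm.eq_or_lt with rfl | hm
      · simpa using hab
      · rw [coeff_add, coeff_smul, coeff_smul, coeff_eq_zero_of_degree_lt,
          coeff_eq_zero_of_degree_lt]
        · simp
        · exact hq.trans_le (by exact_mod_cast hm)
        · exact hp.trans_le (by exact_mod_cast hm)
    obtain ⟨e, he, hee⟩ := exists_poly_mem_PP _ hd 2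
    have h1 : a • f + b • g = e := by
      ext x
      rw [hee, CS.add_apply, CS.smul_apply, CS.smul_apply, hpf, hqg]
      simp
    have h2 : a • f + b • g ∈ (PP k)ᗮ :=
      Submodule.add_mem _ (Submodule.smul_mem _ _ hf.2) (Submodule.smul_mem _ _ hg.2)
    rw [h1] at h2 ⊢
    exact inner_self_eq_zero (𝕜 := ℝ).1 (Submodule.inner_right_of_mem_orthogonal he h2)
  by_cases h0 : p.coeff (k + 1) = 0
  · exact ⟨1, 0, Or.inl one_ne_zero, key 1 0 (by simp [h0])⟩
  · exact ⟨q.coeff (k + 1), - p.coeff (k + 1), Or.inr (neg_ne_zero.2 h0), key _ _ (by ring)⟩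

theorem exists_zonal (M : Submodule ℝ CS) [FiniteDimensional ℝ M]
    (hM : ∀ g, ∀ v ∈ M, tl g v ∈ M) (h0 : M ≠ ⊥) :
    ∃ Z ∈ M, Z ≠ 0 ∧ ∀ θ, tl (torZ θ) Z = Z := by
  have : CompleteSpace M := FiniteDimensional.complete ℝ _
  let φ : M →ₗ[ℝ] ℝ := (evx ez).toLinearMap ∘ₗ M.subtype
  let Z : M := (InnerProductSpace.toDual ℝ M).symm (LinearMap.toContinuousLinearMap φ)
  have hZ : ∀ f : M, ⟪(Z : CS), f⟫ = (f : CS) ez := fun f =>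
    InnerProductSpace.toDual_symm_apply (x := f) (y := LinearMap.toContinuousLinearMap φ)
  refine ⟨Z, Z.2, ?_, ?_⟩
  · intro hZ0
    obtain ⟨f, hf, hf0⟩ := Submodule.exists_mem_ne_zero_of_ne_bot h0
    apply hf0
    ext x
    obtain ⟨h, rfl⟩ := exists_rs_ez x
    have h1 := hZ ⟨tl h⁻¹ f, hM _ _ hf⟩
    rw [hZ0, inner_zero_left] at h1
    simpa using h1.symm
  · intro θ
    have h1 : (⟨tl (torZ θ) Z, hM _ _ Z.2⟩ : M) = Z := by
      apply ext_inner_right ℝ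
      intro f
      change ⟪tlRep (torZ θ) (Z : CS), (f : CS)⟫ = ⟪(Z : CS), f⟫
      rw [inner_rep, hZ]
      have h2 := hZ ⟨tl (torZ θ)⁻¹ f, hM _ _ f.2⟩
      refine h2.trans ?_
      simp only [tl_apply, inv_inv]
      congr 1
      apply ext_S2
      · rw [torZ_0]; simp
      · rw [torZ_1]; simp
      · rw [torZ_2]
    exact congrArg Subtype.val h1

/-- The representation on spherical harmonics. -/
def VRep (k : ℕ) : UQ →* (VV k ≃ₗᵢ[ℝ] VV k) := subRep tlRep (VV k) (tl_mem_VV k)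

theorem continuous_VRep (k : ℕ) (v : VV k) : Continuous fun h => VRep k h v :=
  Continuous.subtype_mk (continuous_tl (v : CS)) _

theorem schurProp_VRep (k : ℕ) : SchurProp (VRep k) := by
  intro L hL hc
  rcases subsingleton_or_nontrivial (VV k) with hs | hn
  · exact ⟨0, fun v => Subsingleton.elim _ _⟩
  have hev := hL.hasEigenvalue_iSup_of_finiteDimensional
  set c := ⨆ x : { x : VV k // x ≠ 0 }, RCLike.re ⟪L x, (x : VV k)⟫ / ‖(x : VV k)‖ ^ 2 with hcdef
  refine ⟨c, ?_⟩
  set E := Module.End.eigenspace L c with hE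
  have hE0 : E ≠ ⊥ := hev
  have hEi : ∀ g, ∀ v ∈ E, VRep k g v ∈ E := by
    intro g v hv
    rw [hE, Module.End.mem_eigenspace_iff] at *
    rw [hc, hv, map_smul]
  have hz : ∀ F : Submodule ℝ (VV k), F ≠ ⊥ → (∀ g, ∀ v ∈ F, VRep k g v ∈ F) →
      ∃ Z ∈ F, Z ≠ 0 ∧ ∀ θ, tl (torZ θ) (Z : CS) = Z := by
    intro F hF0 hFi
    obtain ⟨Z, hZ, hZ0, hZt⟩ := exists_zonal (F.map (VV k).subtype) (by
      rintro g _ ⟨v, hv, rfl⟩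
      exact ⟨VRep k g v, hFi g v hv, rfl⟩) (by
      intro hb
      apply hF0
      rw [Submodule.eq_bot_iff] at hb ⊢
      intro v hv
      exact Subtype.ext (hb v ⟨v, hv, rfl⟩))
    obtain ⟨Z', hZ', rfl⟩ := hZ
    refine ⟨Z', hZ', ?_, hZt⟩
    rintro rfl
    simp at hZ0
  have hEt : Eᗮ = ⊥ := by
    by_contra hne
    obtain ⟨Z, hZ, hZ0, hZt⟩ := hz E hE0 hEi
    obtain ⟨Z', hZ', hZ0', hZt'⟩ := hz Eᗮ hne
      (fun g v hv => rep_mem_orthogonal (VRep k) hEi g hv)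
    obtain ⟨a, b, hab, h⟩ := zonal_unique Z.2 Z'.2 hZt hZt'
    have h' : a • Z + b • Z' = 0 := Subtype.ext h
    have hi : ⟪Z, Z'⟫ = 0 := Submodule.inner_right_of_mem_orthogonal hZ hZ'
    have h1 : ⟪Z, a • Z + b • Z'⟫ = 0 := by rw [h', inner_zero_right]
    have h2 : ⟪Z', a • Z + b • Z'⟫ = 0 := by rw [h', inner_zero_right]
    rw [inner_add_right, inner_smul_right, inner_smul_right, hi] at h1
    rw [inner_add_right, inner_smul_right, inner_smul_right, real_inner_comm, hi] at h2
    simp [hZ0, hZ0'] at h1 h2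
    tauto
  rw [Submodule.orthogonal_eq_bot_iff] at hEt
  intro v
  have : v ∈ E := by rw [hEt]; trivial
  rwa [hE, Module.End.mem_eigenspace_iff] at this

end SphereEq

namespace SphereEq
open Quaternion

open scoped RealInnerProductSpace

/-- Homogeneous polynomials in the first two coordinates. -/
def homPoly (k : ℕ) : (Fin (k + 1) → ℝ) →ₗ[ℝ] CS :=
  ∑ a : Fin (k + 1), (LinearMap.proj a : (Fin (k + 1) → ℝ) →ₗ[ℝ] ℝ).smulRight
    (crd 0 ^ (a : ℕ) * crd 1 ^ (k - a : ℕ))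

theorem homPoly_apply (k : ℕ) (c : Fin (k + 1) → ℝ) :
    homPoly k c = ∑ a : Fin (k + 1), c a • (crd 0 ^ (a : ℕ) * crd 1 ^ (k - a : ℕ)) := by
  simp [homPoly, LinearMap.sum_apply]

theorem homPoly_mem (k : ℕ) (c : Fin (k + 1) → ℝ) : homPoly k c ∈ PP k := by
  rw [homPoly_apply]
  apply Submodule.sum_mem
  intro a _
  apply Submodule.smul_mem
  have h1 := mul_mem_PP (Submodule.pow_mem_pow P1 (crd_mem_P1 0) (a : ℕ))
    (Submodule.pow_mem_pow P1 (crd_mem_P1 1) (k - a : ℕ))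
  rwa [Nat.add_sub_cancel' (Nat.lt_succ_iff.1 a.2)] at h1

open Polynomial in
theorem homPoly_injective_mod (k : ℕ) (c : Fin (k + 2) → ℝ) (hc : homPoly (k + 1) c ∈ PP k) :
    c = 0 := by
  have key : ∀ a b : ℝ, a ^ 2 + b ^ 2 = 1 →
      ∑ i : Fin (k + 2), c i * (a ^ (i : ℕ) * b ^ (k + 1 - i : ℕ)) = 0 := by
    intro a b hab
    obtain ⟨p, q, hp, -, h⟩ := exists_circle_poly (!₂[a, b, 0]) (!₂[0, 0, 1]) hc
    set H := ∑ i : Fin (k + 2), c i * (a ^ (i : ℕ) * b ^ (k + 1 - i : ℕ)) with hH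
    have h1 : ∀ t ∈ Icc (-1 : ℝ) 1, p.eval t = (C H * X ^ (k + 1)).eval t := by
      intro t ht
      have hs : √(1 - t ^ 2) ^ 2 = 1 - t ^ 2 := Real.sq_sqrt (by nlinarith [ht.1, ht.2])
      have hv : ∀ s, s ^ 2 = 1 - t ^ 2 → H * t ^ (k + 1) = p.eval t + s * q.eval t := by
        intro s hs
        have hx : (t * a) ^ 2 + (t * b) ^ 2 + s ^ 2 = 1 := by
          linear_combination t ^ 2 * hab + hs
        have := h t s (mkS2 (t * a) (t * b) s hx) (by rw [hs]; ring) (by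
          ext j; fin_cases j <;> simp [mkS2])
        rw [← this, homPoly_apply, CS.sum_apply, hH, Finset.sum_mul]
        apply Finset.sum_congr rfl
        intro i _
        have e : t ^ (k + 1) = t ^ (i : ℕ) * t ^ (k + 1 - i : ℕ) := by
          rw [← pow_add, Nat.add_sub_cancel' (Nat.lt_succ_iff.1 i.2)]
        simp only [CS.smul_apply, CS.mul_apply, CS.pow_apply, crd_apply, mkS2]
        simp only [Matrix.cons_val_zero, Matrix.cons_val_one]
        rw [e]
        simp [mul_pow]
        ring
      have e1 := hv _ hs
      have e2 := hv (-√(1 - t ^ 2)) (by rw [neg_sq, hs])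
      simp only [eval_mul, eval_C, eval_pow, eval_X]
      linarith
    have h2 : p = C H * X ^ (k + 1) :=
      eq_of_infinite_eval_eq _ _ ((Icc_infinite (by norm_num : (-1 : ℝ) < 1)).mono h1)
    have h3 : p.coeff (k + 1) = 0 := coeff_eq_zero_of_degree_lt hp
    rw [h2] at h3
    simpa using h3
  set P : ℝ[X] := ∑ i : Fin (k + 2), C (c i) * X ^ (i : ℕ) with hP
  have hP0 : P = 0 := by
    apply Polynomial.funext
    intro r
    have hpos : 0 < 1 + r ^ 2 := by positivity
    have hs : √(1 + r ^ 2) ^ 2 = 1 + r ^ 2 := Real.sq_sqrt hpos.le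
    have hs0 : √(1 + r ^ 2) ≠ 0 := (Real.sqrt_pos.2 hpos).ne'
    set u := √(1 + r ^ 2)
    have h1 := key (r / u) (1 / u) (by field_simp; rw [hs]; ring)
    have h2 : P.eval r = u ^ (k + 1) *
        ∑ i : Fin (k + 2), c i * ((r / u) ^ (i : ℕ) * (1 / u) ^ (k + 1 - i : ℕ)) := by
      rw [hP, eval_finsetSum, Finset.mul_sum]
      apply Finset.sum_congr rfl
      intro i _
      have e : u ^ (k + 1) = u ^ (i : ℕ) * u ^ (k + 1 - i : ℕ) := by
        rw [← pow_add, Nat.add_sub_cancel' (Nat.lt_succ_iff.1 i.2)]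
      simp only [eval_mul, eval_C, eval_pow, eval_X, e, div_pow, one_pow]
      field_simp
    rw [h2, h1, mul_zero, eval_zero]
  funext i
  have h1 : P.coeff i = c i := by
    rw [hP, finsetSum_coeff, Finset.sum_eq_single i]
    · simp
    · intro j _ hj
      rw [coeff_C_mul, coeff_X_pow, if_neg (fun h => hj (Fin.ext h.symm)), mul_zero]
    · simp
  rw [← h1, hP0]
  simp

theorem finrank_VV (k : ℕ) : k + 1 + 1 ≤ Module.finrank ℝ (VV k) := by
  have : CompleteSpace (PP k) := FiniteDimensional.complete ℝ _
  let L : CS →ₗ[ℝ] CS := LinearMap.id - ((PP k).starProjection : CS →ₗ[ℝ] CS)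
  let Ψ : (Fin (k + 2) → ℝ) →ₗ[ℝ] VV k := (L ∘ₗ homPoly (k + 1)).codRestrict (VV k) (by
    intro c
    refine ⟨?_, Submodule.sub_starProjection_mem_orthogonal _⟩
    exact Submodule.sub_mem _ (homPoly_mem _ c)
      (PP_mono (Nat.le_succ k) (Submodule.starProjection_apply_mem _ _)))
  have hinj : Function.Injective Ψ := by
    rw [← LinearMap.ker_eq_bot, LinearMap.ker_eq_bot']
    intro c hc
    apply homPoly_injective_mod k c
    have h1 : homPoly (k + 1) c - (PP k).starProjection (homPoly (k + 1) c) = 0 :=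
      congrArg Subtype.val hc
    rw [sub_eq_zero.1 h1]
    exact Submodule.starProjection_apply_mem _ _
  have h := LinearMap.finrank_le_finrank_of_injective hinj
  rw [Module.finrank_fin_fun] at h
  exact h

/-- The complex coordinate on `S²`. -/
def wc (x : Sph 3) : ℂ := ⟨(x : EucSp 3) 0, (x : EucSp 3) 1⟩

theorem continuous_wc : Continuous wc := by
  have : wc = fun x : Sph 3 => ((x : EucSp 3) 0 : ℂ) + ((x : EucSp 3) 1 : ℂ) * Complex.I := by
    funext x
    apply Complex.ext <;> simp [wc]
  rw [this]
  have h0 := continuous_coord (n := 3) 0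
  have h1 := continuous_coord (n := 3) 1
  fun_prop

theorem integrable_sig_complex {f : Sph 3 → ℂ} (hf : Continuous f) : Integrable f sig := by
  rw [← integrableOn_univ]
  exact hf.continuousOn.integrableOn_compact isCompact_univ

theorem wc_torZ (θ : ℝ) (x : Sph 3) : wc (rs (torZ θ) x) = Complex.exp (θ * Complex.I) * wc x := by
  rw [Complex.exp_mul_I, ← Complex.ofReal_cos, ← Complex.ofReal_sin]
  apply Complex.ext
  · simp only [wc, torZ_0, Complex.mul_re, Complex.add_re, Complex.add_im, Complex.mul_im,
      Complex.ofReal_re, Complex.ofReal_im, Complex.I_re, Complex.I_im]; ring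
  · simp only [wc, torZ_1, Complex.mul_re, Complex.add_re, Complex.add_im, Complex.mul_im,
      Complex.ofReal_re, Complex.ofReal_im, Complex.I_re, Complex.I_im]; ring

open ComplexConjugate in
theorem integral_wc_pow {j : ℕ} {f : CS} (hf : f ∈ PP j) : ∀ a b c : ℕ, b + j < a →
    ∫ x, (f x : ℂ) * (wc x ^ a * conj (wc x) ^ b * ((x : EucSp 3) 2 : ℂ) ^ c) ∂sig = 0 := by
  have hcf : ∀ f : CS, Continuous fun x => (f x : ℂ) :=
    fun f => Complex.continuous_ofReal.comp f.continuous
  have hcw : ∀ a b c : ℕ,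
      Continuous fun x : Sph 3 => wc x ^ a * conj (wc x) ^ b * ((x : EucSp 3) 2 : ℂ) ^ c := by
    intro a b c
    exact ((continuous_wc.pow a).mul ((Complex.continuous_conj.comp continuous_wc).pow b)).mul
      ((Complex.continuous_ofReal.comp (continuous_coord 2)).pow c)
  have hinteg : ∀ (f : CS) (a b c : ℕ), Integrable (fun x => (f x : ℂ) *
      (wc x ^ a * conj (wc x) ^ b * ((x : EucSp 3) 2 : ℂ) ^ c)) sig :=
    fun f a b c => integrable_sig_complex ((hcf f).mul (hcw a b c))
  refine PP_induction (p := fun j f => ∀ a b c : ℕ, b + j < a →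
    ∫ x, (f x : ℂ) * (wc x ^ a * conj (wc x) ^ b * ((x : EucSp 3) 2 : ℂ) ^ c) ∂sig = 0)
    ?_ ?_ ?_ ?_ ?_ hf
  · intro a b c hab
    simp only [CS.one_apply, Complex.ofReal_one, one_mul]
    set F : Sph 3 → ℂ := fun x => wc x ^ a * conj (wc x) ^ b * ((x : EucSp 3) 2 : ℂ) ^ c with hF
    obtain ⟨d, hd⟩ : ∃ d : ℕ, a = b + (d + 1) := ⟨a - b - 1, by omega⟩
    set θ : ℝ := Real.pi / (d + 1)
    have h1 : ∀ x, F (rs (torZ θ) x) = - F x := by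
      intro x
      simp only [hF, wc_torZ, torZ_2, hd]
      set e := Complex.exp (θ * Complex.I) with he
      have e1 : e * conj e = 1 := by
        rw [he, ← Complex.exp_conj, ← Complex.exp_add]
        simp
      have e2 : e ^ (d + 1) = -1 := by
        rw [he, ← Complex.exp_nat_mul, ← Complex.exp_pi_mul_I]
        congr 1
        simp only [θ]
        have : (d + 1 : ℂ) ≠ 0 := by exact_mod_cast Nat.succ_ne_zero d
        push_cast
        field_simp
      rw [map_mul]
      calc (e * wc x) ^ (b + (d + 1)) * (conj e * conj (wc x)) ^ b * ((x : EucSp 3) 2 : ℂ) ^ c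
          = (e * conj e) ^ b * e ^ (d + 1) * (wc x ^ (b + (d + 1)) * conj (wc x) ^ b *
            ((x : EucSp 3) 2 : ℂ) ^ c) := by ring
        _ = _ := by rw [e1, e2]; ring
    have h2 : ∫ x, F x ∂sig = ∫ x, F (rs (torZ θ) x) ∂sig := by
      have hm := (measurePreserving_rs (torZ θ)).map_eq
      nth_rw 1 [← hm]
      rw [integral_map (continuous_rs_right _).measurable.aemeasurable
        (hcw a b c).aestronglyMeasurable]
    simp only [h1] at h2
    rw [integral_neg] at h2
    exact self_eq_neg.1 h2
  · intro k f g hf hg a b c h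
    simp only [CS.add_apply, Complex.ofReal_add, add_mul]
    rw [integral_add (hinteg f a b c) (hinteg g a b c), hf a b c h, hg a b c h, add_zero]
  · intro k r f hf a b c h
    simp only [CS.smul_apply, Complex.ofReal_mul, mul_assoc (r : ℂ)]
    rw [integral_const_mul, hf a b c h, mul_zero]
  · intro k f hf a b c h
    exact hf a b c (by omega)
  · intro k i f hf a b c h
    have h10 := hf (a + 1) b c (by omega)
    have h01 := hf a (b + 1) c (by omega)
    fin_cases i
    · have e : ∀ x, (((crd 0 * f : CS) x : ℝ) : ℂ) * (wc x ^ a * conj (wc x) ^ b *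
          ((x : EucSp 3) 2 : ℂ) ^ c) = (1 / 2 : ℂ) * ((f x : ℂ) * (wc x ^ (a + 1) *
          conj (wc x) ^ b * ((x : EucSp 3) 2 : ℂ) ^ c)) + (1 / 2 : ℂ) * ((f x : ℂ) * (wc x ^ a *
          conj (wc x) ^ (b + 1) * ((x : EucSp 3) 2 : ℂ) ^ c)) := by
        intro x
        have : ((x : EucSp 3) 0 : ℂ) = 1 / 2 * (wc x + conj (wc x)) := by
          apply Complex.ext <;> simp [wc]; ring
        simp only [CS.mul_apply, crd_apply, Complex.ofReal_mul]
        rw [this]; ring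
      simp only [Fin.zero_eta, e]
      rw [integral_add ((hinteg _ _ _ _).const_mul _) ((hinteg _ _ _ _).const_mul _),
        integral_const_mul, integral_const_mul, h10, h01]
      simp
    · have e : ∀ x, (((crd 1 * f : CS) x : ℝ) : ℂ) * (wc x ^ a * conj (wc x) ^ b *
          ((x : EucSp 3) 2 : ℂ) ^ c) = (-Complex.I / 2 : ℂ) * ((f x : ℂ) * (wc x ^ (a + 1) *
          conj (wc x) ^ b * ((x : EucSp 3) 2 : ℂ) ^ c)) + (Complex.I / 2 : ℂ) * ((f x : ℂ) *
          (wc x ^ a * conj (wc x) ^ (b + 1) * ((x : EucSp 3) 2 : ℂ) ^ c)) := by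
        intro x
        have : ((x : EucSp 3) 1 : ℂ) = -Complex.I / 2 * (wc x - conj (wc x)) := by
          apply Complex.ext <;> simp [wc]; ring
        simp only [CS.mul_apply, crd_apply, Complex.ofReal_mul]
        rw [this]; ring
      simp only [Fin.mk_one, e]
      rw [integral_add ((hinteg _ _ _ _).const_mul _) ((hinteg _ _ _ _).const_mul _),
        integral_const_mul, integral_const_mul, h10, h01]
      simp
    · have e : ∀ x, (((crd 2 * f : CS) x : ℝ) : ℂ) * (wc x ^ a * conj (wc x) ^ b *
          ((x : EucSp 3) 2 : ℂ) ^ c) = (f x : ℂ) * (wc x ^ a *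
          conj (wc x) ^ b * ((x : EucSp 3) 2 : ℂ) ^ (c + 1)) := by
        intro x
        simp only [CS.mul_apply, crd_apply, Complex.ofReal_mul]
        ring
      simp only [Fin.reduceFinMk, e]
      exact hf a b (c + 1) (by omega)

/-- The highest weight vector. -/
def hwv (k : ℕ) : CS :=
  (⟨fun x => (wc x ^ k).re, Complex.continuous_re.comp (continuous_wc.pow k)⟩ : C(Sph 3, ℝ))

theorem hwv_apply (k : ℕ) (x : Sph 3) : hwv k x = (wc x ^ k).re := rfl

theorem hwv_mem_PP (k : ℕ) : hwv k ∈ PP k := by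
  suffices h : hwv k ∈ PP k ∧ ∃ g ∈ PP k, ∀ x, g x = (wc x ^ k).im from h.1
  induction k with
  | zero =>
    refine ⟨?_, 0, Submodule.zero_mem _, by simp⟩
    have : hwv 0 = 1 := by ext x; simp [hwv_apply]
    rw [this]
    exact one_mem_PP 0
  | succ k ih =>
    obtain ⟨h1, g, h2, h3⟩ := ih
    refine ⟨?_, crd 0 * g + crd 1 * hwv k, ?_, ?_⟩
    · have : hwv (k + 1) = crd 0 * hwv k - crd 1 * g := by
        ext x
        rw [hwv_apply, pow_succ', Complex.mul_re, CS.sub_apply, CS.mul_apply, CS.mul_apply, h3]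
        rfl
      rw [this, add_comm]
      exact Submodule.sub_mem _ (mul_mem_PP (crd_mem_PP 0) h1) (mul_mem_PP (crd_mem_PP 1) h2)
    · rw [add_comm]
      exact Submodule.add_mem _ (mul_mem_PP (crd_mem_PP 0) h2) (mul_mem_PP (crd_mem_PP 1) h1)
    · intro x
      rw [pow_succ', Complex.mul_im, CS.add_apply, CS.mul_apply, CS.mul_apply, h3]
      rfl

theorem hwv_mem_VV (k : ℕ) : hwv (k + 1) ∈ VV k := by
  refine ⟨hwv_mem_PP _, ?_⟩
  change hwv (k + 1) ∈ (PP k)ᗮ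
  rw [Submodule.mem_orthogonal]
  intro f hf
  have h := integral_wc_pow hf (k + 1) 0 0 (by omega)
  simp only [pow_zero, mul_one] at h
  have hi : Integrable (fun x => (f x : ℂ) * wc x ^ (k + 1)) sig :=
    integrable_sig_complex ((Complex.continuous_ofReal.comp f.continuous).mul (continuous_wc.pow _))
  have h2 := integral_re hi
  rw [CS.inner_def]
  rw [h] at h2
  simp only [RCLike.re_eq_complex_re, Complex.re_ofReal_mul, Complex.zero_re] at h2
  exact h2

/-- The point on the first axis. -/
def ex : Sph 3 := mkS2 1 0 0 (by norm_num)

theorem norm_pow_sub_one_le {z : ℂ} (hz : ‖z‖ ≤ 1) (k : ℕ) : ‖z ^ k - 1‖ ≤ k * ‖z - 1‖ := by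
  induction k with
  | zero => simp
  | succ k ih =>
    calc ‖z ^ (k + 1) - 1‖ = ‖z * (z ^ k - 1) + (z - 1)‖ := by congr 1; ring
      _ ≤ ‖z‖ * ‖z ^ k - 1‖ + ‖z - 1‖ := (norm_add_le _ _).trans (by rw [norm_mul])
      _ ≤ 1 * (k * ‖z - 1‖) + ‖z - 1‖ := by gcongr
      _ = _ := by push_cast; ring

theorem norm_wc_sub_le (x y : Sph 3) : ‖wc x - wc y‖ ≤ ‖(x : EucSp 3) - y‖ := by
  rw [EuclideanSpace.norm_eq, Complex.norm_eq_sqrt_sq_add_sq, Fin.sum_univ_three]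
  apply Real.sqrt_le_sqrt
  simp [wc]
  positivity

theorem norm_wc_le (x : Sph 3) : ‖wc x‖ ≤ 1 := by
  rw [Complex.norm_eq_sqrt_sq_add_sq, Real.sqrt_le_iff]
  have := sq_S2 x
  simp only [wc]
  refine ⟨zero_le_one, ?_⟩
  nlinarith [sq_nonneg ((x : EucSp 3) 2)]

theorem half_le_hwv (k : ℕ) (h : UQ) (hk : k * ‖(h : ℍ[ℝ]) - 1‖ ≤ 1 / 4) :
    1 / 2 ≤ tl h (hwv k) ex := by
  rw [tl_apply, hwv_apply]
  have h1 : ‖(h : ℍ[ℝ]) - 1‖ = ‖((h⁻¹ : UQ) : ℍ[ℝ]) - 1‖ := by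
    rw [coe_inv_UQ, ← _root_.norm_star ((h : ℍ[ℝ]) - 1)]; simp
  have h2 : ‖wc (rs h⁻¹ ex) - 1‖ ≤ 2 * ‖(h : ℍ[ℝ]) - 1‖ := by
    have e : (1 : ℂ) = wc ex := by apply Complex.ext <;> simp [wc, ex, mkS2]
    rw [e, h1]
    exact (norm_wc_sub_le _ _).trans (norm_rs_sub_le _ _)
  have h3 := norm_pow_sub_one_le (norm_wc_le (rs h⁻¹ ex)) k
  have h4 : ‖wc (rs h⁻¹ ex) ^ k - 1‖ ≤ 1 / 2 := by
    calc _ ≤ (k : ℝ) * ‖wc (rs h⁻¹ ex) - 1‖ := h3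
      _ ≤ k * (2 * ‖(h : ℍ[ℝ]) - 1‖) := by gcongr
      _ ≤ 1 / 2 := by linarith
  have h5 := (Complex.abs_re_le_norm (wc (rs h⁻¹ ex) ^ k - 1)).trans h4
  rw [abs_le, Complex.sub_re, Complex.one_re] at h5
  linarith [h5.1]

theorem exists_VV_eig_le : ∃ k₀ : ℕ, ∀ k ≥ k₀, ∀ (l : ℝ) (v : VV k),
    genSum (VRep k) v = l • v → v ≠ 0 → l ≤ 5.93 := by
  obtain ⟨k₀, hk₀⟩ := exists_eig_le
  refine ⟨k₀, fun k hk l v hv hv0 => ?_⟩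
  refine hk₀ (k + 1) (by omega) (VV k) (VRep k) (continuous_VRep k) (schurProp_VRep k)
    ((evx ex).toLinearMap ∘ₗ (VV k).subtype) ⟨hwv (k + 1), hwv_mem_VV k⟩ ?_ ?_ (finrank_VV k)
    l v hv hv0
  · change hwv (k + 1) ex = 1
    have e : wc ex = 1 := by apply Complex.ext <;> simp [wc, ex, mkS2]
    rw [hwv_apply, e]; simp
  · intro h hh
    exact half_le_hwv (k + 1) h hh

end SphereEq

namespace SphereEq
open Quaternion

open scoped RealInnerProductSpace

section Rayleigh

variable {V : Type*} [NormedAddCommGroup V] [InnerProductSpace ℝ V] [FiniteDimensional ℝ V]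

theorem rayleigh_le {T : V →ₗ[ℝ] V} (hT : T.IsSymmetric) {M : ℝ}
    (h : ∀ i, hT.eigenvalues rfl i ≤ M) (v : V) : ⟪T v, v⟫ ≤ M * ‖v‖ ^ 2 := by
  rw [← real_inner_self_eq_norm_sq, ← (hT.eigenvectorBasis rfl).sum_inner_mul_inner (T v) v,
    ← (hT.eigenvectorBasis rfl).sum_inner_mul_inner v v, Finset.mul_sum]
  apply Finset.sum_le_sum
  intro i _
  rw [hT v, hT.apply_eigenvectorBasis, inner_smul_right, real_inner_comm v]
  change hT.eigenvalues rfl i * _ * _ ≤ _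
  nlinarith [h i, sq_nonneg (⟪hT.eigenvectorBasis rfl i, v⟫)]

theorem rayleigh_le_of_forall {T : V →ₗ[ℝ] V} (hT : T.IsSymmetric) {M : ℝ}
    (h : ∀ l v, T v = l • v → v ≠ 0 → l ≤ M) (v : V) : ⟪T v, v⟫ ≤ M * ‖v‖ ^ 2 :=
  rayleigh_le hT (fun i => h _ _ (hT.apply_eigenvectorBasis rfl i)
    ((hT.eigenvectorBasis rfl).orthonormal.ne_zero i)) v

theorem exists_rayleigh_lt {T : V →ₗ[ℝ] V} (hT : T.IsSymmetric) {M : ℝ}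
    (h : ∀ l v, T v = l • v → v ≠ 0 → l < M) : ∃ M' < M, ∀ v, ⟪T v, v⟫ ≤ M' * ‖v‖ ^ 2 := by
  have h1 : ∀ i, hT.eigenvalues rfl i < M := fun i => h _ _ (hT.apply_eigenvectorBasis rfl i)
    ((hT.eigenvectorBasis rfl).orthonormal.ne_zero i)
  obtain ⟨M', hM', h2⟩ : ∃ M' < M, ∀ i, hT.eigenvalues rfl i ≤ M' := by
    rcases isEmpty_or_nonempty (Fin (Module.finrank ℝ V)) with he | hne
    · exact ⟨M - 1, by linarith, fun i => he.elim i⟩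
    · obtain ⟨i, hi⟩ := Finite.exists_max (hT.eigenvalues rfl)
      exact ⟨_, h1 i, hi⟩
  exact ⟨M', hM', rayleigh_le hT h2⟩

end Rayleigh

theorem genSum_tl_apply (f : CS) : genSum tlRep f = ∑ s : Letter, tl (qU s) f := by
  rw [genSum_apply]; rfl

theorem card_letter : Fintype.card Letter = 6 := by simp [Letter]

theorem eq_of_inner_eq {H : Type*} [NormedAddCommGroup H] [InnerProductSpace ℝ H] {u v : H}
    (hn : ‖u‖ = ‖v‖) (h : ‖v‖ ^ 2 ≤ ⟪u, v⟫) : u = v := by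
  have := norm_sub_sq_real u v
  rw [hn] at this
  have h0 : ‖u - v‖ ^ 2 ≤ 0 := by linarith
  have h1 : ‖u - v‖ = 0 := by nlinarith [norm_nonneg (u - v)]
  exact sub_eq_zero.1 (norm_eq_zero.1 h1)

theorem tl_eq_of_genSum {l : ℝ} (hl : 6 ≤ l) {f : CS} (h : genSum tlRep f = l • f) (s : Letter) :
    tl (qU s) f = f := by
  apply eq_of_inner_eq (norm_tl _ _)
  have h1 : ∀ t : Letter, ⟪tl (qU t) f, f⟫ ≤ ‖f‖ ^ 2 := fun t => by
    have := real_inner_le_norm (tl (qU t) f) f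
    rwa [norm_tl, ← pow_two] at this
  have h2 : ∑ t : Letter, ⟪tl (qU t) f, f⟫ = l * ‖f‖ ^ 2 := by
    rw [← sum_inner, ← genSum_tl_apply, h, real_inner_smul_left, real_inner_self_eq_norm_sq]
  by_contra hlt
  push Not at hlt
  have h3 : ∑ t : Letter, ⟪tl (qU t) f, f⟫ < ∑ t : Letter, ‖f‖ ^ 2 :=
    Finset.sum_lt_sum (fun t _ => h1 t) ⟨s, Finset.mem_univ s, hlt⟩
  rw [h2, Finset.sum_const, Finset.card_univ, card_letter] at h3
  rw [nsmul_eq_mul, Nat.cast_ofNat] at h3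
  nlinarith [sq_nonneg ‖f‖]

theorem genSum_mem {W : Submodule ℝ CS} (hW : ∀ g, ∀ v ∈ W, tl g v ∈ W) {f : CS} (hf : f ∈ W) :
    genSum tlRep f ∈ W := by
  rw [genSum_tl_apply]
  exact Submodule.sum_mem _ fun s _ => hW _ _ hf

/-- The polynomials invariant under the six generators. -/
def invPoly : Subalgebra ℝ CS where
  carrier := {f | (∃ k, f ∈ PP k) ∧ ∀ s : Letter, tl (qU s) f = f}
  mul_mem' := by
    rintro f g ⟨⟨j, hj⟩, hf⟩ ⟨⟨k, hk⟩, hg⟩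
    refine ⟨⟨j + k, mul_mem_PP hj hk⟩, fun s => ?_⟩
    have : tl (qU s) (f * g) = tl (qU s) f * tl (qU s) g := rfl
    rw [this, hf, hg]
  add_mem' := by
    rintro f g ⟨⟨j, hj⟩, hf⟩ ⟨⟨k, hk⟩, hg⟩
    refine ⟨⟨j + k, Submodule.add_mem _ (PP_mono (by omega) hj) (PP_mono (by omega) hk)⟩,
      fun s => ?_⟩
    have : tl (qU s) (f + g) = tl (qU s) f + tl (qU s) g := rfl
    rw [this, hf, hg]
  algebraMap_mem' := by
    intro r
    refine ⟨⟨0, ?_⟩, fun s => rfl⟩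
    rw [Algebra.algebraMap_eq_smul_one]
    exact Submodule.smul_mem _ _ (one_mem_PP 0)

theorem exists_invPoly_le : ∃ k₀, Subalgebra.toSubmodule invPoly ≤ PP k₀ := by
  obtain ⟨k₀, hk₀⟩ := exists_VV_eig_le
  refine ⟨k₀, ?_⟩
  rintro f ⟨⟨k, hk⟩, hf⟩
  induction k with
  | zero => exact PP_mono (Nat.zero_le _) hk
  | succ k ih =>
    rcases Nat.lt_or_ge k k₀ with hlt | hge
    · exact PP_mono hlt hk
    · apply ih
      obtain ⟨g, hg, v, hv, rfl⟩ := exists_add_mem_VV hk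
      have h6 : genSum tlRep (g + v) = (6 : ℝ) • (g + v) := by
        rw [genSum_tl_apply, Finset.sum_congr rfl (fun s _ => hf s), Finset.sum_const,
          Finset.card_univ, card_letter, ← Nat.cast_smul_eq_nsmul ℝ]
        norm_num
      have hTg : genSum tlRep g ∈ PP k := genSum_mem (fun h _ hv => tl_mem_PP h hv) hg
      have hTv : genSum tlRep v ∈ VV k := genSum_mem (tl_mem_VV k) hv
      have h1 : genSum tlRep v - (6 : ℝ) • v = (6 : ℝ) • g - genSum tlRep g := by
        rw [map_add, smul_add] at h6
        rw [sub_eq_sub_iff_add_eq_add, add_comm, h6]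
      have h2 : genSum tlRep v - (6 : ℝ) • v = 0 := by
        have ha : genSum tlRep v - (6 : ℝ) • v ∈ (PP k)ᗮ :=
          (Submodule.sub_mem _ hTv (Submodule.smul_mem _ _ hv)).2
        have hb : genSum tlRep v - (6 : ℝ) • v ∈ PP k := by
          rw [h1]
          exact Submodule.sub_mem _ (Submodule.smul_mem _ _ hg) hTg
        rw [Submodule.mem_orthogonal] at ha
        exact inner_self_eq_zero.1 (ha _ hb)
      have h3 : (⟨v, hv⟩ : VV k) = 0 := by
        by_contra hne
        have := hk₀ k hge 6 ⟨v, hv⟩ (by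
          apply Subtype.ext
          have := coe_genSum_subRep tlRep (VV k) (tl_mem_VV k) ⟨v, hv⟩
          exact this.trans (sub_eq_zero.1 h2)) hne
        norm_num at this
      have h4 : v = 0 := congrArg Subtype.val h3
      rw [h4, add_zero]
      exact hg

theorem invPoly_const {f : CS} (hf : f ∈ invPoly) (x y : Sph 3) : f x = f y := by
  obtain ⟨k₀, hk₀⟩ := exists_invPoly_le
  have hfin : Module.Finite ℝ invPoly :=
    Submodule.finiteDimensional_of_le (S₁ := Subalgebra.toSubmodule invPoly) hk₀
  obtain ⟨p, hp, hpf⟩ := (Algebra.IsIntegral.of_finite ℝ invPoly).isIntegral ⟨f, hf⟩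
  have h1 : ∀ x, p.IsRoot (f x) := by
    intro x
    have h2 := congrArg ((evx x).comp invPoly.val) hpf
    rw [← Polynomial.aeval_def, ← Polynomial.aeval_algHom_apply, map_zero] at h2
    rwa [Polynomial.IsRoot, ← Polynomial.coe_aeval_eq_eval]
  have h3 : (range f).Finite := by
    apply (Polynomial.finite_setOfPred_isRoot hp.ne_zero).subset
    rintro _ ⟨x, rfl⟩
    exact h1 x
  have hr : 1 < Module.rank ℝ (EucSp 3) := by
    rw [← Module.finrank_eq_rank, finrank_euclideanSpace_fin]
    norm_num
  have : PreconnectedSpace (Sph 3) :=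
    isPreconnected_iff_preconnectedSpace.1 (isPreconnected_sphere hr 0 1)
  exact h3.countable.isTotallyDisconnected _ subset_rfl (isPreconnected_range f.continuous)
    (mem_range_self x) (mem_range_self y)

theorem exists_poly_gap : ∃ M < (6 : ℝ), ∀ k, ∀ f ∈ PP k, ⟪(1 : CS), f⟫ = 0 →
    ⟪genSum tlRep f, f⟫ ≤ M * ‖f‖ ^ 2 := by
  obtain ⟨k₀, hk₀⟩ := exists_VV_eig_le
  let Z : Submodule ℝ CS := PP k₀ ⊓ (ℝ ∙ (1 : CS))ᗮ
  have hspan : ∀ g, ∀ v ∈ (ℝ ∙ (1 : CS)), tlRep g v ∈ (ℝ ∙ (1 : CS)) := by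
    intro g v hv
    obtain ⟨c, rfl⟩ := Submodule.mem_span_singleton.1 hv
    exact Submodule.mem_span_singleton.2 ⟨c, rfl⟩
  have hZ : ∀ g, ∀ v ∈ Z, tlRep g v ∈ Z := fun g v hv =>
    ⟨tl_mem_PP g hv.1, rep_mem_orthogonal tlRep hspan g hv.2⟩
  have : FiniteDimensional ℝ Z := Submodule.finiteDimensional_of_le (inf_le_left : Z ≤ PP k₀)
  obtain ⟨M', hM', h⟩ := exists_rayleigh_lt (genSum_isSymmetric (subRep tlRep Z hZ)) (M := 6) (by
    intro l v hv hv0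
    by_contra hl
    push Not at hl
    have h1 : genSum tlRep v = l • (v : CS) := by
      rw [← coe_genSum_subRep tlRep Z hZ, hv]; rfl
    have h2 : (v : CS) ∈ invPoly := ⟨⟨k₀, v.2.1⟩, tl_eq_of_genSum hl h1⟩
    have h3 : (v : CS) = ((v : CS) ez) • (1 : CS) := by
      ext x
      rw [invPoly_const h2 x ez]
      simp
    have h4 : ⟪(v : CS), (v : CS)⟫ = 0 := by
      nth_rw 1 [h3]
      exact v.2.2 _ (Submodule.mem_span_singleton.2 ⟨_, rfl⟩)
    exact hv0 (Subtype.ext (inner_self_eq_zero.1 h4)))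
  refine ⟨max M' 5.93, max_lt hM' (by norm_num), ?_⟩
  intro k
  induction k with
  | zero =>
    intro f hf h1
    have hfZ : f ∈ Z := by
      refine ⟨PP_mono (Nat.zero_le _) hf, ?_⟩
      change f ∈ (ℝ ∙ (1 : CS))ᗮ
      rwa [Submodule.mem_orthogonal_singleton_iff_inner_right]
    have h2 := h ⟨f, hfZ⟩
    have h3 : ⟪genSum tlRep f, f⟫ ≤ M' * ‖f‖ ^ 2 := by
      rw [← coe_genSum_subRep tlRep Z hZ ⟨f, hfZ⟩]
      exact h2
    exact h3.trans (by gcongr; exact le_max_left _ _)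
  | succ k ih =>
    intro f hf h1
    rcases Nat.lt_or_ge k k₀ with hlt | hge
    · have hfZ : f ∈ Z := by
        refine ⟨PP_mono hlt hf, ?_⟩
        change f ∈ (ℝ ∙ (1 : CS))ᗮ
        rwa [Submodule.mem_orthogonal_singleton_iff_inner_right]
      have h2 := h ⟨f, hfZ⟩
      have h3 : ⟪genSum tlRep f, f⟫ ≤ M' * ‖f‖ ^ 2 := by
        rw [← coe_genSum_subRep tlRep Z hZ ⟨f, hfZ⟩]
        exact h2
      exact h3.trans (by gcongr; exact le_max_left _ _)
    · obtain ⟨g, hg, v, hv, rfl⟩ := exists_add_mem_VV hf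
      have hTg : genSum tlRep g ∈ PP k := genSum_mem (fun h _ hv => tl_mem_PP h hv) hg
      have hTv : genSum tlRep v ∈ VV k := genSum_mem (tl_mem_VV k) hv
      have ho : ∀ a ∈ PP k, ∀ b ∈ VV k, ⟪a, b⟫ = 0 := by
        intro a ha b hb
        have hb' : b ∈ (PP k)ᗮ := hb.2
        rw [Submodule.mem_orthogonal] at hb'
        exact hb' a ha
      rw [inner_add_right, ho _ (one_mem_PP k) v hv, add_zero] at h1
      have h2 := ih g hg h1
      have h3 : ⟪genSum tlRep v, v⟫ ≤ max M' 5.93 * ‖v‖ ^ 2 := by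
        have := rayleigh_le_of_forall (genSum_isSymmetric (VRep k)) (hk₀ k hge) ⟨v, hv⟩
        have h4 : ⟪genSum tlRep v, v⟫ ≤ 5.93 * ‖v‖ ^ 2 := by
          rw [← coe_genSum_subRep tlRep (VV k) (tl_mem_VV k) ⟨v, hv⟩]
          exact this
        exact h4.trans (by gcongr; exact le_max_right _ _)
      have h5 : ‖g + v‖ ^ 2 = ‖g‖ ^ 2 + ‖v‖ ^ 2 := by
        rw [norm_add_sq_real, ho g hg v hv]; ring
      rw [map_add, inner_add_left, inner_add_right, inner_add_right, ho _ hTg v hv,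
        real_inner_comm g (genSum tlRep v), ho g hg _ hTv, h5]
      linarith

end SphereEq

namespace SphereEq
open Quaternion

open scoped RealInnerProductSpace

/-- Spectral gap for polynomials, without normalisation of the mean. -/
theorem exists_poly_gap_sq : ∃ C > (0 : ℝ), ∀ k, ∀ f ∈ PP k,
    ‖f - ⟪(1 : CS), f⟫ • (1 : CS)‖ ^ 2 ≤ C * ∑ s : Letter, ‖tl (qU s) f - f‖ ^ 2 := by
  obtain ⟨M, hM, h⟩ := exists_poly_gap
  refine ⟨1 / (2 * (6 - M)), by have : 0 < 6 - M := by linarith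
                                positivity, ?_⟩
  intro k f hf
  set m := ⟪(1 : CS), f⟫
  set g := f - m • (1 : CS) with hg
  have h11 : ⟪(1 : CS), (1 : CS)⟫ = 1 := by
    rw [CS.inner_def]; simp
  have hgP : g ∈ PP k := Submodule.sub_mem _ hf (Submodule.smul_mem _ _ (one_mem_PP k))
  have hg0 : ⟪(1 : CS), g⟫ = 0 := by
    rw [hg, inner_sub_right, real_inner_smul_right, h11]
    simp [m]
  have h1 := h k g hgP hg0
  have h2 : ∀ s, tl (qU s) f - f = tl (qU s) g - g := by
    intro s
    ext x
    simp [hg]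
  have h3 : ∑ s : Letter, ‖tl (qU s) f - f‖ ^ 2 = 12 * ‖g‖ ^ 2 - 2 * ⟪genSum tlRep g, g⟫ := by
    simp only [h2, norm_sub_sq_real, norm_tl]
    rw [genSum_tl_apply, sum_inner, Finset.sum_add_distrib, Finset.sum_sub_distrib,
      ← Finset.mul_sum, Finset.sum_const, Finset.card_univ, card_letter]
    simp only [nsmul_eq_mul, Nat.cast_ofNat]
    ring
  rw [h3, one_div, inv_mul_eq_div, le_div_iff₀ (by linarith)]
  linarith

/-- All polynomials as a subalgebra of the continuous functions. -/
def polyAlg : Subalgebra ℝ C(Sph 3, ℝ) where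
  carrier := {f | ∃ k, (f : CS) ∈ PP k}
  mul_mem' := by
    rintro f g ⟨j, hj⟩ ⟨k, hk⟩
    exact ⟨j + k, mul_mem_PP hj hk⟩
  add_mem' := by
    rintro f g ⟨j, hj⟩ ⟨k, hk⟩
    exact ⟨j + k, Submodule.add_mem _ (PP_mono (by omega) hj) (PP_mono (by omega) hk)⟩
  algebraMap_mem' := by
    intro r
    refine ⟨0, ?_⟩
    rw [Algebra.algebraMap_eq_smul_one]
    exact Submodule.smul_mem _ _ (one_mem_PP 0)

theorem polyAlg_separatesPoints : polyAlg.SeparatesPoints := by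
  intro x y hxy
  have : ∃ i, (x : EucSp 3) i ≠ (y : EucSp 3) i := by
    by_contra h
    push Not at h
    exact hxy (Subtype.ext (PiLp.ext h))
  obtain ⟨i, hi⟩ := this
  exact ⟨crd i, ⟨(crd i : C(Sph 3, ℝ)), ⟨1, crd_mem_PP i⟩, rfl⟩, hi⟩

theorem integrable_of_bdd {α : Type*} [MeasurableSpace α] {μ : Measure α} [IsFiniteMeasure μ]
    {f : α → ℝ} (hf : Measurable f) (C : ℝ) (hC : ∀ x, |f x| ≤ C) : Integrable f μ :=
  Integrable.of_bound hf.aestronglyMeasurable C (Filter.Eventually.of_forall hC)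

theorem exists_poly_near {U : Set (Sph 3)} (hU : MeasurableSet U) {ε : ℝ} (hε : 0 < ε) :
    ∃ k, ∃ f ∈ PP k, ∫ x, (U.indicator 1 x - f x) ^ 2 ∂sig ≤ ε := by
  have hmem : MemLp (U.indicator (1 : Sph 3 → ℝ)) (ENNReal.ofReal 2) sig :=
    (memLp_const (1 : ℝ)).indicator hU
  obtain ⟨g, hg, -⟩ := hmem.exists_boundedContinuous_integral_rpow_sub_le (by norm_num)
    (show 0 < ε / 4 by positivity)
  obtain ⟨⟨f, k, hk⟩, hf⟩ := ContinuousMap.exists_mem_subalgebra_near_continuous_of_separatesPoints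
    polyAlg polyAlg_separatesPoints g g.continuous (√ε / 2) (by positivity)
  refine ⟨k, f, hk, ?_⟩
  have hb : ∀ x, (U.indicator (1 : Sph 3 → ℝ) x - f x) ^ 2 ≤
      2 * ‖U.indicator (1 : Sph 3 → ℝ) x - g x‖ ^ (2 : ℝ) + ε / 2 := by
    intro x
    have h1 := (hf x).le
    change ‖f x - g x‖ ≤ _ at h1
    have h2 : ‖f x - g x‖ ^ 2 ≤ (√ε / 2) ^ 2 := by gcongr
    rw [div_pow, Real.sq_sqrt hε.le, Real.norm_eq_abs, sq_abs] at h2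
    rw [Real.rpow_two, Real.norm_eq_abs, sq_abs]
    nlinarith [sq_nonneg ((U.indicator (1 : Sph 3 → ℝ) x - g x) + (f x - g x))]
  have hi1 : Integrable (fun x => ‖U.indicator (1 : Sph 3 → ℝ) x - g x‖ ^ (2 : ℝ)) sig := by
    simp only [Real.rpow_two, Real.norm_eq_abs, sq_abs]
    refine integrable_of_bdd
      (((measurable_one.indicator hU).sub g.continuous.measurable).pow_const 2)
      ((1 + ‖g‖) ^ 2) ?_
    intro x
    rw [abs_pow]
    gcongr
    refine (abs_sub _ _).trans (add_le_add ?_ (g.norm_coe_le_norm x))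
    by_cases hx : x ∈ U <;> simp [hx]
  calc ∫ x, (U.indicator 1 x - f x) ^ 2 ∂sig
      ≤ ∫ x, (2 * ‖U.indicator (1 : Sph 3 → ℝ) x - g x‖ ^ (2 : ℝ) + ε / 2) ∂sig :=
        integral_mono_of_nonneg (Filter.Eventually.of_forall fun x => sq_nonneg _)
          ((hi1.const_mul 2).add (integrable_const _)) (Filter.Eventually.of_forall hb)
    _ = 2 * ∫ x, ‖U.indicator (1 : Sph 3 → ℝ) x - g x‖ ^ (2 : ℝ) ∂sig + ε / 2 := by
        rw [integral_add (hi1.const_mul 2) (integrable_const _), integral_const_mul]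
        simp
    _ ≤ ε := by linarith

theorem CS.norm_sq (f : CS) : ‖f‖ ^ 2 = ∫ x, f x ^ 2 ∂sig := by
  rw [← real_inner_self_eq_norm_sq, CS.inner_def]
  simp only [pow_two]

theorem integral_comp_rs (h : UQ) (f : Sph 3 → ℝ) (hf : Measurable f) :
    ∫ x, f (rs h x) ∂sig = ∫ x, f x ∂sig := by
  nth_rw 2 [← (measurePreserving_rs h).map_eq]
  rw [integral_map (continuous_rs_right _).measurable.aemeasurable hf.aestronglyMeasurable]

theorem exists_abs_le (f : CS) : ∃ K, ∀ x, |f x| ≤ K := by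
  let g : C(Sph 3, ℝ) := f
  exact ⟨‖g‖, fun x => g.norm_coe_le_norm x⟩

theorem sq_indicator_sub_indicator {α : Type*} (A B : Set α) (x : α) :
    (A.indicator (1 : α → ℝ) x - B.indicator 1 x) ^ 2 = (symmDiff A B).indicator 1 x := by
  by_cases ha : x ∈ A <;> by_cases hb : x ∈ B <;> simp [ha, hb, Set.mem_symmDiff]

theorem exists_set_gap_aux : ∃ C > (0 : ℝ), ∀ U : Set (Sph 3), MeasurableSet U →
    sig.real U - sig.real U ^ 2 ≤ C * ∑ s : Letter,
      sig.real (symmDiff (rs (qU s)⁻¹ ⁻¹' U) U) := by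
  obtain ⟨C, hC, h⟩ := exists_poly_gap_sq
  refine ⟨4 * C, by positivity, fun U hU => ?_⟩
  apply le_of_forall_pos_le_add
  intro δ hδ
  set ε : ℝ := δ / (96 * C + 2) with hε
  have hε0 : 0 < ε := by positivity
  obtain ⟨k, f, hf, hfe⟩ := exists_poly_near hU hε0
  set u : Sph 3 → ℝ := U.indicator 1 with hu
  have hum : Measurable u := measurable_one.indicator hU
  have hub : ∀ x, |u x| ≤ 1 := by
    intro x; by_cases hx : x ∈ U <;> simp [hu, hx]
  have hfm : Measurable f := f.continuous.measurable
  obtain ⟨K, hK⟩ := exists_abs_le f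
  set m := ⟪(1 : CS), f⟫
  have hi_sub : ∀ F G : Sph 3 → ℝ, Measurable F → Measurable G → ∀ a b, (∀ x, |F x| ≤ a) →
      (∀ x, |G x| ≤ b) → Integrable (fun x => (F x - G x) ^ 2) sig := by
    intro F G hF hG a b ha hb
    refine integrable_of_bdd ((hF.sub hG).pow_const 2) ((a + b) ^ 2) fun x => ?_
    rw [abs_pow]
    gcongr
    exact (abs_sub _ _).trans (add_le_add (ha x) (hb x))
  have hrm : ∀ s : Letter, Measurable (rs (qU s)⁻¹) := fun s => (continuous_rs_right _).measurable
  have e1 : ∫ x, (u x - m) ^ 2 ∂sig = sig.real U - 2 * m * sig.real U + m ^ 2 := by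
    have : ∀ x, (u x - m) ^ 2 = (1 - 2 * m) * U.indicator 1 x + m ^ 2 := by
      intro x; by_cases hx : x ∈ U <;> simp [hu, hx]; ring
    simp only [this]
    rw [integral_add ((integrable_of_bdd hum 1 hub).const_mul _) (integrable_const _),
      integral_const_mul, integral_indicator_one hU]
    simp; ring
  have e2 : ∫ x, (u x - m) ^ 2 ∂sig ≤ 2 * ‖f - m • (1 : CS)‖ ^ 2 + 2 * ε := by
    have hfm2 := hi_sub f (fun _ => m) hfm measurable_const K |m| hK (fun _ => le_rfl)
    have huf := hi_sub u f hum hfm 1 K hub hK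
    calc ∫ x, (u x - m) ^ 2 ∂sig ≤ ∫ x, (2 * (f x - m) ^ 2 + 2 * (u x - f x) ^ 2) ∂sig := by
          apply integral_mono (hi_sub u (fun _ => m) hum measurable_const 1 |m| hub
            (fun _ => le_rfl)) ((hfm2.const_mul 2).add (huf.const_mul 2))
          intro x
          change (u x - m) ^ 2 ≤ 2 * (f x - m) ^ 2 + 2 * (u x - f x) ^ 2
          nlinarith [sq_nonneg ((f x - m) - (u x - f x))]
      _ = 2 * ∫ x, (f x - m) ^ 2 ∂sig + 2 * ∫ x, (u x - f x) ^ 2 ∂sig := by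
          rw [integral_add (hfm2.const_mul 2) (huf.const_mul 2), integral_const_mul,
            integral_const_mul]
      _ ≤ 2 * ‖f - m • (1 : CS)‖ ^ 2 + 2 * ε := by
          rw [CS.norm_sq]
          simp only [CS.sub_apply, CS.smul_apply, CS.one_apply, mul_one]
          linarith
  have e3 : ∀ s : Letter, ‖tl (qU s) f - f‖ ^ 2 ≤
      2 * sig.real (symmDiff (rs (qU s)⁻¹ ⁻¹' U) U) + 8 * ε := by
    intro s
    have hA := hi_sub (fun x => u (rs (qU s)⁻¹ x)) u (hum.comp (hrm s)) hum 1 1 (fun x => hub _) hub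
    have hB := hi_sub (fun x => u (rs (qU s)⁻¹ x)) (fun x => f (rs (qU s)⁻¹ x)) (hum.comp (hrm s))
      (hfm.comp (hrm s)) 1 K (fun x => hub _) (fun x => hK _)
    have huf := hi_sub u f hum hfm 1 K hub hK
    have eA : ∫ x, (u (rs (qU s)⁻¹ x) - u x) ^ 2 ∂sig =
        sig.real (symmDiff (rs (qU s)⁻¹ ⁻¹' U) U) := by
      rw [← integral_indicator_one (((hrm s) hU).symmDiff hU)]
      congr 1
      funext x
      exact sq_indicator_sub_indicator (rs (qU s)⁻¹ ⁻¹' U) U x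
    have eB : ∫ x, (u (rs (qU s)⁻¹ x) - f (rs (qU s)⁻¹ x)) ^ 2 ∂sig = ∫ x, (u x - f x) ^ 2 ∂sig :=
      integral_comp_rs _ (fun x => (u x - f x) ^ 2) ((hum.sub hfm).pow_const 2)
    have hAB : Integrable (fun x => 2 * (u (rs (qU s)⁻¹ x) - u x) ^ 2 +
        4 * (u (rs (qU s)⁻¹ x) - f (rs (qU s)⁻¹ x)) ^ 2) sig :=
      (hA.const_mul 2).add (hB.const_mul 4)
    rw [CS.norm_sq]
    calc ∫ x, (tl (qU s) f - f) x ^ 2 ∂sig ≤ ∫ x, (2 * (u (rs (qU s)⁻¹ x) - u x) ^ 2 +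
          4 * (u (rs (qU s)⁻¹ x) - f (rs (qU s)⁻¹ x)) ^ 2 + 4 * (u x - f x) ^ 2) ∂sig := by
          refine integral_mono (CS.integrable ((tl (qU s) f - f).continuous.pow 2))
            (hAB.add (huf.const_mul 4)) ?_
          intro x
          change (f (rs (qU s)⁻¹ x) - f x) ^ 2 ≤ 2 * (u (rs (qU s)⁻¹ x) - u x) ^ 2 +
            4 * (u (rs (qU s)⁻¹ x) - f (rs (qU s)⁻¹ x)) ^ 2 + 4 * (u x - f x) ^ 2
          set a := u (rs (qU s)⁻¹ x)
          set b := f (rs (qU s)⁻¹ x)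
          nlinarith [sq_nonneg ((a - u x) + (a - b) - (u x - f x)),
            sq_nonneg ((a - b) + (u x - f x))]
      _ = 2 * sig.real (symmDiff (rs (qU s)⁻¹ ⁻¹' U) U) + 4 * ∫ x, (u x - f x) ^ 2 ∂sig +
          4 * ∫ x, (u x - f x) ^ 2 ∂sig := by
          rw [integral_add hAB (huf.const_mul 4),
            integral_add (hA.const_mul 2) (hB.const_mul 4), integral_const_mul, integral_const_mul,
            integral_const_mul, eA, eB]
      _ ≤ _ := by linarith
  have e4 := h k f hf
  have e5 : ∑ s : Letter, ‖tl (qU s) f - f‖ ^ 2 ≤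
      2 * ∑ s : Letter, sig.real (symmDiff (rs (qU s)⁻¹ ⁻¹' U) U) + 48 * ε := by
    refine (Finset.sum_le_sum fun s _ => e3 s).trans (le_of_eq ?_)
    rw [Finset.sum_add_distrib, ← Finset.mul_sum, Finset.sum_const, Finset.card_univ, card_letter]
    simp only [nsmul_eq_mul, Nat.cast_ofNat]
    ring
  have e6 := mul_le_mul_of_nonneg_left e5 hC.le
  have e7 : ε * (96 * C + 2) = δ := by rw [hε]; field_simp
  nlinarith [sq_nonneg (m - sig.real U)]

/-- Invariance defect of a set under a rotation of `S²` is controlled by that under the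
generators. -/
theorem exists_defect_le : ∃ C : NNReal, ∀ (U : Set (Sph 3)) (g : UQ), MeasurableSet U →
    sig (symmDiff (rs g ⁻¹' U) U) ≤ C * ∑ s : Letter, sig (symmDiff (rs (qU s) ⁻¹' U) U) := by
  obtain ⟨C, hC, h⟩ := exists_set_gap_aux
  refine ⟨⟨4 * C, by positivity⟩, fun U g hU => ?_⟩
  have h1 := h U hU
  have h2 : ∑ s : Letter, sig.real (symmDiff (rs (qU s)⁻¹ ⁻¹' U) U) =
      ∑ s : Letter, sig.real (symmDiff (rs (qU s) ⁻¹' U) U) := by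
    apply Finset.sum_bij (fun s _ => linv s)
    · simp
    · intro a _ b _ h; exact linv_inj.1 h
    · intro b _; exact ⟨linv b, by simp, by simp⟩
    · intro s _
      rw [qU_linv]
  rw [h2] at h1
  have hm : Measurable (rs g) := (continuous_rs_right _).measurable
  have hp : sig.real (rs g ⁻¹' U) = sig.real U := by
    rw [measureReal_def, measureReal_def, (measurePreserving_rs g).measure_preimage
      hU.nullMeasurableSet]
  have a1 : sig.real (symmDiff (rs g ⁻¹' U) U) ≤ sig.real U + sig.real U := by
    nth_rw 1 [← hp]
    exact (measureReal_mono symmDiff_subset_union).trans (measureReal_union_le _ _)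
  have a2 : sig.real (symmDiff (rs g ⁻¹' U) U) ≤ (1 - sig.real U) + (1 - sig.real U) := by
    rw [← probReal_compl_eq_one_sub hU]
    have : sig.real (rs g ⁻¹' U)ᶜ = sig.real Uᶜ := by
      rw [probReal_compl_eq_one_sub hU, probReal_compl_eq_one_sub (hm hU), hp]
    nth_rw 1 [← this]
    rw [← compl_symmDiff_compl]
    exact (measureReal_mono symmDiff_subset_union).trans (measureReal_union_le _ _)
  have a3 : sig.real U ≤ 1 := measureReal_le_one
  have a4 : 0 ≤ sig.real U := measureReal_nonneg
  have a5 : sig.real (symmDiff (rs g ⁻¹' U) U) ≤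
      4 * C * ∑ s : Letter, sig.real (symmDiff (rs (qU s) ⁻¹' U) U) := by
    rcases le_total (sig.real U) (1 / 2) with hh | hh <;> nlinarith
  have a6 := ENNReal.ofReal_le_ofReal a5
  rw [ENNReal.ofReal_mul (by positivity), ENNReal.ofReal_sum_of_nonneg
    (fun _ _ => measureReal_nonneg)] at a6
  simp only [measureReal_def, ENNReal.ofReal_toReal (measure_ne_top sig _)] at a6
  convert a6 using 2
  rw [ENNReal.ofReal, Real.toNNReal_of_nonneg (by positivity)]
  rfl

end SphereEq

namespace SphereEq
open Quaternion

open scoped RealInnerProductSpace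

section Block

variable {n : ℕ}

theorem sum_sq_sphere (x : Sph n) : ∑ j, (x : EucSp n) j ^ 2 = 1 := by
  have h := norm_eq_of_mem_sphere x
  rw [EuclideanSpace.norm_eq, Real.sqrt_eq_one] at h
  simpa using h

theorem mem_sphere_of_sum_sq (v : Fin n → ℝ) (h : ∑ j, v j ^ 2 = 1) :
    (WithLp.toLp 2 v : EucSp n) ∈ sphere (0 : EucSp n) 1 := by
  rw [mem_sphere_zero_iff_norm, EuclideanSpace.norm_eq, Real.sqrt_eq_one]
  simpa using h

theorem exists_dir (v : Fin 3 → ℝ) :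
    ∃ ω : Sph 3, ∀ a, v a = √(∑ b, v b ^ 2) * (ω : EucSp 3) a := by
  set r := √(∑ b, v b ^ 2) with hr
  have hs : r ^ 2 = v 0 ^ 2 + v 1 ^ 2 + v 2 ^ 2 := by
    rw [hr, Real.sq_sqrt (by positivity), Fin.sum_univ_three]
  by_cases h0 : r = 0
  · refine ⟨ez, fun a => ?_⟩
    rw [h0, zero_mul]
    have : ∑ b, v b ^ 2 = 0 := by rw [Fin.sum_univ_three, ← hs, h0]; norm_num
    rw [Finset.sum_eq_zero_iff_of_nonneg (fun _ _ => sq_nonneg _)] at this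
    simpa using this a (Finset.mem_univ a)
  · refine ⟨mkS2 (v 0 / r) (v 1 / r) (v 2 / r) ?_, fun a => ?_⟩
    · field_simp
      linarith
    · fin_cases a <;> simp [mkS2] <;> field_simp

theorem exists_chart (I : Fin 3 ↪ Fin n) (x : Sph n) : ∃ (e : Sph 3 → Sph n) (ω : Sph 3),
    Continuous e ∧ e ω = x ∧ ∀ h y, ac I h (e y) = e (rs h y) := by
  obtain ⟨ω, hω⟩ := exists_dir (((x : EucSp n) : Fin n → ℝ) ∘ I)
  set r := √(∑ b, (((x : EucSp n) : Fin n → ℝ) ∘ I) b ^ 2) with hr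
  have hr2 : r ^ 2 = ∑ b, (x : EucSp n) (I b) ^ 2 := Real.sq_sqrt (by positivity)
  let f : Sph 3 → Fin n → ℝ := fun y =>
    Function.extend I (fun a => r * (y : EucSp 3) a) (x : EucSp n)
  have fI : ∀ y a, f y (I a) = r * (y : EucSp 3) a := fun y a => I.injective.extend_apply _ _ a
  have fn : ∀ y j, (¬∃ a, I a = j) → f y j = (x : EucSp n) j :=
    fun y j hj => Function.extend_apply' _ _ j hj
  have hf : ∀ y, ∑ j, f y j ^ 2 = 1 := by
    intro y
    rw [← sum_sq_sphere x, sum_split I, sum_split I (fun j => (x : EucSp n) j ^ 2), ← hr2]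
    congr 1
    · simp only [fI, mul_pow]
      rw [← Finset.mul_sum, sum_sq_sphere y, mul_one]
    · apply Finset.sum_congr rfl
      intro j hj
      rw [fn y j (by simpa using hj)]
  refine ⟨fun y => ⟨WithLp.toLp 2 (f y), mem_sphere_of_sum_sq _ (hf y)⟩, ω, ?_, ?_, ?_⟩
  · apply Continuous.subtype_mk
    apply (PiLp.continuous_toLp 2 _).comp
    apply continuous_pi
    intro j
    by_cases hj : ∃ a, I a = j
    · obtain ⟨a, rfl⟩ := hj
      simp only [fI]
      exact continuous_const.mul (continuous_coord a)
    · simp only [fn _ j hj]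
      exact continuous_const
  · apply Subtype.ext
    ext j
    change f ω j = _
    by_cases hj : ∃ a, I a = j
    · obtain ⟨a, rfl⟩ := hj
      rw [fI]; exact (hω a).symm
    · exact fn _ j hj
  · intro h y
    apply Subtype.ext
    ext j
    rw [coe_ac]
    change blockFun I h (f y) j = f (rs h y) j
    by_cases hj : ∃ a, I a = j
    · obtain ⟨a, rfl⟩ := hj
      rw [blockFun_apply, fI, coe_rs]
      have : f y ∘ I = r • ((y : EucSp 3) : Fin 3 → ℝ) := by
        funext b; exact fI y b
      rw [this, rotFun_smul]; rfl
    · rw [blockFun_apply' I _ _ j hj, fn _ j hj, fn _ j hj]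

theorem measure_eq_lintegral_ac (μ : Measure (Sph n)) [IsProbabilityMeasure μ] (I : Fin 3 ↪ Fin n)
    (hμ : ∀ h, MeasurePreserving (ac I h) μ μ) {E : Set (Sph n)} (hE : MeasurableSet E) :
    μ E = ∫⁻ x, nu {h | ac I h x ∈ E} ∂μ := by
  have hS : MeasurableSet {p : UQ × Sph n | ac I p.1 p.2 ∈ E} :=
    (continuous_ac I).measurable hE
  have h1 := Measure.prod_apply (μ := nu) (ν := μ) hS
  have h2 := Measure.prod_apply_symm (μ := nu) (ν := μ) hS
  rw [h1] at h2
  have h3 : ∀ h, μ (Prod.mk h ⁻¹' {p : UQ × Sph n | ac I p.1 p.2 ∈ E}) = μ E := fun h =>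
    (hμ h).measure_preimage hE.nullMeasurableSet
  simp only [h3, lintegral_const, measure_univ, mul_one] at h2
  exact h2

theorem block_defect_le : ∃ C : NNReal, ∀ (n : ℕ) (μ : Measure (Sph n)) [IsProbabilityMeasure μ]
    (I : Fin 3 ↪ Fin n), (∀ h, MeasurePreserving (ac I h) μ μ) → ∀ (g : UQ) (U : Set (Sph n)),
    MeasurableSet U → μ (symmDiff (ac I g ⁻¹' U) U) ≤
      C * ∑ s : Letter, μ (symmDiff (ac I (qU s) ⁻¹' U) U) := by
  obtain ⟨C, hC⟩ := exists_defect_le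
  refine ⟨C, fun n μ _ I hμ g U hU => ?_⟩
  have hm : ∀ h, MeasurableSet (symmDiff (ac I h ⁻¹' U) U) := fun h =>
    ((hμ h).measurable hU).symmDiff hU
  have hloc : ∀ x : Sph n, ∃ V : Set (Sph 3), MeasurableSet V ∧ ∀ g,
      nu {h | ac I h x ∈ symmDiff (ac I g ⁻¹' U) U} = sig (symmDiff (rs g ⁻¹' V) V) := by
    intro x
    obtain ⟨e, ω, he, rfl, hee⟩ := exists_chart I x
    refine ⟨e ⁻¹' U, he.measurable hU, fun g => ?_⟩
    have hV : MeasurableSet (symmDiff (rs g ⁻¹' (e ⁻¹' U)) (e ⁻¹' U)) :=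
      ((continuous_rs_right g).measurable (he.measurable hU)).symmDiff (he.measurable hU)
    rw [← map_rs_eq_sig ω, Measure.map_apply (continuous_rs_left ω).measurable hV]
    congr 1
    ext h
    simp only [Set.mem_ofPred_eq, mem_preimage, mem_symmDiff, hee]
  have hmeas : ∀ g, Measurable fun x => nu {h | ac I h x ∈ symmDiff (ac I g ⁻¹' U) U} := fun g =>
    measurable_measure_prodMk_right ((continuous_ac I).measurable (hm g))
  have hsum : (C : ℝ≥0∞) * ∑ s : Letter, μ (symmDiff (ac I (qU s) ⁻¹' U) U) =
      ∫⁻ x, C * ∑ s : Letter, nu {h | ac I h x ∈ symmDiff (ac I (qU s) ⁻¹' U) U} ∂μ := by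
    rw [lintegral_const_mul _ (Finset.measurable_sum _ fun s _ => hmeas _),
      lintegral_finsetSum _ (fun s _ => hmeas _)]
    congr 1
    exact Finset.sum_congr rfl fun s _ => measure_eq_lintegral_ac μ I hμ (hm _)
  rw [hsum, measure_eq_lintegral_ac μ I hμ (hm g)]
  apply lintegral_mono
  intro x
  obtain ⟨V, hV, h⟩ := hloc x
  simp only [h]
  exact hC V g hV

end Block

section Control

variable {n : ℕ}

/-- Total defect of invariance of a set under the generating rotations of all blocks. -/
def dl (μ : Measure (Sph n)) (U : Set (Sph n)) : ℝ≥0∞ :=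
  ∑ I : Fin 3 ↪ Fin n, ∑ s : Letter, μ (symmDiff (ac I (qU s) ⁻¹' U) U)

/-- `μ` is invariant under rotations. -/
def RotInv (μ : Measure (Sph n)) : Prop :=
  ∀ γ : EucSp n ≃ₗᵢ[ℝ] EucSp n, IsRotation γ → MeasurePreserving (rotateSphere γ) μ μ

/-- Products of at most `N` block rotations. -/
inductive WB (n : ℕ) : ℕ → (EucSp n ≃ₗᵢ[ℝ] EucSp n) → Prop
  | one (N : ℕ) : WB n N 1
  | cons (N : ℕ) (I : Fin 3 ↪ Fin n) (h : UQ) (γ : EucSp n ≃ₗᵢ[ℝ] EucSp n) :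
      WB n N γ → WB n (N + 1) (bl I h * γ)

theorem WB.isRotation {N : ℕ} {γ : EucSp n ≃ₗᵢ[ℝ] EucSp n} (h : WB n N γ) : IsRotation γ := by
  induction h with
  | one N => exact isRotation_one
  | cons N I h γ _ ih => exact isRotation_mul (isRotation_bl I h) ih

theorem WB.mono {N M : ℕ} (hNM : N ≤ M) {γ : EucSp n ≃ₗᵢ[ℝ] EucSp n} (h : WB n N γ) :
    WB n M γ := by
  induction h generalizing M with
  | one N => exact .one M
  | cons N I h γ _ ih =>
    obtain ⟨M, rfl⟩ : ∃ M', M = M' + 1 := ⟨M - 1, by omega⟩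
    exact .cons M I h γ (ih (by omega))

theorem WB.mul {N M : ℕ} {γ δ : EucSp n ≃ₗᵢ[ℝ] EucSp n} (h : WB n N γ) (h' : WB n M δ) :
    WB n (N + M) (γ * δ) := by
  induction h with
  | one N => rw [one_mul]; exact h'.mono (by omega)
  | cons N I h γ _ ih =>
    rw [mul_assoc, Nat.add_right_comm]; exact .cons _ I h _ ih

theorem WB.block (I : Fin 3 ↪ Fin n) (h : UQ) : WB n 1 (bl I h) := by
  have := WB.cons 0 I h 1 (.one 0)
  rwa [mul_one] at this

theorem WB.inv {N : ℕ} {γ : EucSp n ≃ₗᵢ[ℝ] EucSp n} (h : WB n N γ) : WB n N γ⁻¹ := by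
  induction h with
  | one N => rw [inv_one]; exact .one N
  | cons N I h γ _ ih =>
    rw [mul_inv_rev, ← map_inv]; exact ih.mul (.block I _)

theorem symmDiff_preimage_mul (μ : Measure (Sph n)) {γ δ : EucSp n ≃ₗᵢ[ℝ] EucSp n}
    (hδ : MeasurePreserving (rotateSphere δ) μ μ) (hγ : MeasurePreserving (rotateSphere γ) μ μ)
    {U : Set (Sph n)} (hU : MeasurableSet U) :
    μ (symmDiff (rotateSphere (γ * δ) ⁻¹' U) U) ≤
      μ (symmDiff (rotateSphere γ ⁻¹' U) U) + μ (symmDiff (rotateSphere δ ⁻¹' U) U) := by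
  refine (measure_symmDiff_le _ (rotateSphere δ ⁻¹' U) _).trans ?_
  have : rotateSphere (γ * δ) ⁻¹' U = rotateSphere δ ⁻¹' (rotateSphere γ ⁻¹' U) := rfl
  rw [this, ← preimage_symmDiff,
    hδ.measure_preimage ((hγ.measurable hU).symmDiff hU).nullMeasurableSet]

theorem exists_WB_defect_le : ∃ C : NNReal, ∀ (n : ℕ) (μ : Measure (Sph n))
    [IsProbabilityMeasure μ], RotInv μ → ∀ (N : ℕ) (γ : EucSp n ≃ₗᵢ[ℝ] EucSp n), WB n N γ →
    ∀ (U : Set (Sph n)), MeasurableSet U →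
    μ (symmDiff (rotateSphere γ ⁻¹' U) U) ≤ N * C * dl μ U := by
  obtain ⟨C, hC⟩ := block_defect_le
  refine ⟨C, fun n μ _ hμ N γ hγ U hU => ?_⟩
  induction hγ with
  | one N =>
    have : rotateSphere (1 : EucSp n ≃ₗᵢ[ℝ] EucSp n) ⁻¹' U = U := rfl
    rw [this, symmDiff_self]; simp
  | cons N I h γ hγ ih =>
    refine (symmDiff_preimage_mul μ (hμ γ hγ.isRotation) (hμ _ (isRotation_bl I h)) hU).trans ?_
    have h1 := hC n μ I (fun h => hμ _ (isRotation_bl I h)) h U hU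
    have h2 : ∑ s : Letter, μ (symmDiff (ac I (qU s) ⁻¹' U) U) ≤ dl μ U :=
      Finset.single_le_sum (f := fun I : Fin 3 ↪ Fin n =>
        ∑ s : Letter, μ (symmDiff (ac I (qU s) ⁻¹' U) U)) (fun _ _ => zero_le) (Finset.mem_univ I)
    calc _ ≤ C * dl μ U + N * C * dl μ U := add_le_add (h1.trans (by gcongr)) ih
      _ = _ := by push_cast; ring

end Control

end SphereEq

namespace SphereEq
open Quaternion

open scoped RealInnerProductSpace

section Transitive

variable {n : ℕ}

/-- The embedding of three indices with given distinct values. -/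
def emb3 {a b c : Fin n} (hab : a ≠ b) (hac : a ≠ c) (hbc : b ≠ c) : Fin 3 ↪ Fin n :=
  ⟨![a, b, c], by
    intro i j h
    fin_cases i <;> fin_cases j <;> simp_all [eq_comm]⟩

/-- The basis vector as a point of the sphere. -/
def pole (o : Fin n) : Sph n := ⟨EuclideanSpace.single o 1, by simp⟩

theorem coe_pole (o j : Fin n) : (pole o : EucSp n) j = if j = o then 1 else 0 := by
  simp [pole]

theorem exists_ac_normalize (I : Fin 3 ↪ Fin n) (x : Sph n) : ∃ h : UQ,
    (ac I h x : EucSp n) (I 0) = 0 ∧ (ac I h x : EucSp n) (I 1) = 0 ∧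
    0 ≤ (ac I h x : EucSp n) (I 2) := by
  obtain ⟨ω, hω⟩ := exists_dir (((x : EucSp n) : Fin n → ℝ) ∘ I)
  set r := √(∑ b, (((x : EucSp n) : Fin n → ℝ) ∘ I) b ^ 2) with hr
  obtain ⟨g, hg⟩ := exists_rs_ez ω
  have hv : ((x : EucSp n) : Fin n → ℝ) ∘ I = r • ((ω : EucSp 3) : Fin 3 → ℝ) := by
    funext b; exact hω b
  have key : ∀ a, (ac I g⁻¹ x : EucSp n) (I a) = r * (ez : EucSp 3) a := by
    intro a
    rw [coe_ac, blockFun_apply, hv, rotFun_smul]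
    have : rs g⁻¹ ω = ez := by rw [← hg, rs_inv_apply]
    rw [← this, coe_rs]; rfl
  refine ⟨g⁻¹, ?_, ?_, ?_⟩
  · rw [key]; simp
  · rw [key]; simp
  · rw [key]; simp [hr, Real.sqrt_nonneg]

theorem exists_WB_zero (hn : 3 ≤ n) (o : Fin n) (x : Sph n) (T : Finset (Fin n)) (hT : o ∉ T) :
    ∃ k, WB n T.card k ∧ (∀ j ∈ T, (rotateSphere k x : EucSp n) j = 0) ∧
      (T.Nonempty → 0 ≤ (rotateSphere k x : EucSp n) o) := by
  induction T using Finset.induction_on with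
  | empty => exact ⟨1, .one _, by simp, by simp⟩
  | insert b T hb ih =>
    rw [Finset.mem_insert, not_or] at hT
    obtain ⟨k, hk, h0, -⟩ := ih hT.2
    obtain ⟨a, ha⟩ : ∃ a : Fin n, a ∉ ({b, o} : Finset (Fin n)) := by
      by_contra! h
      have h1 : (Finset.univ : Finset (Fin n)) ⊆ {b, o} := fun a _ => h a
      have h2 := Finset.card_le_card h1
      have h3 := Finset.card_le_two (a := b) (b := o)
      simp at h2
      omega
    simp only [Finset.mem_insert, Finset.mem_singleton, not_or] at ha
    let I := emb3 ha.1 ha.2 (Ne.symm hT.1)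
    obtain ⟨h, e0, e1, e2⟩ := exists_ac_normalize I (rotateSphere k x)
    refine ⟨bl I h * k, ?_, ?_, fun _ => e2⟩
    · rw [Finset.card_insert_of_notMem hb]; exact .cons _ I h k hk
    · intro j hj
      by_cases hj' : ∃ i, I i = j
      · obtain ⟨i, rfl⟩ := hj'
        fin_cases i
        · exact e0
        · exact e1
        · exfalso
          change o ∈ insert b T at hj
          rw [Finset.mem_insert] at hj
          tauto
      · rw [Finset.mem_insert] at hj
        rcases hj with rfl | hj
        · exact absurd ⟨1, rfl⟩ hj'
        · have := h0 j hj
          rw [← this]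
          exact blockFun_apply' I _ _ j hj'

theorem exists_WB_pole (hn : 3 ≤ n) (o : Fin n) (x : Sph n) :
    ∃ k, WB n n k ∧ rotateSphere k x = pole o := by
  obtain ⟨k, hk, h0, h1⟩ := exists_WB_zero hn o x (Finset.univ.erase o) (by simp)
  have hc : (Finset.univ.erase o).card = n - 1 := by simp
  have h1 := h1 (Finset.card_pos.1 (by omega))
  refine ⟨k, hk.mono (by omega), ?_⟩
  have hs := sum_sq_sphere (rotateSphere k x)
  rw [Finset.sum_eq_single o (fun j _ hj => by rw [h0 j (by simp [hj])]; norm_num) (by simp)] at hs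
  have ho : (rotateSphere k x : EucSp n) o = 1 := by nlinarith
  apply Subtype.ext
  ext j
  rw [coe_pole]
  split_ifs with hj
  · rw [hj, ho]
  · exact h0 j (by simp [hj])

end Transitive

section Flip

/-- Change of sign of a coordinate. -/
def flip (a : Fin 3) (v : Fin 3 → ℝ) : Fin 3 → ℝ := fun b => if b = a then - v b else v b

/-- The imaginary units. -/
def iU (a : Fin 3) : UQ :=
  ![mkUQ 0 1 0 0 (by norm_num), mkUQ 0 0 1 0 (by norm_num), mkUQ 0 0 0 1 (by norm_num)] a

theorem flip_eq (a : Fin 3) (v : Fin 3 → ℝ) : flip a v = (-1 : ℝ) • rotFun (iU a) v := by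
  funext b
  fin_cases a <;> fin_cases b <;> simp [flip, rotFun, iU, toQ]

theorem flip_rotFun_flip (a : Fin 3) (h : UQ) (v : Fin 3 → ℝ) :
    flip a (rotFun h (flip a v)) = rotFun ((iU a * h * iU a : UQ) : ℍ[ℝ]) v := by
  have : ((iU a * h * iU a : UQ) : ℍ[ℝ]) = (iU a : ℍ[ℝ]) * h * iU a := rfl
  rw [this, rotFun_mul, rotFun_mul, flip_eq a v, rotFun_smul, flip_eq, rotFun_smul, smul_smul]
  norm_num

end Flip

section Generation

variable {n : ℕ}

/-- The reflection reversing `v`. -/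
def rfn (v : EucSp n) : EucSp n ≃ₗᵢ[ℝ] EucSp n := (ℝ ∙ v)ᗮ.reflection

theorem rfn_apply (v x : EucSp n) : rfn v x = x - (2 * (⟪v, x⟫ / ‖v‖ ^ 2)) • v := by
  unfold rfn
  rw [Submodule.reflection_orthogonal_apply, Submodule.reflection_singleton_apply]
  simp only [RCLike.ofReal_real_eq_id, id]
  rw [neg_sub, mul_smul, two_smul, two_smul]

theorem rfn_pole_apply (o : Fin n) (x : EucSp n) (j : Fin n) :
    rfn (pole o : EucSp n) x j = if j = o then - x j else x j := by
  rw [rfn_apply]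
  have h1 : ⟪(pole o : EucSp n), x⟫ = x o := by
    change ⟪EuclideanSpace.single o (1 : ℝ), x⟫ = x o
    rw [EuclideanSpace.inner_single_left]; simp
  have h2 : ‖(pole o : EucSp n)‖ = 1 := norm_eq_of_mem_sphere (pole o)
  rw [h1, h2]
  simp only [PiLp.sub_apply, PiLp.smul_apply, coe_pole]
  split_ifs with h
  · subst h; simp; ring
  · simp

theorem rfn_mul_self (v : EucSp n) : rfn v * rfn v = 1 := by
  ext1 x
  change rfn v (rfn v x) = x
  unfold rfn
  rw [Submodule.reflection_reflection]

theorem exists_rfn_conj (hn : 3 ≤ n) (o : Fin n) (v : EucSp n) (hv : v ≠ 0) :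
    ∃ k, WB n n k ∧ rfn v = k⁻¹ * rfn (pole o : EucSp n) * k := by
  have hv' : ‖v‖ ≠ 0 := norm_ne_zero_iff.2 hv
  let u : Sph n := ⟨‖v‖⁻¹ • v, by simp [norm_smul, hv']⟩
  obtain ⟨k, hk, hku⟩ := exists_WB_pole hn o u
  refine ⟨k, hk, ?_⟩
  have e : (pole o : EucSp n) = k (u : EucSp n) := by rw [← hku]; rfl
  have h2 : ‖(pole o : EucSp n)‖ = 1 := norm_eq_of_mem_sphere (pole o)
  rw [mul_assoc, eq_inv_mul_iff_mul_eq]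
  ext1 x
  change k (rfn v x) = rfn (pole o : EucSp n) (k x)
  rw [rfn_apply, rfn_apply, h2, e, k.inner_map_map, map_sub, map_smul]
  change _ = k x - (2 * (⟪‖v‖⁻¹ • v, x⟫ / 1 ^ 2)) • k (‖v‖⁻¹ • v)
  rw [map_smul, smul_smul, real_inner_smul_left]
  congr 2
  field_simp

theorem exists_bl_conj (o : Fin n) (I : Fin 3 ↪ Fin n) (h : UQ) :
    ∃ h', rfn (pole o : EucSp n) * bl I h * rfn (pole o : EucSp n) = bl I h' := by
  set r := rfn (pole o : EucSp n) with hr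
  have hout : ∀ (h' : UQ) (x : EucSp n) (j : Fin n), (¬∃ a, I a = j) →
      (r * bl I h * r) x j = bl I h' x j := by
    intro h' x j hj
    change r (bl I h (r x)) j = _
    rw [rfn_pole_apply, bl_apply, bl_apply, blockFun_apply' I _ _ j hj,
      blockFun_apply' I _ _ j hj, rfn_pole_apply]
    split_ifs <;> simp
  by_cases ho : ∃ a, I a = o
  · obtain ⟨a, rfl⟩ := ho
    refine ⟨iU a * h * iU a, ?_⟩
    ext x j
    by_cases hj : ∃ b, I b = j
    · obtain ⟨b, rfl⟩ := hj
      change r (bl I h (r x)) (I b) = _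
      have hf : ∀ y : EucSp n, (r y : Fin n → ℝ) ∘ I = flip a ((y : Fin n → ℝ) ∘ I) := by
        intro y
        funext c
        simp [flip, hr, rfn_pole_apply]
      have h1 := congrFun (hf (bl I h (r x))) b
      have h2 : ((bl I h (r x) : EucSp n) : Fin n → ℝ) ∘ I = rotFun h ((r x : Fin n → ℝ) ∘ I) := by
        funext c
        exact (bl_apply I h (r x) (I c)).trans (blockFun_apply I _ _ c)
      rw [h2, hf x, flip_rotFun_flip] at h1
      refine h1.trans ?_
      rw [bl_apply, blockFun_apply]
    · exact hout _ x j hj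
  · refine ⟨h, ?_⟩
    ext x j
    by_cases hj : ∃ b, I b = j
    · obtain ⟨b, rfl⟩ := hj
      change r (bl I h (r x)) (I b) = _
      have hb : ∀ c, I c ≠ o := fun c hc => ho ⟨c, hc⟩
      rw [rfn_pole_apply, if_neg (hb b), bl_apply, bl_apply, blockFun_apply, blockFun_apply]
      have : (r x : Fin n → ℝ) ∘ I = (x : Fin n → ℝ) ∘ I := by
        funext c
        simp [hr, rfn_pole_apply, hb c]
      rw [this]
    · exact hout _ x j hj

theorem WB.conj (o : Fin n) {N : ℕ} {γ : EucSp n ≃ₗᵢ[ℝ] EucSp n} (h : WB n N γ) :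
    WB n N (rfn (pole o : EucSp n) * γ * rfn (pole o : EucSp n)) := by
  induction h with
  | one N => rw [mul_one, rfn_mul_self]; exact .one N
  | cons N I h γ _ ih =>
    obtain ⟨h', e⟩ := exists_bl_conj o I h
    have := WB.cons N I h' _ ih
    rw [← e] at this
    convert this using 1
    set r := rfn (pole o : EucSp n)
    calc r * (bl I h * γ) * r = r * bl I h * 1 * γ * r := by group
      _ = r * bl I h * (r * r) * γ * r := by rw [rfn_mul_self]
      _ = _ := by group

theorem WB_list (hn : 3 ≤ n) (o : Fin n) (l : List (EucSp n)) :
    ∃ k, WB n (2 * n * l.length) k ∧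
      ((l.map fun v => rfn v).prod = k ∨ (l.map fun v => rfn v).prod =
        k * rfn (pole o : EucSp n)) := by
  set r := rfn (pole o : EucSp n) with hr
  have hrr : r * r = 1 := rfn_mul_self _
  induction l with
  | nil => exact ⟨1, .one _, Or.inl rfl⟩
  | cons v l ih =>
    obtain ⟨k, hk, h⟩ := ih
    rw [List.map_cons, List.prod_cons, List.length_cons]
    by_cases hv : v = 0
    · have : rfn v = 1 := by
        ext1 x; rw [rfn_apply, hv]; simp
      rw [this, one_mul]
      exact ⟨k, hk.mono (by nlinarith), h⟩
    · obtain ⟨k0, hk0, e⟩ := exists_rfn_conj hn o v hv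
      rw [← hr] at e
      refine ⟨k0⁻¹ * (r * (k0 * k) * r), ?_, ?_⟩
      · exact (hk0.inv.mul (WB.conj o (hk0.mul hk))).mono (by nlinarith)
      · rw [e]
        rcases h with h | h
        · right
          rw [h]
          calc k0⁻¹ * r * k0 * k = k0⁻¹ * r * k0 * k * 1 := by group
            _ = k0⁻¹ * r * k0 * k * (r * r) := by rw [hrr]
            _ = _ := by group
        · left
          rw [h]; group

theorem WB_of_isRotation (hn : 3 ≤ n) {γ : EucSp n ≃ₗᵢ[ℝ] EucSp n} (hγ : IsRotation γ) :
    WB n (2 * n * n) γ := by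
  let o : Fin n := ⟨0, by omega⟩
  obtain ⟨l, hl, e⟩ := LinearIsometryEquiv.reflections_generate_dim γ
  rw [finrank_euclideanSpace_fin] at hl
  obtain ⟨k, hk, h⟩ := WB_list hn o l
  have hk' : WB n (2 * n * n) k := hk.mono (by gcongr)
  change γ = (l.map fun v => rfn v).prod at e
  rcases h with h | h
  · rw [e, h]; exact hk'
  · exfalso
    have h1 : IsRotation (rfn (pole o : EucSp n)) := by
      have : rfn (pole o : EucSp n) = k⁻¹ * γ := by rw [e, h]; group
      rw [this]
      exact isRotation_mul (isRotation_inv hk.isRotation) hγ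
    unfold IsRotation rfn at h1
    have h2 := Submodule.det_reflection (𝕜 := ℝ) (ℝ ∙ (pole o : EucSp n))ᗮ
    rw [Submodule.orthogonal_orthogonal, finrank_span_singleton] at h2
    · change LinearMap.det _ = _ at h1
      rw [h2] at h1
      norm_num at h1
    · intro h0
      have := norm_eq_of_mem_sphere (pole o)
      rw [h0] at this
      simp at this

end Generation

end SphereEq

namespace SphereEq
open Quaternion

open scoped RealInnerProductSpace

section Haar

variable {n : ℕ}

instance : ContinuousStar (EucSp n →L[ℝ] EucSp n) :=
  ⟨(ContinuousLinearMap.adjoint (𝕜 := ℝ) (E := EucSp n) (F := EucSp n)).continuous⟩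

/-- The group of rotations. -/
def rotSubgroup (n : ℕ) : Subgroup (EucSp n ≃ₗᵢ[ℝ] EucSp n) where
  carrier := {γ | IsRotation γ}
  mul_mem' := isRotation_mul
  one_mem' := isRotation_one
  inv_mem' := isRotation_inv

/-- The group of rotations as a subgroup of the unitary group. -/
def SOn (n : ℕ) : Subgroup (unitary (EucSp n →L[ℝ] EucSp n)) :=
  (rotSubgroup n).comap Unitary.linearIsometryEquiv.toMonoidHom

instance : IsTopologicalGroup (unitary (EucSp n →L[ℝ] EucSp n)) := inferInstance

instance : IsTopologicalGroup (SOn n) := inferInstance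

/-- The isometry of an element of `SOn`. -/
def soIso (g : SOn n) : EucSp n ≃ₗᵢ[ℝ] EucSp n := Unitary.linearIsometryEquiv g.1

theorem isRotation_soIso (g : SOn n) : IsRotation (soIso g) := g.2

theorem soIso_mul (g h : SOn n) : soIso (g * h) = soIso g * soIso h := by
  unfold soIso; rw [Subgroup.coe_mul, map_mul]

theorem exists_soIso {γ : EucSp n ≃ₗᵢ[ℝ] EucSp n} (h : IsRotation γ) : ∃ g : SOn n, soIso g = γ :=
  ⟨⟨Unitary.linearIsometryEquiv.symm γ, by
    change IsRotation (Unitary.linearIsometryEquiv (Unitary.linearIsometryEquiv.symm γ))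
    rwa [MulEquiv.apply_symm_apply]⟩, by
    unfold soIso; rw [MulEquiv.apply_symm_apply]⟩

theorem isCompact_SOn_image : IsCompact
    (Set.range fun g : SOn n =>
      ((g : unitary (EucSp n →L[ℝ] EucSp n)) : EucSp n →L[ℝ] EucSp n)) := by
  have e : (Set.range fun g : SOn n =>
      ((g : unitary (EucSp n →L[ℝ] EucSp n)) : EucSp n →L[ℝ] EucSp n)) =
      (unitary (EucSp n →L[ℝ] EucSp n) : Set (EucSp n →L[ℝ] EucSp n)) ∩
        {f | f.det = 1} := by
    ext f
    constructor
    · rintro ⟨g, rfl⟩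
      exact ⟨g.1.2, g.2⟩
    · rintro ⟨h1, h2⟩
      exact ⟨⟨⟨f, h1⟩, h2⟩, rfl⟩
  rw [e]
  apply Metric.isCompact_of_isClosed_isBounded
  · exact isClosed_unitary.inter (isClosed_singleton.preimage ContinuousLinearMap.continuous_det)
  · refine (Metric.isBounded_closedBall (x := (0 : EucSp n →L[ℝ] EucSp n)) (r := 1)).subset ?_
    rintro f ⟨h1, -⟩
    rw [mem_closedBall_zero_iff]
    refine ContinuousLinearMap.opNorm_le_bound _ zero_le_one fun x => ?_
    rw [one_mul]
    exact (Unitary.norm_map ⟨f, h1⟩ x).le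

instance : CompactSpace (SOn n) := by
  rw [← isCompact_univ_iff]
  have hi : Topology.IsInducing fun g : SOn n =>
      ((g : unitary (EucSp n →L[ℝ] EucSp n)) : EucSp n →L[ℝ] EucSp n) :=
    Topology.IsInducing.subtypeVal.comp Topology.IsInducing.subtypeVal
  rw [hi.isCompact_iff, image_univ]
  exact isCompact_SOn_image

instance : MeasurableSpace (SOn n) := borel _
instance : BorelSpace (SOn n) := ⟨rfl⟩

/-- The Haar probability measure of the group of rotations. -/
def nuS (n : ℕ) : Measure (SOn n) := Measure.haarMeasure ⊤

instance : IsProbabilityMeasure (nuS n) := ⟨by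
  have h := Measure.haarMeasure_self (K₀ := (⊤ : TopologicalSpace.PositiveCompacts (SOn n)))
  simpa [nuS] using h⟩

instance : (nuS n).IsMulLeftInvariant := by unfold nuS; infer_instance

theorem continuous_soIso :
    Continuous fun p : SOn n × Sph n => rotateSphere (soIso p.1) p.2 := by
  apply Continuous.subtype_mk
  have h : Continuous fun p : SOn n × Sph n =>
      ((p.1 : unitary (EucSp n →L[ℝ] EucSp n)) : EucSp n →L[ℝ] EucSp n) (p.2 : EucSp n) :=
    ((continuous_subtype_val.comp continuous_subtype_val).comp continuous_fst).clm_apply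
      (continuous_subtype_val.comp continuous_snd)
  exact h

theorem continuous_soIso_inv :
    Continuous fun p : SOn n × Sph n => rotateSphere (soIso p.1⁻¹) p.2 := by
  have h : Continuous fun p : SOn n × Sph n => (p.1⁻¹, p.2) :=
    (continuous_inv.comp continuous_fst).prodMk continuous_snd
  have h2 := continuous_soIso.comp h
  exact h2

theorem exists_rotation_map (hn : 3 ≤ n) (x y : Sph n) :
    ∃ γ : EucSp n ≃ₗᵢ[ℝ] EucSp n, IsRotation γ ∧ rotateSphere γ x = y := by
  obtain ⟨k, hk, ek⟩ := exists_WB_pole hn ⟨0, by omega⟩ x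
  obtain ⟨l, hl, el⟩ := exists_WB_pole hn ⟨0, by omega⟩ y
  refine ⟨l⁻¹ * k, isRotation_mul (isRotation_inv hl.isRotation) hk.isRotation, ?_⟩
  rw [rotateSphere_mul, ek, ← el, rotateSphere_inv_apply]

theorem nuS_const (hn : 3 ≤ n) (U : Set (Sph n)) (x y : Sph n) :
    nuS n {g | rotateSphere (soIso g⁻¹) x ∈ U} = nuS n {g | rotateSphere (soIso g⁻¹) y ∈ U} := by
  obtain ⟨γ, hγ, e⟩ := exists_rotation_map hn y x
  obtain ⟨k, rfl⟩ := exists_soIso hγ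
  rw [← measure_preimage_mul (nuS n) k⁻¹ {g | rotateSphere (soIso g⁻¹) y ∈ U}]
  congr 1
  ext g
  simp only [Set.mem_ofPred_eq, mem_preimage, mul_inv_rev, inv_inv]
  rw [soIso_mul, rotateSphere_mul, e]

variable (μ : Measure (Sph n)) [IsProbabilityMeasure μ]

theorem lintegral_nuS {U : Set (Sph n)} (hU : MeasurableSet U) (V : Set (Sph n)) :
    ∫⁻ g, μ (V ∩ rotateSphere (soIso g⁻¹) ⁻¹' U) ∂(nuS n) =
      ∫⁻ x in V, nuS n {g | rotateSphere (soIso g⁻¹) x ∈ U} ∂μ := by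
  have hS : MeasurableSet {p : SOn n × Sph n | rotateSphere (soIso p.1⁻¹) p.2 ∈ U} :=
    continuous_soIso_inv.measurable hU
  have h1 := Measure.prod_apply (μ := nuS n) (ν := μ.restrict V) hS
  have h2 := Measure.prod_apply_symm (μ := nuS n) (ν := μ.restrict V) hS
  rw [h1] at h2
  refine Eq.trans ?_ h2
  congr 1
  funext g
  rw [Measure.restrict_apply (measurable_prodMk_left hS), inter_comm]
  rfl

theorem nuS_eq (hn : 3 ≤ n) (hμ : RotInv μ) {U : Set (Sph n)} (hU : MeasurableSet U) (x : Sph n) :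
    nuS n {g | rotateSphere (soIso g⁻¹) x ∈ U} = μ U := by
  have h := lintegral_nuS μ hU univ
  simp only [univ_inter, Measure.restrict_univ] at h
  have h1 : ∀ g : SOn n, μ (rotateSphere (soIso g⁻¹) ⁻¹' U) = μ U := fun g =>
    (hμ _ (isRotation_soIso _)).measure_preimage hU.nullMeasurableSet
  simp only [h1, nuS_const hn U _ x, lintegral_const, measure_univ, mul_one] at h
  exact h.symm

theorem exists_dl_gap : ∃ C : NNReal, ∀ (n : ℕ) (μ : Measure (Sph n)) [IsProbabilityMeasure μ],
    3 ≤ n → RotInv μ → ∀ U, MeasurableSet U →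
      μ U * μ Uᶜ ≤ (2 * n * n : ℕ) * C * dl μ U := by
  obtain ⟨C, hC⟩ := exists_WB_defect_le
  refine ⟨C, fun n μ _ hn hμ U hU => ?_⟩
  have h := lintegral_nuS μ hU Uᶜ
  simp only [nuS_eq μ hn hμ hU, lintegral_const, Measure.restrict_apply MeasurableSet.univ,
    univ_inter] at h
  rw [← h]
  calc _ ≤ ∫⁻ _, (2 * n * n : ℕ) * C * dl μ U ∂(nuS n) := by
        apply lintegral_mono
        intro g
        refine (measure_mono ?_).trans
          (hC n μ hμ _ _ (WB_of_isRotation hn (isRotation_soIso g⁻¹)) U hU)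
        rintro x ⟨h1, h2⟩
        exact Or.inl ⟨h2, h1⟩
    _ = _ := by simp

end Haar

end SphereEq

namespace SphereEq
open Quaternion

open scoped RealInnerProductSpace

section Expansion

variable {n : ℕ}

/-- The points mapped into `U` by some element of `S`. -/
def nb (S : Finset (EucSp n ≃ₗᵢ[ℝ] EucSp n)) (U : Set (Sph n)) : Set (Sph n) :=
  {x | ∃ s ∈ S, rotateSphere s x ∈ U}

theorem nb_eq_biUnion (S : Finset (EucSp n ≃ₗᵢ[ℝ] EucSp n)) (U : Set (Sph n)) :
    nb S U = ⋃ s ∈ S, rotateSphere s ⁻¹' U := by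
  ext x; simp [nb]

theorem measurable_rotateSphere (γ : EucSp n ≃ₗᵢ[ℝ] EucSp n) : Measurable (rotateSphere γ) :=
  (continuous_rotateSphere γ).measurable

theorem measurableSet_nb (S : Finset (EucSp n ≃ₗᵢ[ℝ] EucSp n)) {U : Set (Sph n)}
    (hU : MeasurableSet U) : MeasurableSet (nb S U) := by
  rw [nb_eq_biUnion]
  exact Finset.measurableSet_biUnion _ fun s _ => measurable_rotateSphere s hU

theorem nb_mono {S T : Finset (EucSp n ≃ₗᵢ[ℝ] EucSp n)} (h : S ⊆ T) (U : Set (Sph n)) :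
    nb S U ⊆ nb T U := fun _ ⟨s, hs, hx⟩ => ⟨s, h hs, hx⟩

theorem exists_nb_gap (hn : 3 ≤ n) (μ : Measure (Sph n)) [IsProbabilityMeasure μ]
    (hμ : RotInv μ) : ∃ (S : Finset (EucSp n ≃ₗᵢ[ℝ] EucSp n)) (c : ℝ),
    (∀ s ∈ S, IsRotation s) ∧ 0 < c ∧ ∀ U, MeasurableSet U →
      μ.real U + c * (μ.real U * (1 - μ.real U)) ≤ μ.real (nb S U) := by
  classical
  obtain ⟨C, hC⟩ := exists_dl_gap
  let S : Finset (EucSp n ≃ₗᵢ[ℝ] EucSp n) := insert 1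
    (Finset.univ.image fun p : (Fin 3 ↪ Fin n) × Letter => bl p.1 (qU p.2))
  let N : ℕ := (2 * n * n) * (Fintype.card (Fin 3 ↪ Fin n) * (Fintype.card Letter * 2))
  have hpos : (0 : ℝ) < N * C + 1 := by positivity
  refine ⟨S, (N * C + 1)⁻¹, ?_, by positivity, fun U hU => ?_⟩
  · intro s hs
    simp only [S, Finset.mem_insert, Finset.mem_image, Finset.mem_univ, true_and] at hs
    rcases hs with rfl | ⟨p, rfl⟩
    · exact isRotation_one
    · exact isRotation_bl _ _
  have hsub : U ⊆ nb S U := fun x hx => ⟨1, by simp [S], hx⟩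
  have hm := measurableSet_nb S hU
  have h1 : ∀ I s, μ (symmDiff (ac I (qU s) ⁻¹' U) U) ≤ 2 * μ (nb S U \ U) := by
    intro I s
    have hp := hμ (bl I (qU s)) (isRotation_bl I _)
    have hT : MeasurableSet (ac I (qU s) ⁻¹' U) := hp.measurable hU
    have hTm : μ (ac I (qU s) ⁻¹' U) = μ U := hp.measure_preimage hU.nullMeasurableSet
    have e : μ (U \ ac I (qU s) ⁻¹' U) = μ (ac I (qU s) ⁻¹' U \ U) := by
      have e1 := measure_sdiff_add_inter (μ := μ) (ac I (qU s) ⁻¹' U) hU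
      have e2 := measure_sdiff_add_inter (μ := μ) U hT
      rw [hTm, ← e2, inter_comm U] at e1
      exact (ENNReal.add_left_inj (measure_ne_top μ _)).1 e1.symm
    have hle : μ (ac I (qU s) ⁻¹' U \ U) ≤ μ (nb S U \ U) := by
      apply measure_mono
      rintro x ⟨hx, hx'⟩
      exact ⟨⟨bl I (qU s), by
        simp only [S, Finset.mem_insert, Finset.mem_image, Finset.mem_univ, true_and]
        exact Or.inr ⟨(I, s), rfl⟩, hx⟩, hx'⟩
    calc _ ≤ μ (ac I (qU s) ⁻¹' U \ U) + μ (U \ ac I (qU s) ⁻¹' U) := measure_union_le _ _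
      _ ≤ μ (nb S U \ U) + μ (nb S U \ U) := by rw [e]; gcongr
      _ = _ := (two_mul _).symm
  have h2 : dl μ U ≤ (Fintype.card (Fin 3 ↪ Fin n) * (Fintype.card Letter * 2) : ℕ) *
      μ (nb S U \ U) := by
    unfold dl
    calc _ ≤ ∑ I : Fin 3 ↪ Fin n, ∑ s : Letter, 2 * μ (nb S U \ U) :=
          Finset.sum_le_sum fun I _ => Finset.sum_le_sum fun s _ => h1 I s
      _ = _ := by
        simp only [Finset.sum_const, Finset.card_univ, nsmul_eq_mul]
        push_cast; ring
  have h3 : μ U * μ Uᶜ ≤ N * C * μ (nb S U \ U) := by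
    refine (hC n μ hn hμ U hU).trans ?_
    calc _ ≤ (2 * n * n : ℕ) * C * ((Fintype.card (Fin 3 ↪ Fin n) *
          (Fintype.card Letter * 2) : ℕ) * μ (nb S U \ U)) := by gcongr
      _ = _ := by simp only [N]; push_cast; ring
  have h4 := ENNReal.toReal_mono (by finiteness) h3
  simp only [ENNReal.toReal_mul, ENNReal.toReal_natCast, ENNReal.coe_toReal] at h4
  simp only [← measureReal_def] at h4
  rw [probReal_compl_eq_one_sub hU, measureReal_sdiff hsub hU] at h4
  have h5 : 0 ≤ μ.real (nb S U) - μ.real U := sub_nonneg.2 (measureReal_mono hsub)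
  have h6 : (N * C + 1 : ℝ)⁻¹ * (μ.real U * (1 - μ.real U)) ≤ μ.real (nb S U) - μ.real U := by
    rw [inv_mul_le_iff₀ hpos]
    linarith
  linarith

theorem exists_nb_growth (hn : 3 ≤ n) (μ : Measure (Sph n)) [IsProbabilityMeasure μ]
    (hμ : RotInv μ) (R ε : ℝ) (hε : 0 < ε) : ∃ S : Finset (EucSp n ≃ₗᵢ[ℝ] EucSp n),
    (∀ s ∈ S, IsRotation s) ∧ ∀ U, MeasurableSet U →
      min (R * μ.real U) (1 - ε) ≤ μ.real (nb S U) := by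
  classical
  obtain ⟨S, c, hS, hc, h⟩ := exists_nb_gap hn μ hμ
  have key : ∀ t : ℕ, ∃ T : Finset (EucSp n ≃ₗᵢ[ℝ] EucSp n),
      (∀ s ∈ T, IsRotation s) ∧ ∀ U, MeasurableSet U →
      min ((1 + c * ε) ^ t * μ.real U) (1 - ε) ≤ μ.real (nb T U) := by
    intro t
    induction t with
    | zero =>
      refine ⟨{1}, by simpa using isRotation_one, fun U hU => ?_⟩
      have : nb {(1 : EucSp n ≃ₗᵢ[ℝ] EucSp n)} U = U := by
        ext x; simp [nb, rotateSphere_one]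
      rw [this]; simp
    | succ t ih =>
      obtain ⟨T, hT, hh⟩ := ih
      refine ⟨(T ×ˢ S).image fun p => p.1 * p.2, ?_, fun U hU => ?_⟩
      · intro s hs
        simp only [Finset.mem_image, Finset.mem_product] at hs
        obtain ⟨p, ⟨h1, h2⟩, rfl⟩ := hs
        exact isRotation_mul (hT _ h1) (hS _ h2)
      have e : nb ((T ×ˢ S).image fun p => p.1 * p.2) U = nb S (nb T U) := by
        ext x
        simp only [nb, Finset.mem_image, Finset.mem_product, Prod.exists, Set.mem_ofPred_eq]
        constructor
        · rintro ⟨_, ⟨a, b, ⟨ha, hb⟩, rfl⟩, hx⟩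
          exact ⟨b, hb, a, ha, hx⟩
        · rintro ⟨b, hb, a, ha, hx⟩
          exact ⟨_, ⟨a, b, ⟨ha, hb⟩, rfl⟩, hx⟩
      rw [e]
      have h1 := h (nb T U) (measurableSet_nb T hU)
      have h2 := hh U hU
      set v := μ.real (nb T U)
      have hv0 : 0 ≤ v := measureReal_nonneg
      have hv1 : v ≤ 1 := measureReal_le_one
      by_cases hv : 1 - ε ≤ v
      · refine (min_le_right _ _).trans ?_
        have : 0 ≤ c * (v * (1 - v)) := by
          have : 0 ≤ 1 - v := by linarith
          positivity
        linarith
      · push Not at hv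
        rw [min_le_iff] at h2
        have h3 : (1 + c * ε) ^ t * μ.real U ≤ v := by
          rcases h2 with h2 | h2 <;> linarith
        refine (min_le_left _ _).trans ?_
        have h4 : c * (v * ε) ≤ c * (v * (1 - v)) := by
          gcongr; linarith
        calc (1 + c * ε) ^ (t + 1) * μ.real U = (1 + c * ε) * ((1 + c * ε) ^ t * μ.real U) := by
              ring
          _ ≤ (1 + c * ε) * v := by gcongr
          _ ≤ _ := by nlinarith
  have hgt : 1 < 1 + c * ε := by linarith [mul_pos hc hε]
  obtain ⟨t, ht⟩ := pow_unbounded_of_one_lt R hgt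
  obtain ⟨T, hT, hh⟩ := key t
  refine ⟨T, hT, fun U hU => le_trans ?_ (hh U hU)⟩
  have : 0 ≤ μ.real U := measureReal_nonneg
  gcongr

theorem exists_nb_target (hn : 3 ≤ n) (μ : Measure (Sph n)) [IsProbabilityMeasure μ]
    (hμ : RotInv μ) {B : Set (Sph n)} (hB : MeasurableSet B) (hpos : 0 < μ.real B)
    {K : Finset (EucSp n ≃ₗᵢ[ℝ] EucSp n)} (hK : ∀ k ∈ K, IsRotation k) (hcov : nb K B = univ) :
    ∃ S : Finset (EucSp n ≃ₗᵢ[ℝ] EucSp n), (∀ s ∈ S, IsRotation s) ∧ ∀ U, MeasurableSet U →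
      min (2 * μ.real U) (2 / 3 * μ.real B) ≤ μ.real (B ∩ nb S U) := by
  classical
  obtain ⟨S, hS, h⟩ := exists_nb_growth hn μ hμ (2 * K.card) (μ.real B / 3) (by positivity)
  refine ⟨S ∪ (S ×ˢ K).image (fun p => p.1 * p.2⁻¹), ?_, fun U hU => ?_⟩
  · intro s hs
    simp only [Finset.mem_union, Finset.mem_image, Finset.mem_product] at hs
    rcases hs with hs | ⟨p, ⟨h1, h2⟩, rfl⟩
    · exact hS s hs
    · exact isRotation_mul (hS _ h1) (isRotation_inv (hK _ h2))
  have hV := measurableSet_nb S hU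
  have h1 := h U hU
  rw [min_le_iff] at h1
  rcases h1 with h1 | h1
  · refine (min_le_left _ _).trans ?_
    have h2 : μ.real (nb S U) ≤ ∑ k ∈ K, μ.real (rotateSphere k ⁻¹' B ∩ nb S U) := by
      have : nb S U ⊆ ⋃ k ∈ K, (rotateSphere k ⁻¹' B ∩ nb S U) := by
        intro x hx
        have : x ∈ nb K B := by rw [hcov]; trivial
        obtain ⟨k, hk, hxk⟩ := this
        exact mem_biUnion hk ⟨hxk, hx⟩
      exact (measureReal_mono this (measure_ne_top μ _)).trans (measureReal_biUnion_finset_le _ _)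
    have h3 : ∀ k ∈ K, μ.real (rotateSphere k ⁻¹' B ∩ nb S U) ≤
        μ.real (B ∩ nb (S ∪ (S ×ˢ K).image (fun p => p.1 * p.2⁻¹)) U) := by
      intro k hk
      have hp := hμ k⁻¹ (isRotation_inv (hK k hk))
      have hm : MeasurableSet (rotateSphere k ⁻¹' B ∩ nb S U) :=
        (measurable_rotateSphere k hB).inter hV
      have e : μ.real (rotateSphere k ⁻¹' B ∩ nb S U) =
          μ.real (rotateSphere k⁻¹ ⁻¹' (rotateSphere k ⁻¹' B ∩ nb S U)) := by
        rw [measureReal_def, measureReal_def, hp.measure_preimage hm.nullMeasurableSet]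
      rw [e]
      refine measureReal_mono ?_ (measure_ne_top μ _)
      rintro x ⟨hx, s, hs, hx'⟩
      rw [mem_preimage, rotateSphere_apply_inv] at hx
      refine ⟨hx, s * k⁻¹, ?_, hx'⟩
      simp only [Finset.mem_union, Finset.mem_image, Finset.mem_product]
      exact Or.inr ⟨(s, k), ⟨hs, hk⟩, rfl⟩
    have h4 := h2.trans (Finset.sum_le_sum h3)
    rw [Finset.sum_const, nsmul_eq_mul] at h4
    have hKpos : (0 : ℝ) < K.card := by
      rw [Nat.cast_pos, Finset.card_pos]
      have : (B : Set (Sph n)).Nonempty := by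
        by_contra hne
        rw [not_nonempty_iff_eq_empty] at hne
        rw [hne] at hpos; simp at hpos
      obtain ⟨x, -⟩ := this
      have : x ∈ nb K B := by rw [hcov]; trivial
      obtain ⟨k, hk, -⟩ := this
      exact ⟨k, hk⟩
    nlinarith [h1, h4]
  · refine (min_le_right _ _).trans ?_
    have h2 : μ.real (nb S U) ≤ μ.real (B ∩ nb S U) + μ.real Bᶜ := by
      have : nb S U ⊆ (B ∩ nb S U) ∪ Bᶜ := by
        intro x hx
        by_cases hb : x ∈ B
        · exact Or.inl ⟨hb, hx⟩
        · exact Or.inr hb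
      exact (measureReal_mono this).trans (measureReal_union_le _ _)
    rw [probReal_compl_eq_one_sub hB] at h2
    have h3 : μ.real (B ∩ nb S U) ≤
        μ.real (B ∩ nb (S ∪ (S ×ˢ K).image (fun p => p.1 * p.2⁻¹)) U) :=
      measureReal_mono (inter_subset_inter_right _ (nb_mono Finset.subset_union_left _))
    linarith

end Expansion

end SphereEq

namespace SphereEq

section Matching

variable {X ι : Type*} [MeasurableSpace X] [Finite ι] {g : ι → X ≃ᵐ X} {A B : Set X}

/-- A partial measurable matching from `A` to `B`: a point labelled `i` is matched along `g i`. -/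
structure IsMatching (g : ι → X ≃ᵐ X) (A B : Set X) (m : X → Option ι) : Prop where
  meas : ∀ i, MeasurableSet {x | m x = some i}
  left : ∀ {x i}, m x = some i → x ∈ A
  right : ∀ {x i}, m x = some i → g i x ∈ B
  inj : ∀ {x y i j}, m x = some i → m y = some j → g i x = g j y → x = y

/-- The set of matched points. -/
def mdom (m : X → Option ι) : Set X := ⋃ i, {x | m x = some i}

/-- The set of partners of the matched points of `E`. -/
def mimg (g : ι → X ≃ᵐ X) (m : X → Option ι) (E : Set X) : Set X :=
  ⋃ i, (g i).symm ⁻¹' ({x | m x = some i} ∩ E)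

omit [MeasurableSpace X] [Finite ι] in
theorem mem_mdom {m : X → Option ι} {x : X} : x ∈ mdom m ↔ ∃ i, m x = some i := by
  simp [mdom]

omit [Finite ι] in
theorem mem_mimg {m : X → Option ι} {E : Set X} {y : X} :
    y ∈ mimg g m E ↔ ∃ i x, m x = some i ∧ x ∈ E ∧ g i x = y := by
  simp only [mimg, mem_iUnion, mem_preimage, mem_inter_iff, Set.mem_ofPred_eq]
  constructor
  · rintro ⟨i, h1, h2⟩
    exact ⟨i, _, h1, h2, (g i).apply_symm_apply y⟩
  · rintro ⟨i, x, h1, h2, rfl⟩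
    exact ⟨i, by simpa using h1, by simpa using h2⟩

theorem IsMatching.measurableSet_mdom {m : X → Option ι} (h : IsMatching g A B m) :
    MeasurableSet (mdom m) := MeasurableSet.iUnion h.meas

theorem IsMatching.measurableSet_mimg {m : X → Option ι} (h : IsMatching g A B m) {E : Set X}
    (hE : MeasurableSet E) : MeasurableSet (mimg g m E) :=
  MeasurableSet.iUnion fun i => (g i).symm.measurable ((h.meas i).inter hE)

omit [Finite ι] in
theorem IsMatching.mimg_subset {m : X → Option ι} (h : IsMatching g A B m) (E : Set X) :
    mimg g m E ⊆ B := by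
  intro y hy
  obtain ⟨i, x, h1, -, rfl⟩ := mem_mimg.1 hy
  exact h.right h1

omit [Finite ι] in
theorem IsMatching.mdom_subset {m : X → Option ι} (h : IsMatching g A B m) : mdom m ⊆ A := by
  intro y hy
  obtain ⟨i, hi⟩ := mem_mdom.1 hy
  exact h.left hi

theorem IsMatching.measure_mimg {m : X → Option ι} (h : IsMatching g A B m) {μ : Measure X}
    (hg : ∀ i, MeasurePreserving (g i) μ μ) {E : Set X} (hE : MeasurableSet E) :
    μ (mimg g m E) = μ (mdom m ∩ E) := by
  have := Fintype.ofFinite ι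
  rw [mimg, mdom, iUnion_inter, measure_iUnion, measure_iUnion]
  · congr 1; ext i
    exact ((hg i).symm (g i)).measure_preimage ((h.meas i).inter hE).nullMeasurableSet
  · intro i j hij
    rw [Function.onFun, Set.disjoint_left]
    rintro x ⟨h1, -⟩ ⟨h2, -⟩
    rw [Set.mem_ofPred_eq] at h1 h2
    rw [h1, Option.some_inj] at h2
    exact hij h2
  · exact fun i => (h.meas i).inter hE
  · intro i j hij
    rw [Function.onFun, Set.disjoint_left]
    rintro y ⟨h1, -⟩ ⟨h2, -⟩
    rw [Set.mem_ofPred_eq] at h1 h2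
    have := h.inj h1 h2 (by simp)
    rw [← this, h1, Option.some_inj] at h2
    exact hij h2
  · exact fun i => (g i).symm.measurable ((h.meas i).inter hE)

/-- Points of `A` from which an unmatched point of `B` is reached by an alternating path using
at most `k` steps. -/
def reach (g : ι → X ≃ᵐ X) (A B : Set X) (m : X → Option ι) : ℕ → Set X
  | 0 => ∅
  | k + 1 => A ∩ ⋃ i, g i ⁻¹' ((B \ mimg g m univ) ∪ mimg g m (reach g A B m k))

omit [Finite ι] in
theorem mimg_mono {m : X → Option ι} {E F : Set X} (h : E ⊆ F) : mimg g m E ⊆ mimg g m F :=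
  iUnion_mono fun _ => preimage_mono (inter_subset_inter_right _ h)

theorem IsMatching.measurableSet_reach {m : X → Option ι} (h : IsMatching g A B m)
    (hA : MeasurableSet A) (hB : MeasurableSet B) (k : ℕ) :
    MeasurableSet (reach g A B m k) := by
  induction k with
  | zero => exact MeasurableSet.empty
  | succ k ih =>
    exact hA.inter (MeasurableSet.iUnion fun i => (g i).measurable
      ((hB.diff (h.measurableSet_mimg MeasurableSet.univ)).union (h.measurableSet_mimg ih)))

omit [Finite ι] in
theorem reach_mono (m : X → Option ι) (k : ℕ) : reach g A B m k ⊆ reach g A B m (k + 1) := by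
  induction k with
  | zero => exact empty_subset _
  | succ k ih =>
    exact inter_subset_inter_right _ (iUnion_mono fun i =>
      preimage_mono (union_subset_union_right _ (mimg_mono ih)))

omit [Finite ι] in
theorem reach_subset (m : X → Option ι) (k : ℕ) : reach g A B m k ⊆ A := by
  cases k with
  | zero => exact empty_subset _
  | succ k => exact inter_subset_left

open Classical in
/-- Relabel the points of `G` by `i`. -/
def relabel (m : X → Option ι) (G : Set X) (i : ι) : X → Option ι :=
  fun x => if x ∈ G then some i else m x

omit [Finite ι] in
theorem IsMatching.relabel_of_hole {m : X → Option ι} (h : IsMatching g A B m) {G : Set X} {i : ι}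
    (hG : MeasurableSet G) (hGA : G ⊆ A) (hGi : ∀ x ∈ G, g i x ∈ B \ mimg g m univ) :
    IsMatching g A B (relabel m G i) where
  meas j := by
    have : {x | relabel m G i x = some j} =
        (G ∩ {_x | i = j}) ∪ ({x | m x = some j} \ G) := by
      ext x
      by_cases hx : x ∈ G <;> simp [relabel, hx]
    rw [this]
    exact (hG.inter (MeasurableSet.const _)).union ((h.meas j).diff hG)
  left {x j} hx := by
    by_cases hG : x ∈ G
    · exact hGA hG
    · exact h.left (by simpa [relabel, hG] using hx)
  right {x j} hx := by
    by_cases hG : x ∈ G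
    · simp only [relabel, hG, if_true, Option.some_inj] at hx
      exact hx ▸ (hGi x hG).1
    · exact h.right (by simpa [relabel, hG] using hx)
  inj {x y j k} hx hy hxy := by
    by_cases h1 : x ∈ G <;> by_cases h2 : y ∈ G <;>
      simp only [relabel, h1, h2, if_true, if_false, Option.some_inj] at hx hy
    · subst hx; subst hy; exact (g i).injective hxy
    · subst hx
      exact absurd (mem_mimg.2 ⟨k, y, hy, mem_univ _, hxy.symm⟩) (hGi x h1).2
    · subst hy
      exact absurd (mem_mimg.2 ⟨j, x, hx, mem_univ _, hxy⟩) (hGi y h2).2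
    · exact h.inj hx hy hxy

theorem exists_pos_of_iUnion {μ : Measure X} {F : Set X} (hF : μ F ≠ 0) {κ : Type*}
    [Countable κ] {s : κ → Set X} (h : F ⊆ ⋃ k, s k) : ∃ k, μ (F ∩ s k) ≠ 0 := by
  by_contra! hc
  apply hF
  refine measure_mono_null (t := ⋃ k, (F ∩ s k)) ?_ (measure_iUnion_null hc)
  rw [← inter_iUnion]
  exact subset_inter subset_rfl h

theorem IsMatching.exists_hole {m : X → Option ι} (h : IsMatching g A B m) {μ : Measure X}
    (hg : ∀ i, MeasurePreserving (g i) μ μ) (hA : MeasurableSet A) (hB : MeasurableSet B) (k : ℕ) :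
    ∀ F : Set X, MeasurableSet F → F ⊆ reach g A B m (k + 1) → μ F ≠ 0 →
      ∃ (F' : Set X) (m' : X → Option ι) (i : ι), F' ⊆ F ∧ MeasurableSet F' ∧ μ F' ≠ 0 ∧
        IsMatching g A B m' ∧ mdom m' = mdom m ∧ {x | m x ≠ m' x} ⊆ reach g A B m k ∧
        μ {x | m x ≠ m' x} ≤ k * μ F' ∧ ∀ x ∈ F', g i x ∈ B \ mimg g m' univ := by
  have hhole : MeasurableSet (B \ mimg g m univ) :=
    hB.diff (h.measurableSet_mimg MeasurableSet.univ)
  have direct : ∀ (k : ℕ) (F : Set X), MeasurableSet F → ∀ i,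
      μ (F ∩ g i ⁻¹' (B \ mimg g m univ)) ≠ 0 →
      ∃ (F' : Set X) (m' : X → Option ι) (i : ι), F' ⊆ F ∧ MeasurableSet F' ∧ μ F' ≠ 0 ∧
        IsMatching g A B m' ∧ mdom m' = mdom m ∧ {x | m x ≠ m' x} ⊆ reach g A B m k ∧
        μ {x | m x ≠ m' x} ≤ k * μ F' ∧ ∀ x ∈ F', g i x ∈ B \ mimg g m' univ :=
    fun k F hF i hi => ⟨_, m, i, inter_subset_left, hF.inter ((g i).measurable hhole), hi, h, rfl,
      by simp, by simp, fun x hx => hx.2⟩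
  induction k with
  | zero =>
    intro F hF hFs hF0
    have : F ⊆ ⋃ i, g i ⁻¹' (B \ mimg g m univ) := by
      intro x hx
      have := (hFs hx).2
      simpa [reach, mimg] using this
    obtain ⟨i, hi⟩ := exists_pos_of_iUnion hF0 this
    exact direct 0 F hF i hi
  | succ k ih =>
    intro F hF hFs hF0
    have hr := h.measurableSet_reach hA hB (k + 1)
    by_cases h1 : μ (F ∩ reach g A B m (k + 1)) = 0
    swap
    · obtain ⟨F', m', i, a1, a2, a3, a4, a5, a6, a7, a8⟩ :=
        ih _ (hF.inter hr) inter_subset_right h1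
      refine ⟨F', m', i, a1.trans inter_subset_left, a2, a3, a4, a5,
        a6.trans (reach_mono m k), a7.trans ?_, a8⟩
      gcongr; simp
    have h2 : μ (F \ reach g A B m (k + 1)) ≠ 0 := by
      rwa [← measure_sdiff_add_inter (s := F) hr, h1, add_zero] at hF0
    have h3 : F \ reach g A B m (k + 1) ⊆ ⋃ i, g i ⁻¹' ((B \ mimg g m univ) ∪
        mimg g m (reach g A B m (k + 1))) := fun x hx => (hFs hx.1).2
    obtain ⟨i, hi⟩ := exists_pos_of_iUnion h2 h3
    by_cases h4 : μ (F ∩ g i ⁻¹' (B \ mimg g m univ)) = 0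
    swap
    · exact direct _ F hF i h4
    have h5 : μ ((F \ reach g A B m (k + 1)) ∩
        g i ⁻¹' mimg g m (reach g A B m (k + 1))) ≠ 0 := by
      intro h5
      apply hi
      refine measure_mono_null ?_ (measure_union_null h4 h5)
      rintro x ⟨hx, hx' | hx'⟩
      · exact Or.inl ⟨hx.1, hx'⟩
      · exact Or.inr ⟨hx, hx'⟩
    obtain ⟨j, hj⟩ := exists_pos_of_iUnion h5 (s := fun j =>
        g i ⁻¹' ((g j).symm ⁻¹' ({x | m x = some j} ∩ reach g A B m (k + 1))))
      (by rw [← preimage_iUnion]; exact inter_subset_right)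
    set F1 := (F \ reach g A B m (k + 1)) ∩ g i ⁻¹' mimg g m (reach g A B m (k + 1)) ∩
      g i ⁻¹' ((g j).symm ⁻¹' ({x | m x = some j} ∩ reach g A B m (k + 1))) with hF1
    have hF1m : MeasurableSet F1 :=
      ((hF.diff hr).inter ((g i).measurable (h.measurableSet_mimg hr))).inter
        ((g i).measurable ((g j).symm.measurable ((h.meas j).inter hr)))
    set e : X ≃ᵐ X := (g i).trans (g j).symm with he
    have hep : MeasurePreserving e μ μ := ((hg j).symm (g j)).comp (hg i)
    have hGμ : ∀ s, MeasurableSet s → μ (e.symm ⁻¹' s) = μ s := fun s hs =>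
      (hep.symm e).measure_preimage hs.nullMeasurableSet
    obtain ⟨G', m', i', a1, a2, a3, a4, a5, a6, a7, a8⟩ := ih (e.symm ⁻¹' F1)
      (e.symm.measurable hF1m) (by
        intro x hx
        have := hx.2.2
        simpa [he] using this) (by rwa [hGμ _ hF1m])
    have hGj : ∀ x ∈ G', m x = some j ∧ x ∈ reach g A B m (k + 1) ∧ x ∉ reach g A B m k ∧
        e.symm x ∈ F1 := by
      intro x hx
      have hx1 : e.symm x ∈ F1 := a1 hx
      have hx2 : m x = some j ∧ x ∈ reach g A B m (k + 1) := by
        have := hx1.2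
        simpa [he] using this
      refine ⟨hx2.1, hx2.2, fun hk => hx1.1.1.2 ⟨reach_subset _ _ (hFs hx1.1.1.1), ?_⟩, hx1⟩
      refine mem_iUnion.2 ⟨i, Or.inr (mem_mimg.2 ⟨j, x, hx2.1, hk, ?_⟩)⟩
      simp [he]
    have hGm' : ∀ x ∈ G', m' x = some j := by
      intro x hx
      obtain ⟨b1, -, b3, -⟩ := hGj x hx
      by_contra hne
      exact b3 (a6 (by rw [Set.mem_ofPred_eq, b1]; exact fun h => hne h.symm))
    refine ⟨e ⁻¹' G', relabel m' G' i', i, ?_, e.measurable a2, ?_,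
      a4.relabel_of_hole a2 (fun x hx => h.left (hGj x hx).1) a8, ?_, ?_, ?_, ?_⟩
    · intro x hx
      have := (hGj _ hx).2.2.2.1.1.1
      simpa using this
    · rwa [hep.measure_preimage a2.nullMeasurableSet]
    · rw [← a5]
      ext x
      rw [mem_mdom, mem_mdom]
      by_cases hx : x ∈ G'
      · simp [relabel, hx, hGm' x hx]
      · simp [relabel, hx]
    · intro x hx
      by_cases hx' : x ∈ G'
      · exact (hGj x hx').2.1
      · exact reach_mono m k (a6 (by simpa [relabel, hx'] using hx))
    · rw [hep.measure_preimage a2.nullMeasurableSet]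
      calc _ ≤ μ ({x | m x ≠ m' x} ∪ G') := by
            apply measure_mono
            intro x hx
            by_cases hx' : x ∈ G'
            · exact Or.inr hx'
            · exact Or.inl (by simpa [relabel, hx'] using hx)
        _ ≤ _ := measure_union_le _ _
        _ ≤ k * μ G' + μ G' := by gcongr
        _ = _ := by push_cast; ring
    · intro x hx
      have hgx : g j (e x) = g i x := by simp [he]
      have hx : e x ∈ G' := hx
      rw [← hgx]
      refine ⟨h.right (hGj _ hx).1, fun hmem => ?_⟩
      obtain ⟨l, z, hz1, -, hz2⟩ := mem_mimg.1 hmem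
      by_cases hz : z ∈ G'
      · simp only [relabel, hz, if_true, Option.some_inj] at hz1
        subst hz1
        exact (a8 z hz).2 (mem_mimg.2 ⟨j, e x, hGm' _ hx, mem_univ _, hz2.symm⟩)
      · simp only [relabel, hz, if_false] at hz1
        exact hz (a4.inj hz1 (hGm' _ hx) hz2 ▸ hx)

/-- The unmatched mass. -/
def defect (μ : Measure X) (A : Set X) (m : X → Option ι) : ℝ := μ.real (A \ mdom m)

/-- One augmentation along alternating paths. -/
theorem IsMatching.exists_augment {m : X → Option ι} (h : IsMatching g A B m) {μ : Measure X}
    [IsFiniteMeasure μ]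
    (hg : ∀ i, MeasurePreserving (g i) μ μ) (hA : MeasurableSet A) (hB : MeasurableSet B) (k : ℕ)
    (hk : μ ((A \ mdom m) ∩ reach g A B m (k + 1)) ≠ 0) :
    ∃ m' : X → Option ι, IsMatching g A B m' ∧ defect μ A m' < defect μ A m ∧
      μ.real {x | m x ≠ m' x} ≤ (k + 1) * (defect μ A m - defect μ A m') := by
  obtain ⟨F, m', i, a1, a2, a3, a4, a5, a6, a7, a8⟩ := h.exists_hole hg hA hB k _
    ((hA.diff h.measurableSet_mdom).inter (h.measurableSet_reach hA hB (k + 1)))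
    inter_subset_right hk
  have hFA : F ⊆ A \ mdom m := a1.trans inter_subset_left
  have e1 : A \ mdom (relabel m' F i) = (A \ mdom m) \ F := by
    rw [← a5]
    ext x
    by_cases hx : x ∈ F <;> simp [relabel, mem_mdom, hx]
  have e2 : defect μ A (relabel m' F i) = defect μ A m - μ.real F := by
    rw [defect, e1, measureReal_sdiff hFA a2]; rfl
  have hpos : 0 < μ.real F := by
    rw [measureReal_def, ENNReal.toReal_pos_iff]
    exact ⟨pos_iff_ne_zero.2 a3, measure_lt_top _ _⟩
  refine ⟨relabel m' F i, a4.relabel_of_hole a2 (fun x hx => (hFA hx).1) a8, by linarith, ?_⟩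
  rw [e2, sub_sub_cancel]
  have a7' : μ.real {x | m x ≠ m' x} ≤ k * μ.real F := by
    have := ENNReal.toReal_mono (by finiteness) a7
    simpa [measureReal_def, ENNReal.toReal_mul] using this
  calc _ ≤ μ.real ({x | m x ≠ m' x} ∪ F) := by
        refine measureReal_mono ?_ (measure_ne_top _ _)
        intro x hx
        by_cases hx' : x ∈ F
        · exact Or.inr hx'
        · exact Or.inl (by simpa [relabel, hx'] using hx)
    _ ≤ _ := measureReal_union_le _ _
    _ ≤ _ := by linarith

end Matching

end SphereEq

namespace SphereEq

section Matching

open Filter Topology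

variable {X ι : Type*} [MeasurableSpace X] [Finite ι] {g : ι → X ≃ᵐ X} {A B : Set X}

theorem sq_le_four_mul_two_pow (k : ℕ) : (k : ℝ) ^ 2 ≤ 4 * 2 ^ k := by
  have h : ∀ k : ℕ, k ^ 2 ≤ 4 * 2 ^ k := by
    intro k
    induction k with
    | zero => simp
    | succ k ih =>
      rcases Nat.lt_or_ge k 3 with h | h
      · interval_cases k <;> norm_num
      · rw [pow_succ 2 k]; nlinarith
  exact_mod_cast h k

theorem IsMatching.exists_reach {m : X → Option ι} (h : IsMatching g A B m) {μ : Measure X}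
    [IsProbabilityMeasure μ] (hg : ∀ i, MeasurePreserving (g i) μ μ) (hA : MeasurableSet A)
    (hB : MeasurableSet B) (hAB : μ A = μ B)
    (hgA : ∀ U, MeasurableSet U →
      min (2 * μ.real U) (2 / 3 * μ.real A) ≤ μ.real (A ∩ ⋃ i, g i ⁻¹' U))
    (hgB : ∀ U, MeasurableSet U →
      min (2 * μ.real U) (2 / 3 * μ.real A) ≤ μ.real (B ∩ ⋃ i, (g i).symm ⁻¹' U))
    {k₀ : ℕ} (hk₀ : 2 * μ.real A ≤ 2 ^ k₀ * defect μ A m) (hd : 0 < defect μ A m) :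
    ∃ k, k + 1 ≤ 2 * k₀ ∧ μ ((A \ mdom m) ∩ reach g A B m (k + 1)) ≠ 0 := by
  by_contra! hc
  have hc' : ∀ k ≤ 2 * k₀, μ ((A \ mdom m) ∩ reach g A B m k) = 0 := by
    intro k hk
    cases k with
    | zero => simp [reach]
    | succ k => exact hc k hk
  have hABr : μ.real B = μ.real A := by rw [measureReal_def, measureReal_def, hAB]
  set α := μ.real A with hα
  set δ := defect μ A m with hδ
  have hdm := h.measurableSet_mdom
  have hrm := h.measurableSet_reach hA hB
  have hδα : δ ≤ α := measureReal_mono sdiff_subset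
  have hdom : μ.real (mdom m) = α - δ := by
    rw [hδ, defect, measureReal_sdiff h.mdom_subset hdm]; ring
  let q : ℕ → ℝ := fun k => μ.real (reach g A B m k)
  have hq0 : ∀ k, 0 ≤ q k := fun k => measureReal_nonneg
  have hqα : ∀ k, q k ≤ α := fun k => measureReal_mono (reach_subset m k)
  have hqd : ∀ k ≤ 2 * k₀, μ.real (mdom m ∩ reach g A B m k) = q k := by
    intro k hk
    have e : reach g A B m k = (mdom m ∩ reach g A B m k) ∪ ((A \ mdom m) ∩ reach g A B m k) := by
      ext x
      by_cases hx : x ∈ mdom m <;> simp [hx]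
      exact fun hx' => reach_subset m k hx'
    refine le_antisymm (measureReal_mono inter_subset_right) ?_
    calc q k = μ.real ((mdom m ∩ reach g A B m k) ∪ ((A \ mdom m) ∩ reach g A B m k)) := by
          rw [← e]
      _ ≤ _ := measureReal_union_le _ _
      _ = _ := by rw [measureReal_def μ ((A \ mdom m) ∩ _), hc' k hk]; simp
  let w : ℕ → Set X := fun k => (B \ mimg g m univ) ∪ mimg g m (reach g A B m k)
  have hwm : ∀ k, MeasurableSet (w k) := fun k =>
    (hB.diff (h.measurableSet_mimg MeasurableSet.univ)).union (h.measurableSet_mimg (hrm k))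
  have hw : ∀ k ≤ 2 * k₀, μ.real (w k) = δ + q k := by
    intro k hk
    have hdisj : Disjoint (B \ mimg g m univ) (mimg g m (reach g A B m k)) := by
      refine Disjoint.mono_right (mimg_mono (subset_univ _)) disjoint_sdiff_left
    rw [measureReal_union hdisj (h.measurableSet_mimg (hrm k)),
      measureReal_sdiff (h.mimg_subset _) (h.measurableSet_mimg MeasurableSet.univ), hABr]
    rw [measureReal_def μ (mimg g m univ), h.measure_mimg hg MeasurableSet.univ, inter_univ,
      measureReal_def μ (mimg g m _), h.measure_mimg hg (hrm k), ← measureReal_def,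
      ← measureReal_def, hdom, hqd k hk]
    ring
  have hgrow : ∀ k ≤ 2 * k₀, min (2 * (δ + q k)) (2 / 3 * α) ≤ q (k + 1) := by
    intro k hk
    rw [← hw k hk]
    exact hgA _ (hwm k)
  have p1 : ∀ k ≤ 2 * k₀, min (2 ^ k * δ - δ) (α / 2) ≤ q k := by
    intro k
    induction k with
    | zero => intro _; refine (min_le_left _ _).trans ?_; simpa using hq0 0
    | succ k ih =>
      intro hk
      have h1 := ih (by omega)
      have h2 := hgrow k (by omega)
      rw [min_le_iff] at h1 h2 ⊢
      rcases h2 with h2 | h2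
      · rcases h1 with h1 | h1
        · left; rw [pow_succ]; linarith
        · right; linarith
      · right; linarith
  have p2 : α / 2 ≤ q k₀ := by
    have := p1 k₀ (by omega)
    rw [min_le_iff] at this
    rcases this with h | h <;> linarith
  have hshrink : ∀ k ≤ 2 * k₀, min (2 * (α - q (k + 1))) (2 / 3 * α) ≤ α - q k := by
    intro k hk
    have hm := (hA.diff (hrm (k + 1)))
    have h1 := hgB _ hm
    rw [measureReal_sdiff (reach_subset m _) (hrm _)] at h1
    refine h1.trans ?_
    have hwB : w k ⊆ B := union_subset sdiff_subset (h.mimg_subset _)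
    calc _ ≤ μ.real (B \ w k) := by
          refine measureReal_mono ?_ (measure_ne_top _ _)
          rintro y ⟨hyB, hy⟩
          refine ⟨hyB, fun hyw => ?_⟩
          obtain ⟨i, hi⟩ := mem_iUnion.1 hy
          refine hi.2 ⟨hi.1, mem_iUnion.2 ⟨i, ?_⟩⟩
          rw [mem_preimage, (g i).apply_symm_apply]
          exact hyw
      _ = α - (δ + q k) := by rw [measureReal_sdiff hwB (hwm k), hABr, hw k hk]
      _ ≤ _ := by linarith
  have hα0 : 0 < α := hd.trans_le hδα
  have p3 : ∀ t ≤ k₀, 2 ^ t * (α - q (k₀ + t)) ≤ α / 2 := by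
    intro t
    induction t with
    | zero => intro _; simp; linarith
    | succ t ih =>
      intro ht
      have h1 := ih (by omega)
      have h2 := hshrink (k₀ + t) (by omega)
      have h3 : α - q (k₀ + t) ≤ α / 2 := by
        have : (1 : ℝ) ≤ 2 ^ t := one_le_pow₀ (by norm_num)
        nlinarith [hqα (k₀ + t)]
      rw [min_le_iff] at h2
      rcases h2 with h2 | h2
      · have h4 : (0 : ℝ) < 2 ^ t := by positivity
        have := mul_le_mul_of_nonneg_left h2 h4.le
        rw [pow_succ, ← add_assoc]; linarith
      · linarith
  have p4 := p3 k₀ le_rfl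
  have p5 : δ ≤ α - q (k₀ + k₀) := by
    have := hqd (k₀ + k₀) (by omega)
    have h2 : μ.real (mdom m ∩ reach g A B m (k₀ + k₀)) ≤ μ.real (mdom m) :=
      measureReal_mono inter_subset_left
    linarith
  have : (2 : ℝ) ^ k₀ * δ ≤ 2 ^ k₀ * (α - q (k₀ + k₀)) := by gcongr
  linarith

theorem IsMatching.exists_improve {m : X → Option ι} (h : IsMatching g A B m) {μ : Measure X}
    [IsProbabilityMeasure μ] (hg : ∀ i, MeasurePreserving (g i) μ μ) (hA : MeasurableSet A)
    (hB : MeasurableSet B) (hAB : μ A = μ B)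
    (hgA : ∀ U, MeasurableSet U →
      min (2 * μ.real U) (2 / 3 * μ.real A) ≤ μ.real (A ∩ ⋃ i, g i ⁻¹' U))
    (hgB : ∀ U, MeasurableSet U →
      min (2 * μ.real U) (2 / 3 * μ.real A) ≤ μ.real (B ∩ ⋃ i, (g i).symm ⁻¹' U))
    (hd : 0 < defect μ A m) :
    ∃ m' : X → Option ι, IsMatching g A B m' ∧ defect μ A m' < defect μ A m ∧
      μ.real {x | m x ≠ m' x} ≤ 16 * √(defect μ A m) - 16 * √(defect μ A m') := by
  have hα1 : μ.real A ≤ 1 := measureReal_le_one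
  have hδα : defect μ A m ≤ μ.real A := measureReal_mono sdiff_subset
  obtain ⟨n, hn1, hn2⟩ := exists_nat_pow_near (x := 2 * μ.real A / defect μ A m) (y := 2)
    (by rw [le_div_iff₀ hd]; linarith) (by norm_num)
  rw [le_div_iff₀ hd] at hn1
  rw [div_lt_iff₀ hd] at hn2
  obtain ⟨k, hk, hk'⟩ := h.exists_reach hg hA hB hAB hgA hgB hn2.le hd
  obtain ⟨m', h1, h2, h3⟩ := h.exists_augment hg hA hB k hk'
  refine ⟨m', h1, h2, h3.trans ?_⟩
  set δ := defect μ A m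
  set δ' := defect μ A m'
  have hδ'0 : 0 ≤ δ' := measureReal_nonneg
  have hs := Real.sq_sqrt hd.le
  have hs' := Real.sq_sqrt hδ'0
  have hs0 := Real.sqrt_nonneg δ'
  have hlt : √δ' < √δ := Real.sqrt_lt_sqrt hδ'0 h2
  have hkr : (k + 1 : ℝ) ≤ 2 * (n + 1) := by exact_mod_cast hk
  have hsq := sq_le_four_mul_two_pow (n + 1)
  push_cast at hsq
  rw [pow_succ 2 n] at hsq
  have hb : ((n + 1 : ℝ) * √δ) ^ 2 ≤ 4 ^ 2 := by
    rw [mul_pow, hs]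
    have := mul_le_mul_of_nonneg_right hsq hd.le
    nlinarith
  have hb' : (n + 1 : ℝ) * √δ ≤ 4 := 
    (pow_le_pow_iff_left₀ (by positivity) (by norm_num) two_ne_zero).1 hb
  have e : δ - δ' = (√δ - √δ') * (√δ + √δ') := by nlinarith
  rw [e]
  have hp : 0 < √δ - √δ' := by linarith
  calc (k + 1 : ℝ) * ((√δ - √δ') * (√δ + √δ')) ≤ (2 * (n + 1)) * ((√δ - √δ') * (√δ + √δ)) := by
        gcongr
    _ = 4 * ((n + 1) * √δ) * (√δ - √δ') := by ring
    _ ≤ 4 * 4 * (√δ - √δ') := by gcongr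
    _ = _ := by ring

/-- A transitive relation all of whose sequences have upper bounds, along which a nonnegative
function is continuous, has an element at which the function cannot be decreased. -/
theorem exists_minimal_of_seq {T : Type*} (r : T → T → Prop) (d : T → ℝ)
    (hr : ∀ a, r a a) (ht : ∀ a b c, r a b → r b c → r a c) (hd : ∀ a, 0 ≤ d a)
    (hu : ∀ s : ℕ → T, (∀ n, r (s n) (s (n + 1))) →
      ∃ a, (∀ n, r (s n) a) ∧ Tendsto (fun n => d (s n)) atTop (𝓝 (d a))) (a₀ : T) :
    ∃ a, ∀ b, r a b → d a ≤ d b := by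
  have hbdd : ∀ a, BddBelow (d '' {b | r a b}) := fun a => ⟨0, by
    rintro _ ⟨b, -, rfl⟩; exact hd b⟩
  have step : ∀ a, ∃ b, r a b ∧ ∀ c, r a c → 2 * d b ≤ d a + d c := by
    intro a
    by_cases hz : d a ≤ sInf (d '' {b | r a b})
    · exact ⟨a, hr a, fun c hc => by
        have := csInf_le (hbdd a) ⟨c, hc, rfl⟩
        linarith⟩
    · push Not at hz
      obtain ⟨_, ⟨b, hb, rfl⟩, hb'⟩ := exists_lt_of_csInf_lt (s := d '' {b | r a b})
        ⟨d a, a, hr a, rfl⟩ (b := (d a + sInf (d '' {b | r a b})) / 2) (by linarith)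
      exact ⟨b, hb, fun c hc => by
        have := csInf_le (hbdd a) ⟨c, hc, rfl⟩
        linarith⟩
  choose f hf1 hf2 using step
  let s : ℕ → T := fun n => f^[n] a₀
  have hs : ∀ n, s (n + 1) = f (s n) := fun n => Function.iterate_succ_apply' f n a₀
  obtain ⟨a, ha, hlim⟩ := hu s fun n => by rw [hs]; exact hf1 _
  refine ⟨a, fun b hb => ?_⟩
  have h1 : ∀ n, 2 * d (s (n + 1)) ≤ d (s n) + d b := fun n => by
    rw [hs]; exact hf2 _ _ (ht _ _ _ (ha n) hb)
  have h2 := le_of_tendsto_of_tendsto' ((hlim.comp (tendsto_add_atTop_nat 1)).const_mul 2)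
    (hlim.add_const (d b)) h1
  linarith

end Matching

end SphereEq

namespace SphereEq

section Matching

open Filter Topology

variable {X ι : Type*}

open Classical in
/-- The eventual label of a point along a sequence of labellings, if there is one. -/
def limLabel (s : ℕ → X → Option ι) (x : X) : Option ι :=
  if h : ∃ o, ∀ᶠ n in atTop, s n x = o then h.choose else none

theorem limLabel_eq {s : ℕ → X → Option ι} {x : X} {o : Option ι}
    (h : ∀ᶠ n in atTop, s n x = o) : limLabel s x = o := by
  have h' : ∃ o, ∀ᶠ n in atTop, s n x = o := ⟨o, h⟩
  rw [limLabel, dif_pos h']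
  obtain ⟨n, h1, h2⟩ := (h'.choose_spec.and h).exists
  exact h1.symm.trans h2

theorem limLabel_eq_some {s : ℕ → X → Option ι} {x : X} {i : ι} :
    limLabel s x = some i ↔ ∀ᶠ n in atTop, s n x = some i := by
  refine ⟨fun h => ?_, limLabel_eq⟩
  by_cases h' : ∃ o, ∀ᶠ n in atTop, s n x = o
  · rw [limLabel, dif_pos h'] at h
    exact h ▸ h'.choose_spec
  · rw [limLabel, dif_neg h'] at h
    exact absurd h (by simp)

theorem limLabel_eq_of_forall {s : ℕ → X → Option ι} {x : X} {n : ℕ}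
    (h : ∀ k ≥ n, s k x = s (k + 1) x) : limLabel s x = s n x := by
  apply limLabel_eq
  filter_upwards [eventually_ge_atTop n] with k hk
  induction k, hk using Nat.le_induction with
  | base => rfl
  | succ k hk ih => rw [← h k hk, ih]

variable [MeasurableSpace X] [Finite ι] {g : ι → X ≃ᵐ X} {A B : Set X}

omit [Finite ι] in
theorem IsMatching.limLabel {s : ℕ → X → Option ι} (h : ∀ n, IsMatching g A B (s n)) :
    IsMatching g A B (limLabel s) where
  meas i := by
    have : {x | SphereEq.limLabel s x = some i} =
        ⋃ N, ⋂ n, ⋂ (_ : N ≤ n), {x | s n x = some i} := by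
      ext x
      simp [limLabel_eq_some]
    rw [this]
    exact MeasurableSet.iUnion fun N => MeasurableSet.iInter fun n =>
      MeasurableSet.iInter fun _ => (h n).meas i
  left hx := by
    obtain ⟨n, hn⟩ := (limLabel_eq_some.1 hx).exists
    exact (h n).left hn
  right hx := by
    obtain ⟨n, hn⟩ := (limLabel_eq_some.1 hx).exists
    exact (h n).right hn
  inj hx hy hxy := by
    obtain ⟨n, hn, hn'⟩ := ((limLabel_eq_some.1 hx).and (limLabel_eq_some.1 hy)).exists
    exact (h n).inj hn hn' hxy

omit [Finite ι] in
theorem abs_defect_sub_le {μ : Measure X} [IsFiniteMeasure μ] {m m' : X → Option ι} :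
    |defect μ A m - defect μ A m'| ≤ μ.real {x | m x ≠ m' x} := by
  have key : ∀ m m' : X → Option ι, defect μ A m ≤ defect μ A m' + μ.real {x | m x ≠ m' x} := by
    intro m m'
    refine le_trans (measureReal_mono ?_ (measure_ne_top _ _)) (measureReal_union_le _ _)
    rintro x ⟨hx, hx'⟩
    by_cases h : m x = m' x
    · left
      refine ⟨hx, fun hm => hx' ?_⟩
      obtain ⟨i, hi⟩ := mem_mdom.1 hm
      exact mem_mdom.2 ⟨i, h.trans hi⟩
    · exact Or.inr h
  have h1 := key m m'
  have h2 := key m' m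
  have : {x | m' x ≠ m x} = {x | m x ≠ m' x} := by ext x; exact ne_comm
  rw [this] at h2
  rw [abs_le]; constructor <;> linarith

theorem exists_isMatching_defect_zero {μ : Measure X} [IsProbabilityMeasure μ]
    (hg : ∀ i, MeasurePreserving (g i) μ μ) (hA : MeasurableSet A)
    (hB : MeasurableSet B) (hAB : μ A = μ B)
    (hgA : ∀ U, MeasurableSet U →
      min (2 * μ.real U) (2 / 3 * μ.real A) ≤ μ.real (A ∩ ⋃ i, g i ⁻¹' U))
    (hgB : ∀ U, MeasurableSet U →
      min (2 * μ.real U) (2 / 3 * μ.real A) ≤ μ.real (B ∩ ⋃ i, (g i).symm ⁻¹' U)) :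
    ∃ m : X → Option ι, IsMatching g A B m ∧ μ (A \ mdom m) = 0 := by
  let d : {m // IsMatching g A B m} → ℝ := fun m => defect μ A m.1
  let r : {m // IsMatching g A B m} → {m // IsMatching g A B m} → Prop := fun m m' =>
    μ.real {x | m.1 x ≠ m'.1 x} ≤ 16 * √(d m) - 16 * √(d m')
  have h0 : IsMatching g A B (fun _ => none) :=
    ⟨by simp, by simp, by simp, by simp⟩
  have htr : ∀ a b c, r a b → r b c → r a c := by
    intro a b c hab hbc
    have : μ.real {x | a.1 x ≠ c.1 x} ≤
        μ.real {x | a.1 x ≠ b.1 x} + μ.real {x | b.1 x ≠ c.1 x} := by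
      refine le_trans (measureReal_mono ?_ (measure_ne_top _ _)) (measureReal_union_le _ _)
      intro x hx
      by_cases h : a.1 x = b.1 x
      · right
        rw [Set.mem_ofPred_eq, ← h]; exact hx
      · exact Or.inl h
    simp only [r] at hab hbc ⊢
    linarith
  have hup : ∀ s : ℕ → {m // IsMatching g A B m}, (∀ n, r (s n) (s (n + 1))) →
      ∃ a, (∀ n, r (s n) a) ∧ Tendsto (fun n => d (s n)) atTop (𝓝 (d a)) := by
    intro s hs
    let M : {m // IsMatching g A B m} :=
    ⟨limLabel fun n => (s n).1, IsMatching.limLabel fun n => (s n).2⟩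
    let φ : ℕ → ℝ := fun n => 16 * √(d (s n))
    have hs' : ∀ n, μ.real {x | (s n).1 x ≠ (s (n + 1)).1 x} ≤ φ n - φ (n + 1) := hs
    have hφ : Antitone φ := antitone_nat_of_succ_le fun n => by
      have := (measureReal_nonneg (μ := μ)).trans (hs' n)
      linarith
    have hφ0 : ∀ n, 0 ≤ φ n := fun n => by positivity
    obtain ⟨L, hL⟩ : ∃ L, Tendsto φ atTop (𝓝 L) :=
      ⟨_, tendsto_atTop_ciInf hφ ⟨0, by rintro _ ⟨n, rfl⟩; exact hφ0 n⟩⟩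
    have hφL : ∀ n, L ≤ φ n := fun n => hφ.le_of_tendsto hL n
    have hρ : ∀ n, μ.real {x | (s n).1 x ≠ M.1 x} ≤ φ n - L := by
      intro n
      have h1 : μ {x | (s n).1 x ≠ M.1 x} ≤ ENNReal.ofReal (φ n - L) := by
        calc _ ≤ μ (⋃ k, {x | (s (n + k)).1 x ≠ (s (n + k + 1)).1 x}) := by
              apply measure_mono
              intro x hx
              by_contra hx'
              simp only [mem_iUnion, Set.mem_ofPred_eq, not_exists, not_not] at hx'
              refine hx (limLabel_eq_of_forall (s := fun n => (s n).1) fun k hk => ?_).symm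
              obtain ⟨l, rfl⟩ := Nat.exists_eq_add_of_le hk
              exact hx' l
          _ ≤ ∑' k, μ {x | (s (n + k)).1 x ≠ (s (n + k + 1)).1 x} := measure_iUnion_le _
          _ ≤ _ := by
              refine ENNReal.tsum_le_of_sum_range_le fun N => ?_
              calc _ ≤ ∑ k ∈ Finset.range N, ENNReal.ofReal (φ (n + k) - φ (n + k + 1)) := by
                    refine Finset.sum_le_sum fun k _ => ?_
                    rw [← ENNReal.ofReal_toReal (measure_ne_top μ _)]
                    exact ENNReal.ofReal_le_ofReal (hs' (n + k))
                _ = ENNReal.ofReal (φ n - φ (n + N)) := by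
                    rw [← ENNReal.ofReal_sum_of_nonneg fun k _ => sub_nonneg.2 (hφ (Nat.le_succ _))]
                    exact congrArg _ (Finset.sum_range_sub' (fun k => φ (n + k)) N)
                _ ≤ _ := ENNReal.ofReal_le_ofReal (by linarith [hφL (n + N)])
      have := ENNReal.toReal_mono ENNReal.ofReal_ne_top h1
      rwa [ENNReal.toReal_ofReal (by linarith [hφL n])] at this
    have hd : Tendsto (fun n => d (s n)) atTop (𝓝 (d M)) := by
      rw [tendsto_iff_norm_sub_tendsto_zero]
      refine squeeze_zero (fun n => norm_nonneg _)
        (fun n => (abs_defect_sub_le.trans (hρ n))) ?_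
      simpa using hL.sub_const L
    have hLM : L = 16 * √(d M) :=
      tendsto_nhds_unique hL ((Real.continuous_sqrt.tendsto _ |>.comp hd).const_mul 16)
    exact ⟨M, fun n => by simpa only [r, ← hLM] using hρ n, hd⟩
  obtain ⟨m, hm⟩ := exists_minimal_of_seq r d (fun m => by simp [r]) htr
    (fun m => measureReal_nonneg) hup ⟨_, h0⟩
  refine ⟨m.1, m.2, ?_⟩
  by_contra hne
  have hd : 0 < defect μ A m.1 := by
    rw [defect, measureReal_def, ENNReal.toReal_pos_iff]
    exact ⟨pos_iff_ne_zero.2 hne, measure_lt_top _ _⟩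
  obtain ⟨m', h1, h2, h3⟩ := m.2.exists_improve hg hA hB hAB hgA hgB hd
  exact absurd (hm ⟨m', h1⟩ h3) (not_le.2 h2)
end Matching

end SphereEq

namespace SphereEq
open Quaternion

theorem exists_red (w : List Letter) : ∃ v, Red v ∧ evU v = evU w := by
  induction w with
  | nil => exact ⟨[], trivial, rfl⟩
  | cons s w ih =>
    obtain ⟨v, hv, e⟩ := ih
    by_cases h : v.head? = some (linv s)
    · obtain ⟨t, v', rfl⟩ : ∃ t v', v = t :: v' := by
        cases v with
        | nil => simp at h
        | cons t v' => exact ⟨t, v', rfl⟩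
      simp only [List.head?_cons, Option.some_inj] at h
      refine ⟨v', hv.2, ?_⟩
      rw [evU_cons, ← e, evU_cons, h, qU_linv, mul_inv_cancel_left]
    · exact ⟨s :: v, ⟨h, hv⟩, by rw [evU_cons, evU_cons, e]⟩

theorem evU_inj_of_length {w w' : List Letter} (hw : Red w) (hw' : Red w')
    (hl : w.length = w'.length) (h : evU w = evU w') : w = w' := by
  apply ev_injective hw hw' hl
  have h1 : ev ℝ w = ev ℝ w' := by
    have h2 : ((evU w : UQ) : ℍ[ℝ]) = (evU w' : UQ) := by rw [h]
    rw [coe_evU, coe_evU, hl] at h2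
    exact smul_right_injective _ (by positivity) h2
  rw [ev_cast w, ev_cast w'] at h1
  ext
  · have := congrArg QuaternionAlgebra.re h1; simpa using this
  · have := congrArg QuaternionAlgebra.imI h1; simpa using this
  · have := congrArg QuaternionAlgebra.imJ h1; simpa using this
  · have := congrArg QuaternionAlgebra.imK h1; simpa using this

theorem exists_not_commute {v : List Letter} (hv : Red v) (hne : v ≠ []) :
    ∃ s, qU s * evU v ≠ evU v * qU s := by
  obtain ⟨t, v', rfl⟩ : ∃ t v', v = t :: v' := by
    cases v with
    | nil => exact absurd rfl hne
    | cons t v' => exact ⟨t, v', rfl⟩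
  obtain ⟨l, hl⟩ : ∃ l, (t :: v').getLast? = some l := ⟨_, List.getLast?_eq_some_getLast (by simp)⟩
  obtain ⟨s, h1, h2, h3⟩ : ∃ s : Letter, s ≠ t ∧ s ≠ linv t ∧ s ≠ linv l := by
    have h : ∀ t l : Letter, ∃ s : Letter, s ≠ t ∧ s ≠ linv t ∧ s ≠ linv l := by decide
    exact h t l
  refine ⟨s, fun h => h1 ?_⟩
  have hr1 : Red (s :: t :: v') := by
    refine ⟨?_, hv⟩
    simp only [List.head?_cons, ne_eq, Option.some_inj]
    intro h; apply h2; rw [h, linv_linv]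
  have hr2 : Red ((t :: v') ++ [s]) := by
    refine red_append hv ⟨by simp, trivial⟩ fun r hr => ?_
    rw [hl] at hr
    simp only [Option.mem_def, Option.some_inj] at hr
    subst hr
    simpa using h3
  have := evU_inj_of_length hr1 hr2 (by simp) (by
    rw [evU_cons, h, evU_append]; simp [evU])
  simp only [List.cons_append, List.cons.injEq] at this
  exact this.1

theorem evU_ne_one {v : List Letter} (hv : Red v) (hne : v ≠ []) : evU v ≠ 1 := by
  intro h
  obtain ⟨s, hs⟩ := exists_not_commute hv hne
  rw [h] at hs; simp at hs

theorem evU_inj {w w' : List Letter} (hw : Red w) (hw' : Red w') (h : evU w = evU w') :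
    w = w' := by
  induction w generalizing w' with
  | nil =>
    by_contra hne
    exact evU_ne_one hw' (Ne.symm hne) h.symm
  | cons s w ih =>
    cases w' with
    | nil => exact absurd h (evU_ne_one hw (by simp))
    | cons t w' =>
      by_cases hst : s = t
      · subst hst
        rw [evU_cons, evU_cons, mul_right_inj] at h
        rw [ih hw.2 hw'.2 h]
      · exfalso
        have hr : Red (winv (t :: w') ++ (s :: w)) := by
          refine red_append (red_winv hw') hw fun r hr => ?_
          simp only [winv_cons, List.getLast?_append, List.getLast?_singleton, Option.some_or,
            Option.mem_def, Option.some_inj] at hr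
          subst hr
          simpa [linv_linv] using hst
        exact evU_ne_one hr (by simp) (by rw [evU_append, evU_winv, h, inv_mul_cancel])

section Free

variable {n : ℕ} (I : Fin 3 ↪ Fin n)

/-- No nontrivial element of the free group fixes `x`. -/
def IsFreePt (x : Sph n) : Prop := ∀ w, evU w ≠ 1 → ac I (evU w) x ≠ x

variable {I}

theorem IsFreePt.ac {x : Sph n} (h : IsFreePt I x) (w : List Letter) :
    IsFreePt I (ac I (evU w) x) := by
  intro v hv e
  refine h (winv w ++ v ++ w) ?_ ?_
  · rw [evU_append, evU_append, evU_winv]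
    intro h'
    apply hv
    rw [mul_assoc, inv_mul_eq_one] at h'
    simpa using h'.symm
  · rw [evU_append, evU_append, evU_winv, ac_mul, ac_mul, e, ac_inv_apply]

theorem IsFreePt.inj {x : Sph n} (h : IsFreePt I x) {v w : List Letter}
    (e : SphereEq.ac I (evU v) x = SphereEq.ac I (evU w) x) : evU v = evU w := by
  by_contra hne
  refine h (winv w ++ v) ?_ ?_
  · rw [evU_append, evU_winv, Ne, inv_mul_eq_one]
    exact fun h => hne h.symm
  · rw [evU_append, evU_winv, ac_mul, e, ac_inv_apply]

variable (I) in
/-- Points in the same orbit of the free group. -/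
def orbSetoid : Setoid (Sph n) where
  r x y := ∃ w, ac I (evU w) x = y
  iseqv := ⟨fun x => ⟨[], ac_one I x⟩, by
    rintro x y ⟨w, rfl⟩
    exact ⟨winv w, by rw [evU_winv, ac_inv_apply]⟩, by
    rintro x y z ⟨w, rfl⟩ ⟨v, rfl⟩
    exact ⟨v ++ w, by rw [evU_append, ac_mul]⟩⟩

variable (I) in
theorem exists_first_letter : ∃ L : Sph n → Option Letter, ∀ x, IsFreePt I x → ∀ s,
    L x ≠ some (linv s) → L (ac I (qU s) x) = some s := by
  let rep : Sph n → Sph n := fun x => @Quotient.out _ (orbSetoid I) (Quotient.mk (orbSetoid I) x)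
  have hrep : ∀ x, ∃ w, Red w ∧ ac I (evU w) (rep x) = x := by
    intro x
    obtain ⟨w, hw⟩ := @Quotient.mk_out _ (orbSetoid I) x
    obtain ⟨v, hv, e⟩ := exists_red w
    exact ⟨v, hv, by rw [e]; exact hw⟩
  choose wd hred hwd using hrep
  refine ⟨fun x => (wd x).head?, fun x hx s hs => ?_⟩
  set y := ac I (qU s) x with hy
  have hxy : rep y = rep x := by
    have : Quotient.mk (orbSetoid I) y = Quotient.mk (orbSetoid I) x :=
      (Quotient.sound (s := orbSetoid I) ⟨[s], by simp [evU, hy]⟩).symm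
    simp only [rep, this]
  have hfree : IsFreePt I (rep x) := by
    have := hx.ac (winv (wd x))
    have e : SphereEq.ac I (evU (wd x))⁻¹ x = rep x := by
      have := ac_inv_apply I (evU (wd x)) (rep x)
      rwa [hwd x] at this
    rwa [evU_winv, e] at this
  have e : evU (wd y) = evU (s :: wd x) := by
    apply hfree.inj
    rw [evU_cons, ac_mul, hwd x, ← hxy, hwd y]
  have := evU_inj (hred y) (red_cons.2 ⟨hs, hred x⟩) e
  simp [this]

theorem five_mul_card_le (F : Finset (Sph n)) (hF : ∀ x ∈ F, IsFreePt I x) :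
    5 * F.card ≤ ((Finset.univ ×ˢ F).image fun p : Letter × Sph n => ac I (qU p.1) p.2).card := by
  classical
  obtain ⟨L, hL⟩ := exists_first_letter I
  set N := (Finset.univ ×ˢ F).image fun p : Letter × Sph n => ac I (qU p.1) p.2 with hN
  have h1 : ∀ s, F.card ≤ (N.filter fun y => L y = some s).card +
      (F.filter fun x => L x = some (linv s)).card := by
    intro s
    rw [← Finset.card_filter_add_card_filter_not (s := F) (fun x => L x = some (linv s)), add_comm]
    refine Nat.add_le_add_right ?_ _
    apply Finset.card_le_card_of_injOn (fun x => ac I (qU s) x)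
    · intro x hx
      simp only [Finset.coe_filter, Set.mem_ofPred_eq] at hx ⊢
      exact ⟨Finset.mem_image.2 ⟨(s, x), by simpa using hx.1, rfl⟩, hL x (hF x hx.1) s hx.2⟩
    · intro x _ y _ h
      have := congrArg (ac I (qU s)⁻¹) h
      simpa [ac_inv_apply] using this
  have h2 : ∑ s, (N.filter fun y => L y = some s).card ≤ N.card := by
    rw [← Finset.card_biUnion]
    · apply Finset.card_le_card
      intro y hy
      simp only [Finset.mem_biUnion, Finset.mem_filter] at hy
      obtain ⟨s, -, h, -⟩ := hy
      exact h
    · intro s _ t _ hst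
      rw [Function.onFun, Finset.disjoint_left]
      intro y h1 h2
      simp only [Finset.mem_filter] at h1 h2
      rw [h1.2, Option.some_inj] at h2
      exact hst h2.2
  have h3 : ∑ s, (F.filter fun x => L x = some (linv s)).card ≤ F.card := by
    rw [← Finset.card_biUnion]
    · apply Finset.card_le_card
      intro y hy
      simp only [Finset.mem_biUnion, Finset.mem_filter] at hy
      obtain ⟨s, -, h, -⟩ := hy
      exact h
    · intro s _ t _ hst
      rw [Function.onFun, Finset.disjoint_left]
      intro y h1 h2
      simp only [Finset.mem_filter] at h1 h2
      rw [h1.2, Option.some_inj, linv_inj] at h2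
      exact hst h2.2
  have h4 := Finset.sum_le_sum fun s (_ : s ∈ Finset.univ) => h1 s
  rw [Finset.sum_add_distrib, Finset.sum_const, Finset.card_univ, card_letter, smul_eq_mul] at h4
  omega

variable (I) in
theorem exists_free_expand (t : ℕ) : ∃ E : Finset (List Letter), ∀ F : Finset (Sph n),
    (∀ x ∈ F, IsFreePt I x) →
    5 ^ t * F.card ≤ ((E ×ˢ F).image fun p : List Letter × Sph n => ac I (evU p.1) p.2).card := by
  classical
  induction t with
  | zero =>
    refine ⟨{[]}, fun F _ => ?_⟩
    have : ((({[]} : Finset (List Letter)) ×ˢ F).image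
        fun p : List Letter × Sph n => ac I (evU p.1) p.2) = F := by
      ext x
      simp only [Finset.mem_image, Finset.mem_product, Finset.mem_singleton]
      constructor
      · rintro ⟨⟨w, y⟩, ⟨rfl, hy⟩, rfl⟩
        simpa [evU, ac_one] using hy
      · exact fun hx => ⟨([], x), ⟨rfl, hx⟩, ac_one I x⟩
    rw [this]; simp
  | succ t ih =>
    obtain ⟨E, hE⟩ := ih
    refine ⟨(Finset.univ ×ˢ E).image fun p : Letter × List Letter => p.1 :: p.2, fun F hF => ?_⟩
    set G := (E ×ˢ F).image fun p : List Letter × Sph n => ac I (evU p.1) p.2 with hG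
    have h1 := five_mul_card_le (I := I) G (by
      intro x hx
      obtain ⟨p, hp, rfl⟩ := Finset.mem_image.1 hx
      exact (hF _ (Finset.mem_product.1 hp).2).ac _)
    have h2 := hE F hF
    have e : ((Finset.univ ×ˢ G).image fun p : Letter × Sph n => ac I (qU p.1) p.2) =
        ((((Finset.univ ×ˢ E).image fun p : Letter × List Letter => p.1 :: p.2) ×ˢ F).image
          fun p : List Letter × Sph n => ac I (evU p.1) p.2) := by
      ext y
      simp only [hG, Finset.mem_image, Finset.mem_product, Finset.mem_univ, true_and]
      constructor
      · rintro ⟨⟨s, z⟩, ⟨⟨w, x⟩, ⟨hw, hx⟩, rfl⟩, rfl⟩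
        exact ⟨(s :: w, x), ⟨⟨(s, w), hw, rfl⟩, hx⟩, by rw [evU_cons, ac_mul]⟩
      · rintro ⟨⟨v, x⟩, ⟨⟨⟨s, w⟩, hw, rfl⟩, hx⟩, rfl⟩
        exact ⟨(s, ac I (evU w) x), ⟨(w, x), ⟨hw, hx⟩, rfl⟩, by rw [evU_cons, ac_mul]⟩
    rw [← e]
    calc _ = 5 * (5 ^ t * F.card) := by ring
      _ ≤ 5 * G.card := by gcongr
      _ ≤ _ := h1

end Free

end SphereEq

namespace SphereEq
open Quaternion

theorem finite_fixed {h k : UQ} (hk : k * h ≠ h * k) : {x : Sph 3 | rs h x = x}.Finite := by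
  set b := (h : ℍ[ℝ]).imI with hb
  set c := (h : ℍ[ℝ]).imJ with hc
  set d := (h : ℍ[ℝ]).imK with hd
  have hS : 0 < b ^ 2 + c ^ 2 + d ^ 2 := by
    by_contra hS
    have hb0 : b = 0 := by nlinarith [sq_nonneg b, sq_nonneg c, sq_nonneg d]
    have hc0 : c = 0 := by nlinarith [sq_nonneg b, sq_nonneg c, sq_nonneg d]
    have hd0 : d = 0 := by nlinarith [sq_nonneg b, sq_nonneg c, sq_nonneg d]
    apply hk
    apply Subtype.ext
    rw [Metric.unitSphere.coe_mul, Metric.unitSphere.coe_mul]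
    ext <;> simp [← hb, ← hc, ← hd, hb0, hc0, hd0, mul_comm]
  set S := b ^ 2 + c ^ 2 + d ^ 2 with hSdef
  have key : ∀ x : Sph 3, rs h x = x →
      c * (x : EucSp 3) 2 = d * (x : EucSp 3) 1 ∧ d * (x : EucSp 3) 0 = b * (x : EucSp 3) 2 ∧
      b * (x : EucSp 3) 1 = c * (x : EucSp 3) 0 := by
    intro x hx
    have h1 : (h : ℍ[ℝ]) * toQ (x : EucSp 3) * star (h : ℍ[ℝ]) = toQ (x : EucSp 3) := by
      rw [← toQ_rotFun]
      congr 1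
      ext j
      rw [← coe_rs, hx]
    have h2 : star (h : ℍ[ℝ]) * (h : ℍ[ℝ]) = 1 := by
      rw [← coe_inv_UQ, ← Metric.unitSphere.coe_mul, inv_mul_cancel]; rfl
    have h3 : (h : ℍ[ℝ]) * toQ (x : EucSp 3) = toQ (x : EucSp 3) * h := by
      calc _ = (h : ℍ[ℝ]) * toQ (x : EucSp 3) * (star (h : ℍ[ℝ]) * h) := by rw [h2, mul_one]
        _ = ((h : ℍ[ℝ]) * toQ (x : EucSp 3) * star (h : ℍ[ℝ])) * h := by rw [mul_assoc _ (star _)]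
        _ = _ := by rw [h1]
    have e1 := congrArg QuaternionAlgebra.imI h3
    have e2 := congrArg QuaternionAlgebra.imJ h3
    have e3 := congrArg QuaternionAlgebra.imK h3
    simp [toQ, ← hb, ← hc, ← hd] at e1 e2 e3
    refine ⟨by linarith, by linarith, by linarith⟩
  have sub : ∀ s : ℝ, {x : Sph 3 | rs h x = x ∧
      b * (x : EucSp 3) 0 + c * (x : EucSp 3) 1 + d * (x : EucSp 3) 2 = s}.Subsingleton := by
    rintro s x ⟨hx, hxs⟩ y ⟨hy, hys⟩
    have par : ∀ z : Sph 3, rs h z = z →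
        b * (z : EucSp 3) 0 + c * (z : EucSp 3) 1 + d * (z : EucSp 3) 2 = s →
        S * (z : EucSp 3) 0 = s * b ∧ S * (z : EucSp 3) 1 = s * c ∧
        S * (z : EucSp 3) 2 = s * d := by
      intro z hz hs
      obtain ⟨k1, k2, k3⟩ := key z hz
      rw [← hs, hSdef]
      refine ⟨?_, ?_, ?_⟩
      · linear_combination d * k2 - c * k3
      · linear_combination b * k3 - d * k1
      · linear_combination c * k1 - b * k2
    obtain ⟨x0, x1, x2⟩ := par x hx hxs
    obtain ⟨y0, y1, y2⟩ := par y hy hys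
    exact ext_S2 (mul_left_cancel₀ hS.ne' (x0.trans y0.symm))
      (mul_left_cancel₀ hS.ne' (x1.trans y1.symm)) (mul_left_cancel₀ hS.ne' (x2.trans y2.symm))
  refine ((sub (√S)).finite.union (sub (-√S)).finite).subset fun x hx => ?_
  obtain ⟨k1, k2, k3⟩ := key x hx
  set p := b * (x : EucSp 3) 0 + c * (x : EucSp 3) 1 + d * (x : EucSp 3) 2 with hp
  have hp2 : p ^ 2 = (√S) ^ 2 := by
    rw [Real.sq_sqrt hS.le, ← mul_one S, ← sq_S2 x, hSdef, hp]
    linear_combination (-(c * (x : EucSp 3) 2 - d * (x : EucSp 3) 1)) * k1 -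
      (d * (x : EucSp 3) 0 - b * (x : EucSp 3) 2) * k2 -
      (b * (x : EucSp 3) 1 - c * (x : EucSp 3) 0) * k3
  rcases sq_eq_sq_iff_eq_or_eq_neg.1 hp2 with h' | h'
  · exact Or.inl ⟨hx, h'⟩
  · exact Or.inr ⟨hx, h'⟩

/-- The points of `S²` with a nontrivial stabilizer in the free group. -/
def badPts : Set (Sph 3) := {x | ∃ w, evU w ≠ 1 ∧ rs (evU w) x = x}

theorem countable_badPts : badPts.Countable := by
  have : badPts ⊆ ⋃ w ∈ {w : List Letter | evU w ≠ 1}, {x : Sph 3 | rs (evU w) x = x} := by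
    rintro x ⟨w, hw, hx⟩
    exact mem_biUnion (show w ∈ {w : List Letter | evU w ≠ 1} from hw) hx
  refine Set.Countable.mono this (Set.Countable.biUnion (Set.to_countable _) fun w hw => ?_)
  obtain ⟨v, hv, e⟩ := exists_red w
  have hne : v ≠ [] := by
    rintro rfl
    exact hw e.symm
  obtain ⟨s, hs⟩ := exists_not_commute hv hne
  rw [e] at hs
  exact (finite_fixed hs).countable

theorem sig_singleton (x : Sph 3) : sig {x} = 0 := by
  by_contra hne
  have hinf : (univ : Set (Sph 3)).Infinite := by
    have hle : ∀ k : ℕ, ((k : ℝ) + 1)⁻¹ ^ 2 ≤ 1 := fun k =>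
      pow_le_one₀ (by positivity) (inv_le_one_of_one_le₀ (by linarith [k.cast_nonneg (α := ℝ)]))
    have hinj : Function.Injective fun k : ℕ => mkS2 ((k : ℝ) + 1)⁻¹ (√(1 - ((k : ℝ) + 1)⁻¹ ^ 2)) 0
        (by rw [Real.sq_sqrt (by linarith [hle k])]; ring) := by
      intro k l h
      have h0 : ((k : ℝ) + 1)⁻¹ = ((l : ℝ) + 1)⁻¹ := by
        have := congrArg (fun x : Sph 3 => (x : EucSp 3) 0) h
        simpa [mkS2] using this
      have := inv_injective h0
      exact_mod_cast add_right_cancel this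
    have := Infinite.of_injective _ hinj
    exact Set.infinite_univ
  have htop := hinf.meas_eq_top (μ := sig) ⟨sig {x}, hne, fun y _ => by
    obtain ⟨g, hg⟩ := exists_rs_ez x
    obtain ⟨k, hk⟩ := exists_rs_ez y
    have e : rs (g * k⁻¹) ⁻¹' {x} = {y} := by
      ext z
      rw [mem_preimage, mem_singleton_iff, mem_singleton_iff, rs_mul, ← hg, ← hk]
      constructor
      · intro h
        have := congrArg (fun z => rs k (rs g⁻¹ z)) h
        simpa [rs_inv_apply, rs_apply_inv] using this
      · rintro rfl
        rw [rs_inv_apply]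
    rw [← e, (measurePreserving_rs _).measure_preimage
      (measurableSet_singleton x).nullMeasurableSet]⟩
  exact measure_ne_top _ _ htop

theorem exists_conj_free : ∃ g : UQ, ∀ x : Sph 3, x ∉ badPts ∨ rs g⁻¹ x ∉ badPts := by
  have h : nu (⋃ d ∈ badPts, ⋃ e ∈ badPts, {g | rs g d = e}) = 0 := by
    refine (measure_biUnion_null_iff countable_badPts).2 fun d _ =>
      (measure_biUnion_null_iff countable_badPts).2 fun e _ => ?_
    have h1 := map_rs_eq_sig d
    have h2 := sig_singleton e
    rw [← h1, Measure.map_apply (continuous_rs_left d).measurable (measurableSet_singleton e)] at h2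
    exact h2
  have hne : (⋃ d ∈ badPts, ⋃ e ∈ badPts, {g | rs g d = e}) ≠ univ := by
    intro e
    rw [e, measure_univ] at h
    exact one_ne_zero h
  obtain ⟨g, hg⟩ := (Set.ne_univ_iff_exists_notMem _).1 hne
  refine ⟨g, fun x => ?_⟩
  by_contra! hc
  apply hg
  simp only [mem_iUnion]
  exact ⟨_, hc.2, x, hc.1, rs_apply_inv g x⟩

section

variable {n : ℕ}

theorem isFreePt_of_dir {I : Fin 3 ↪ Fin n} {x : Sph n} {r : ℝ} (hr : r ≠ 0) {ω : Sph 3}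
    (hω : ∀ a, (x : EucSp n) (I a) = r * (ω : EucSp 3) a) (hfree : ω ∉ badPts) :
    IsFreePt I x := by
  intro w hw hx
  refine hfree ⟨w, hw, ?_⟩
  apply Subtype.ext
  ext a
  have h1 : ((x : EucSp n) : Fin n → ℝ) ∘ I = r • ((ω : EucSp 3) : Fin 3 → ℝ) := by
    ext a; simpa using hω a
  have h2 : (ac I (evU w) x : EucSp n) (I a) = r * rotFun (evU w) (ω : EucSp 3) a := by
    rw [coe_ac, blockFun_apply, h1, rotFun_smul]; rfl
  rw [hx, hω] at h2
  rw [coe_rs]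
  exact (mul_left_cancel₀ hr h2).symm

theorem ac_dir {I : Fin 3 ↪ Fin n} {x : Sph n} {r : ℝ} {ω : Sph 3}
    (hω : ∀ a, (x : EucSp n) (I a) = r * (ω : EucSp 3) a) (h : UQ) (a : Fin 3) :
    (ac I h x : EucSp n) (I a) = r * (rs h ω : EucSp 3) a := by
  have h1 : ((x : EucSp n) : Fin n → ℝ) ∘ I = r • ((ω : EucSp 3) : Fin 3 → ℝ) := by
    ext a; simpa using hω a
  rw [coe_ac, blockFun_apply, h1, rotFun_smul, coe_rs]; rfl

theorem exists_block_ne (hn : 3 ≤ n) (x : Sph n) :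
    ∃ (I : Fin 3 ↪ Fin n) (r : ℝ) (ω : Sph 3), r ≠ 0 ∧
      ∀ a, (x : EucSp n) (I a) = r * (ω : EucSp 3) a := by
  obtain ⟨j, hj⟩ : ∃ j, (x : EucSp n) j ≠ 0 := by
    by_contra! hc
    have : (x : EucSp n) = 0 := by ext j; simpa using hc j
    have h1 := norm_eq_of_mem_sphere x
    rw [this] at h1; simp at h1
  let I : Fin 3 ↪ Fin n := (Fin.castLEEmb hn).trans
    (Equiv.swap (Fin.castLE hn 0) j).toEmbedding
  have hI : I 0 = j := by simp [I]
  obtain ⟨ω, hω⟩ := exists_dir fun a => (x : EucSp n) (I a)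
  refine ⟨I, _, ω, fun h0 => hj ?_, hω⟩
  have := hω 0
  rw [h0, zero_mul, hI] at this
  exact this

/-- Finitely many rotations expand all finite subsets of the sphere by any prescribed factor. -/
theorem exists_finset_expand (hn : 3 ≤ n) (C : ℕ) : ∃ S : Finset (EucSp n ≃ₗᵢ[ℝ] EucSp n),
    (∀ s ∈ S, IsRotation s) ∧ ∀ F : Finset (Sph n),
      C * F.card ≤ ((S ×ˢ F).image
        fun p : (EucSp n ≃ₗᵢ[ℝ] EucSp n) × Sph n => rotateSphere p.1 p.2).card := by
  classical
  obtain ⟨g, hg⟩ := exists_conj_free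
  let c : Bool → UQ := fun b => if b then 1 else g
  let κ := (Fin 3 ↪ Fin n) × Bool
  obtain ⟨t, ht⟩ := pow_unbounded_of_one_lt (C * Fintype.card κ) (show (1 : ℕ) < 5 by norm_num)
  choose E hE using fun I : Fin 3 ↪ Fin n => exists_free_expand I t
  let S : Finset (EucSp n ≃ₗᵢ[ℝ] EucSp n) := Finset.univ.biUnion fun k : κ =>
    (E k.1).image fun w => bl k.1 (c k.2 * evU w * (c k.2)⁻¹)
  refine ⟨S, ?_, fun F => ?_⟩
  · intro s hs
    simp only [S, Finset.mem_biUnion, Finset.mem_image] at hs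
    obtain ⟨k, -, w, -, rfl⟩ := hs
    exact isRotation_bl _ _
  set N := (S ×ˢ F).image fun p : (EucSp n ≃ₗᵢ[ℝ] EucSp n) × Sph n => rotateSphere p.1 p.2 with hN
  let Fk : κ → Finset (Sph n) := fun k => F.filter fun x => IsFreePt k.1 (ac k.1 (c k.2)⁻¹ x)
  have hcov : F ⊆ Finset.univ.biUnion Fk := by
    intro x hx
    obtain ⟨I, r, ω, hr, hω⟩ := exists_block_ne hn x
    simp only [Finset.mem_biUnion, Finset.mem_univ, true_and, Fk, Finset.mem_filter]
    rcases hg ω with h | h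
    · refine ⟨(I, true), hx, ?_⟩
      have : (c true)⁻¹ = 1 := by simp [c]
      rw [this, ac_one]
      exact isFreePt_of_dir hr hω h
    · exact ⟨(I, false), hx, isFreePt_of_dir hr (ac_dir hω _) (by simpa [c] using h)⟩
  have hk : ∀ k, 5 ^ t * (Fk k).card ≤ N.card := by
    intro k
    have h1 := hE k.1 ((Fk k).image (ac k.1 (c k.2)⁻¹)) (by
      intro x hx
      obtain ⟨y, hy, rfl⟩ := Finset.mem_image.1 hx
      exact (Finset.mem_filter.1 hy).2)
    rw [Finset.card_image_of_injective] at h1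
    swap
    · intro x y hxy
      have := congrArg (ac k.1 (c k.2)) hxy
      simpa [ac_apply_inv] using this
    refine h1.trans (Finset.card_le_card_of_injOn (ac k.1 (c k.2)) ?_ ?_)
    · intro y hy
      obtain ⟨⟨w, z⟩, hp, rfl⟩ := Finset.mem_image.1 (Finset.mem_coe.1 hy)
      obtain ⟨hw, hz⟩ := Finset.mem_product.1 hp
      obtain ⟨x, hx, rfl⟩ := Finset.mem_image.1 hz
      refine Finset.mem_coe.2 (Finset.mem_image.2
        ⟨(bl k.1 (c k.2 * evU w * (c k.2)⁻¹), x), ?_, ?_⟩)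
      · refine Finset.mem_product.2 ⟨Finset.mem_biUnion.2 ⟨k, Finset.mem_univ _,
          Finset.mem_image.2 ⟨w, hw, rfl⟩⟩, (Finset.mem_filter.1 hx).1⟩
      · change ac k.1 (c k.2 * evU w * (c k.2)⁻¹) x = _
        rw [ac_mul, ac_mul]
    · intro x _ y _ hxy
      have := congrArg (ac k.1 (c k.2)⁻¹) hxy
      simpa [ac_inv_apply] using this
  have hpos : 0 < Fintype.card κ :=
    Fintype.card_pos_iff.2 ⟨(Fin.castLEEmb hn, true)⟩
  have h2 : F.card ≤ ∑ k, (Fk k).card := (Finset.card_le_card hcov).trans Finset.card_biUnion_le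
  have h3 : 5 ^ t * F.card ≤ Fintype.card κ * N.card := by
    calc _ ≤ 5 ^ t * ∑ k, (Fk k).card := by gcongr
      _ = ∑ k, 5 ^ t * (Fk k).card := Finset.mul_sum _ _ _
      _ ≤ ∑ _k : κ, N.card := Finset.sum_le_sum fun k _ => hk k
      _ = _ := by simp
  have h4 : Fintype.card κ * (C * F.card) ≤ Fintype.card κ * N.card := by
    calc _ = (C * Fintype.card κ) * F.card := by ring
      _ ≤ 5 ^ t * F.card := by gcongr
      _ ≤ _ := h3
  exact Nat.le_of_mul_le_mul_left h4 hpos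

end

end SphereEq

namespace SphereEq

section NullBijection

variable {n : ℕ}

/-- If finitely many rotations move every point into `B`, then the whole sphere can be injected
into `B` by piecewise applying finitely many rotations. -/
theorem exists_injective_into (hn : 3 ≤ n) {K : Finset (EucSp n ≃ₗᵢ[ℝ] EucSp n)}
    (hK : ∀ k ∈ K, IsRotation k) {B : Set (Sph n)} (hcov : nb K B = univ) :
    ∃ (T : Finset (EucSp n ≃ₗᵢ[ℝ] EucSp n)) (f : Sph n → Sph n), (∀ s ∈ T, IsRotation s) ∧
      Function.Injective f ∧ ∀ x, f x ∈ B ∧ ∃ s ∈ T, rotateSphere s x = f x := by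
  classical
  obtain ⟨S, hS, hexp⟩ := exists_finset_expand hn K.card
  let T : Finset (EucSp n ≃ₗᵢ[ℝ] EucSp n) := (K ×ˢ S).image fun p => p.1 * p.2
  have hT : ∀ s ∈ T, IsRotation s := by
    intro s hs
    obtain ⟨p, hp, rfl⟩ := Finset.mem_image.1 hs
    obtain ⟨h1, h2⟩ := Finset.mem_product.1 hp
    exact isRotation_mul (hK _ h1) (hS _ h2)
  let t : Sph n → Finset (Sph n) := fun x => (T.image fun s => rotateSphere s x).filter (· ∈ B)
  have hall : ∀ F : Finset (Sph n), F.card ≤ (F.biUnion t).card := by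
    intro F
    rcases F.eq_empty_or_nonempty with rfl | ⟨x₀, hx₀⟩
    · simp
    set N := (S ×ˢ F).image fun p : (EucSp n ≃ₗᵢ[ℝ] EucSp n) × Sph n => rotateSphere p.1 p.2
      with hN
    have hKpos : 0 < K.card := by
      have : x₀ ∈ nb K B := hcov ▸ mem_univ _
      obtain ⟨k, hk, -⟩ := this
      exact Finset.card_pos.2 ⟨k, hk⟩
    have hsub : N ⊆ (K ×ˢ F.biUnion t).image
        fun p : (EucSp n ≃ₗᵢ[ℝ] EucSp n) × Sph n => rotateSphere p.1⁻¹ p.2 := by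
      intro y hy
      obtain ⟨⟨s, x⟩, hp, rfl⟩ := Finset.mem_image.1 hy
      obtain ⟨hs, hx⟩ := Finset.mem_product.1 hp
      have : rotateSphere s x ∈ nb K B := hcov ▸ mem_univ _
      obtain ⟨k, hk, hkB⟩ := this
      refine Finset.mem_image.2 ⟨(k, rotateSphere k (rotateSphere s x)),
        Finset.mem_product.2 ⟨hk, ?_⟩, rotateSphere_inv_apply _ _⟩
      refine Finset.mem_biUnion.2 ⟨x, hx, Finset.mem_filter.2 ⟨?_, hkB⟩⟩
      exact Finset.mem_image.2 ⟨k * s, Finset.mem_image.2 ⟨(k, s),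
        Finset.mem_product.2 ⟨hk, hs⟩, rfl⟩, rotateSphere_mul _ _ _⟩
    have h1 : K.card * F.card ≤ K.card * (F.biUnion t).card :=
      (hexp F).trans <| (Finset.card_le_card hsub).trans <|
        Finset.card_image_le.trans (Finset.card_product _ _).le
    exact Nat.le_of_mul_le_mul_left h1 hKpos
  obtain ⟨f, hf, hft⟩ := (Finset.all_card_le_biUnion_card_iff_exists_injective t).1 hall
  refine ⟨T, f, hT, hf, fun x => ?_⟩
  obtain ⟨h1, h2⟩ := Finset.mem_filter.1 (hft x)
  obtain ⟨s, hs, e⟩ := Finset.mem_image.1 h1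
  exact ⟨h2, s, hs, e⟩

/-- Two sets into which finitely many rotations move every point are equidecomposable, and so are
their traces on any set invariant under the rotations used. -/
theorem exists_bijective_trace (hn : 3 ≤ n) {K : Finset (EucSp n ≃ₗᵢ[ℝ] EucSp n)}
    (hK : ∀ k ∈ K, IsRotation k) {A B : Set (Sph n)} (hA : nb K A = univ) (hB : nb K B = univ) :
    ∃ T : Finset (EucSp n ≃ₗᵢ[ℝ] EucSp n), (∀ s ∈ T, IsRotation s) ∧ ∀ N : Set (Sph n),
      (∀ s ∈ T, ∀ x, rotateSphere s x ∈ N ↔ x ∈ N) →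
      ∃ h : ↥(A ∩ N) → ↥(B ∩ N), Function.Bijective h ∧
        ∀ a : ↥(A ∩ N), ∃ s ∈ T, rotateSphere s a = (h a : Sph n) := by
  classical
  obtain ⟨S, f, hS, hf, hfB⟩ := exists_injective_into hn hK hB
  obtain ⟨T, g, hT, hg, hgA⟩ := exists_injective_into hn hK hA
  refine ⟨S ∪ T.image (·⁻¹), ?_, fun N hN => ?_⟩
  · intro s hs
    rcases Finset.mem_union.1 hs with h | h
    · exact hS s h
    · obtain ⟨t, ht, rfl⟩ := Finset.mem_image.1 h
      exact isRotation_inv (hT t ht)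
  have hfN : ∀ x ∈ N, f x ∈ N := by
    intro x hx
    obtain ⟨-, s, hs, e⟩ := hfB x
    rw [← e]
    exact (hN s (Finset.mem_union_left _ hs) x).2 hx
  have hgN : ∀ x ∈ N, g x ∈ N := by
    intro x hx
    obtain ⟨-, s, hs, e⟩ := hgA x
    rw [← e, ← hN s⁻¹ (Finset.mem_union_right _ (Finset.mem_image_of_mem _ hs)),
      rotateSphere_inv_apply]
    exact hx
  let F : ↥(A ∩ N) → ↥(B ∩ N) := fun a => ⟨f a, (hfB a).1, hfN _ a.2.2⟩
  let G : ↥(B ∩ N) → ↥(A ∩ N) := fun b => ⟨g b, (hgA b).1, hgN _ b.2.2⟩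
  have hF : Function.Injective F := fun a b h => Subtype.ext (hf (congrArg Subtype.val h))
  have hG : Function.Injective G := fun a b h => Subtype.ext (hg (congrArg Subtype.val h))
  refine Function.Embedding.schroeder_bernstein_of_rel hF hG
    (fun a b => ∃ s ∈ S ∪ T.image (·⁻¹), rotateSphere s a = (b : Sph n)) ?_ ?_
  · intro a
    obtain ⟨-, s, hs, e⟩ := hfB a
    exact ⟨s, Finset.mem_union_left _ hs, e⟩
  · intro b
    obtain ⟨-, s, hs, e⟩ := hgA b
    refine ⟨s⁻¹, Finset.mem_union_right _ (Finset.mem_image_of_mem _ hs), ?_⟩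
    change rotateSphere s⁻¹ (g b) = b
    rw [← e, rotateSphere_inv_apply]

end NullBijection

end SphereEq

namespace SphereEq

section Assembly

variable {n : ℕ}

/-- A linear isometry as a measurable automorphism of the sphere. -/
def rotEquiv (γ : EucSp n ≃ₗᵢ[ℝ] EucSp n) : Sph n ≃ᵐ Sph n where
  toFun := rotateSphere γ
  invFun := rotateSphere γ⁻¹
  left_inv := rotateSphere_inv_apply γ
  right_inv := rotateSphere_apply_inv γ
  measurable_toFun := measurable_rotateSphere γ
  measurable_invFun := measurable_rotateSphere γ⁻¹

theorem rotEquiv_symm_apply (γ : EucSp n ≃ₗᵢ[ℝ] EucSp n) (x : Sph n) :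
    (rotEquiv γ).symm x = rotateSphere γ⁻¹ x := rfl

theorem rotInv_of_image {μ : Measure (Sph n)}
    (hinv : ∀ γ : EucSp n ≃ₗᵢ[ℝ] EucSp n, IsRotation γ →
      ∀ U : Set (Sph n), μ (rotateSphere γ '' U) = μ U) : RotInv μ := by
  intro γ hγ
  refine ⟨measurable_rotateSphere γ, Measure.ext fun U hU => ?_⟩
  rw [Measure.map_apply (measurable_rotateSphere γ) hU, ← hinv γ hγ (rotateSphere γ ⁻¹' U),
    image_preimage_eq (f := rotateSphere γ) _ (rotEquiv γ).surjective]

theorem exists_nb_cover (hn : 3 ≤ n) {U : Set (Sph n)} (hU : IsOpen U) (hne : U.Nonempty) :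
    ∃ K : Finset (EucSp n ≃ₗᵢ[ℝ] EucSp n), (∀ k ∈ K, IsRotation k) ∧ nb K U = univ := by
  classical
  obtain ⟨y, hy⟩ := hne
  choose r hr hry using fun x : Sph n => exists_rotation_map hn x y
  obtain ⟨t, ht⟩ := isCompact_univ.elim_finite_subcover (fun x => rotateSphere (r x) ⁻¹' U)
    (fun x => hU.preimage (continuous_rotateSphere (r x)))
    (fun x _ => mem_iUnion.2 ⟨x, by simpa [hry] using hy⟩)
  refine ⟨t.image r, ?_, eq_univ_of_forall fun x => ?_⟩
  · intro k hk
    obtain ⟨x, -, rfl⟩ := Finset.mem_image.1 hk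
    exact hr x
  · obtain ⟨z, hz, hx⟩ := mem_iUnion₂.1 (ht (mem_univ x))
    exact ⟨r z, Finset.mem_image_of_mem r hz, hx⟩

theorem nb_mono_right (S : Finset (EucSp n ≃ₗᵢ[ℝ] EucSp n)) {U V : Set (Sph n)} (h : U ⊆ V) :
    nb S U ⊆ nb S V := fun _ ⟨s, hs, hx⟩ => ⟨s, hs, h hx⟩

theorem measureReal_pos_of_cover {μ : Measure (Sph n)} [IsProbabilityMeasure μ] (hμ : RotInv μ)
    {K : Finset (EucSp n ≃ₗᵢ[ℝ] EucSp n)} (hK : ∀ k ∈ K, IsRotation k) {U : Set (Sph n)}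
    (hU : MeasurableSet U) (hcov : nb K U = univ) : 0 < μ.real U := by
  refine ENNReal.toReal_pos (fun h => ?_) (measure_ne_top _ _)
  have h0 : μ (nb K U) = 0 := by
    rw [nb_eq_biUnion]
    refine (measure_biUnion_null_iff K.countable_toSet).2 ?_
    intro k hk
    rw [(hμ k (hK k hk)).measure_preimage hU.nullMeasurableSet, h]
  rw [hcov, measure_univ] at h0
  exact one_ne_zero h0

theorem exists_measurable_part {X : Type*} [TopologicalSpace X] [MeasurableSpace X] [BorelSpace X]
    {μ : Measure X} {A : Set X} (hA : NullMeasurableSet A μ) :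
    ∃ A₀, MeasurableSet A₀ ∧ interior A ⊆ A₀ ∧ A₀ ⊆ A ∧ μ (A \ A₀) = 0 := by
  obtain ⟨A', h1, h2, h3⟩ := hA.exists_measurable_subset_ae_eq
  refine ⟨interior A ∪ A', isOpen_interior.measurableSet.union h2, subset_union_left,
    union_subset interior_subset h1, ?_⟩
  exact measure_mono_null (sdiff_subset_sdiff_right subset_union_right) (ae_le_set.1 h3.symm.le)

/-- A null set is contained in a null set invariant under finitely many given rotations. -/
theorem exists_invariant_null {μ : Measure (Sph n)} (hμ : RotInv μ)
    (S : Finset (EucSp n ≃ₗᵢ[ℝ] EucSp n)) (hS : ∀ s ∈ S, IsRotation s) {E : Set (Sph n)}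
    (hE : μ E = 0) : ∃ N, E ⊆ N ∧ μ N = 0 ∧ ∀ s ∈ S, ∀ x, rotateSphere s x ∈ N ↔ x ∈ N := by
  let H := Subgroup.closure (S : Set (EucSp n ≃ₗᵢ[ℝ] EucSp n))
  have hH : ∀ γ ∈ H, IsRotation γ := fun γ hγ =>
    Subgroup.closure_induction (p := fun γ _ => IsRotation γ) (fun s hs => hS s hs)
      isRotation_one (fun _ _ _ _ => isRotation_mul) (fun _ _ => isRotation_inv) hγ
  have hHc : Countable H := by
    have : Countable (FreeGroup (S : Set (EucSp n ≃ₗᵢ[ℝ] EucSp n))) :=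
      inferInstanceAs (Countable (Quot _))
    simp only [H, FreeGroup.closure_eq_range]
    exact (MonoidHom.rangeRestrict_surjective _).countable
  refine ⟨⋃ γ : H, rotateSphere γ.1 ⁻¹' E, ?_, ?_, ?_⟩
  · intro x hx
    exact mem_iUnion.2 ⟨1, hx⟩
  · rw [measure_iUnion_null_iff]
    intro γ
    exact (hμ γ.1 (hH _ γ.2)).quasiMeasurePreserving.preimage_null hE
  · intro s hs x
    have hsH : s ∈ H := Subgroup.subset_closure hs
    simp only [mem_iUnion, mem_preimage]
    constructor
    · rintro ⟨γ, h⟩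
      refine ⟨γ * ⟨s, hsH⟩, ?_⟩
      change rotateSphere (γ.1 * s) x ∈ E
      rwa [rotateSphere_mul]
    · rintro ⟨γ, h⟩
      refine ⟨γ * ⟨s, hsH⟩⁻¹, ?_⟩
      change rotateSphere (γ.1 * s⁻¹) _ ∈ E
      rwa [rotateSphere_mul, rotateSphere_inv_apply]

/-- A matching without defect covers both sides up to null sets. -/
theorem IsMatching.measure_diff_mimg {X ι : Type*} [MeasurableSpace X] [Finite ι]
    {g : ι → X ≃ᵐ X} {A B : Set X} {m : X → Option ι} (h : IsMatching g A B m) {μ : Measure X}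
    [IsProbabilityMeasure μ] (hg : ∀ i, MeasurePreserving (g i) μ μ)
    (hAB : μ A = μ B) (hm : μ (A \ mdom m) = 0) : μ (B \ mimg g m univ) = 0 := by
  have h1 : μ (mimg g m univ) = μ B := by
    rw [h.measure_mimg hg MeasurableSet.univ, inter_univ, ← hAB]
    exact (measure_mono h.mdom_subset).antisymm (ae_le_set.2 hm |> measure_mono_ae)
  rw [measure_sdiff (h.mimg_subset _) (h.measurableSet_mimg MeasurableSet.univ).nullMeasurableSet
    (measure_ne_top _ _), h1, tsub_self]

/-- A labelling of `A` by rotations which induces a bijection onto `B` gives an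
equidecomposition. -/
theorem exists_pieces {μ : Measure (Sph n)} {A B : Set (Sph n)}
    (W : Finset (EucSp n ≃ₗᵢ[ℝ] EucSp n)) (hW : ∀ w ∈ W, IsRotation w)
    (lab : Sph n → (EucSp n ≃ₗᵢ[ℝ] EucSp n)) (hlab : ∀ x ∈ A, lab x ∈ W)
    (hbij : BijOn (fun x => rotateSphere (lab x) x) A B)
    (hmeas : ∀ w ∈ W, NullMeasurableSet {x | x ∈ A ∧ lab x = w} μ) :
    ∃ (m : ℕ) (γ : Fin m → (EucSp n ≃ₗᵢ[ℝ] EucSp n)) (P : Fin m → Set (Sph n)),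
      (∀ i, IsRotation (γ i)) ∧
      (∀ i, NullMeasurableSet (P i) μ) ∧
      (∀ i j, i ≠ j → Disjoint (P i) (P j)) ∧
      (⋃ i, P i) = A ∧
      (∀ i j, i ≠ j → Disjoint (rotateSphere (γ i) '' P i) (rotateSphere (γ j) '' P j)) ∧
      (⋃ i, rotateSphere (γ i) '' P i) = B := by
  let γ : Fin W.card → (EucSp n ≃ₗᵢ[ℝ] EucSp n) := fun i => (W.equivFin.symm i).1
  have hγW : ∀ i, γ i ∈ W := fun i => (W.equivFin.symm i).2
  have hγ : Function.Injective γ := Subtype.val_injective.comp W.equivFin.symm.injective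
  have hsurj : ∀ w ∈ W, ∃ i, γ i = w := fun w hw => ⟨W.equivFin ⟨w, hw⟩, by simp [γ]⟩
  refine ⟨W.card, γ, fun i => {x | x ∈ A ∧ lab x = γ i}, fun i => hW _ (hγW i),
    fun i => hmeas _ (hγW i), ?_, ?_, ?_, ?_⟩
  · intro i j hij
    rw [Set.disjoint_left]
    rintro x ⟨-, h1⟩ ⟨-, h2⟩
    exact hij (hγ (h1.symm.trans h2))
  · ext x
    simp only [mem_iUnion, Set.mem_ofPred_eq]
    constructor
    · rintro ⟨i, h, -⟩
      exact h
    · intro h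
      obtain ⟨i, hi⟩ := hsurj _ (hlab x h)
      exact ⟨i, h, hi.symm⟩
  · intro i j hij
    rw [Set.disjoint_left]
    rintro _ ⟨x, ⟨hx, h1⟩, rfl⟩ ⟨y, ⟨hy, h2⟩, e⟩
    have : y = x := hbij.injOn hy hx (by simpa [h1, h2] using e)
    subst this
    exact hij (hγ (h1.symm.trans h2))
  · ext y
    simp only [mem_iUnion]
    constructor
    · rintro ⟨i, x, ⟨hx, h1⟩, rfl⟩
      rw [← h1]
      exact hbij.mapsTo hx
    · intro hy
      obtain ⟨x, hx, rfl⟩ := hbij.surjOn hy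
      obtain ⟨i, hi⟩ := hsurj _ (hlab x hx)
      exact ⟨i, x, ⟨hx, hi.symm⟩, by rw [hi]⟩

theorem exists_almost_matching (hn : 3 ≤ n) {μ : Measure (Sph n)} [IsProbabilityMeasure μ]
    (hμ : RotInv μ) {A B : Set (Sph n)} (hA : MeasurableSet A) (hB : MeasurableSet B)
    (hAB : μ A = μ B) {K : Finset (EucSp n ≃ₗᵢ[ℝ] EucSp n)} (hK : ∀ k ∈ K, IsRotation k)
    (hKA : nb K A = univ) (hKB : nb K B = univ) :
    ∃ (S : Finset (EucSp n ≃ₗᵢ[ℝ] EucSp n)) (m : Sph n → Option S), (∀ s ∈ S, IsRotation s) ∧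
      IsMatching (fun s : S => rotEquiv s.1) A B m ∧ μ (A \ mdom m) = 0 ∧
      μ (B \ mimg (fun s : S => rotEquiv s.1) m univ) = 0 := by
  classical
  have hr : μ.real A = μ.real B := by simp [measureReal_def, hAB]
  obtain ⟨S, hS, hSA⟩ := exists_nb_target hn μ hμ hA (measureReal_pos_of_cover hμ hK hA hKA) hK hKA
  obtain ⟨T, hT, hTB⟩ := exists_nb_target hn μ hμ hB (measureReal_pos_of_cover hμ hK hB hKB) hK hKB
  let R := S ∪ T.image (·⁻¹)
  have hR : ∀ s ∈ R, IsRotation s := by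
    intro s hs
    rcases Finset.mem_union.1 hs with h | h
    · exact hS s h
    · obtain ⟨t, ht, rfl⟩ := Finset.mem_image.1 h
      exact isRotation_inv (hT t ht)
  have hg : ∀ s : R, MeasurePreserving (rotEquiv s.1) μ μ := fun s => hμ s.1 (hR _ s.2)
  obtain ⟨m, hm, h0⟩ := exists_isMatching_defect_zero hg hA hB hAB
    (fun U hU => by
      refine (hSA U hU).trans <| measureReal_mono (inter_subset_inter_right _ ?_)
        (measure_ne_top _ _)
      rintro x ⟨s, hs, hx⟩
      exact mem_iUnion.2 ⟨⟨s, Finset.mem_union_left _ hs⟩, hx⟩)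
    (fun U hU => by
      rw [hr]
      refine (hTB U hU).trans <| measureReal_mono (inter_subset_inter_right _ ?_)
        (measure_ne_top _ _)
      rintro x ⟨t, ht, hx⟩
      refine mem_iUnion.2 ⟨⟨t⁻¹, Finset.mem_union_right _ (Finset.mem_image_of_mem _ ht)⟩, ?_⟩
      rw [mem_preimage, rotEquiv_symm_apply, inv_inv]
      exact hx)
  exact ⟨R, m, hR, hm, h0, hm.measure_diff_mimg hg hAB h0⟩

/-- An almost everywhere matching and a bijection between the traces of an invariant null set
combine to an exact labelling. -/
theorem exists_labelling {μ : Measure (Sph n)} {A B N : Set (Sph n)}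
    (hAm : NullMeasurableSet A μ) {S T : Finset (EucSp n ≃ₗᵢ[ℝ] EucSp n)} {m : Sph n → Option S}
    (hm : IsMatching (fun s : S => rotEquiv s.1) A B m) (hN0 : μ N = 0)
    (hSN : ∀ s ∈ S, ∀ x, rotateSphere s x ∈ N ↔ x ∈ N)
    (hAN : A \ mdom m ⊆ N) (hBN : B \ mimg (fun s : S => rotEquiv s.1) m univ ⊆ N)
    {h : ↥(A ∩ N) → ↥(B ∩ N)} (hh : Function.Bijective h)
    (hT : ∀ a : ↥(A ∩ N), ∃ s ∈ T, rotateSphere s a = (h a : Sph n)) :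
    ∃ lab : Sph n → (EucSp n ≃ₗᵢ[ℝ] EucSp n), (∀ x ∈ A, lab x ∈ S ∨ lab x ∈ T) ∧
      BijOn (fun x => rotateSphere (lab x) x) A B ∧
      ∀ w, NullMeasurableSet {x | x ∈ A ∧ lab x = w} μ := by
  classical
  choose l hlT hl using hT
  let lab : Sph n → (EucSp n ≃ₗᵢ[ℝ] EucSp n) := fun x =>
    if hx : x ∈ A ∩ N then l ⟨x, hx⟩ else (m x).elim 1 Subtype.val
  have hin : ∀ a : ↥(A ∩ N), lab a = l a := fun a => dif_pos a.2
  have hout : ∀ x i, x ∉ N → m x = some i → lab x = i.1 := by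
    intro x i hx hi
    simp only [lab]
    rw [dif_neg (fun h => hx h.2), hi]
    rfl
  have hsome : ∀ x ∈ A, x ∉ N → ∃ i, m x = some i := by
    intro x hx hxN
    by_contra hc
    exact hxN (hAN ⟨hx, fun h => hc (mem_mdom.1 h)⟩)
  have key1 : ∀ a : ↥(A ∩ N), rotateSphere (lab a) a = (h a : Sph n) := fun a => by
    rw [hin, hl]
  have key2 : ∀ x ∈ A, x ∉ N → ∃ i, m x = some i ∧ lab x = i.1 ∧ rotateSphere (lab x) x ∉ N := by
    intro x hx hxN
    obtain ⟨i, hi⟩ := hsome x hx hxN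
    refine ⟨i, hi, hout x i hxN hi, ?_⟩
    rwa [hout x i hxN hi, hSN _ i.2]
  refine ⟨lab, ?_, ⟨?_, ?_, ?_⟩, ?_⟩
  · intro x hx
    by_cases hxN : x ∈ N
    · exact Or.inr (hin ⟨x, hx, hxN⟩ ▸ hlT _)
    · obtain ⟨i, -, e, -⟩ := key2 x hx hxN
      exact Or.inl (e ▸ i.2)
  · intro x hx
    by_cases hxN : x ∈ N
    · change rotateSphere (lab x) x ∈ B
      rw [key1 ⟨x, hx, hxN⟩]
      exact (h _).2.1
    · obtain ⟨i, hi, e, -⟩ := key2 x hx hxN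
      change rotateSphere (lab x) x ∈ B
      rw [e]
      exact hm.right hi
  · intro x hx y hy exy
    change rotateSphere (lab x) x = rotateSphere (lab y) y at exy
    by_cases hxN : x ∈ N <;> by_cases hyN : y ∈ N
    · rw [key1 ⟨x, hx, hxN⟩, key1 ⟨y, hy, hyN⟩] at exy
      exact congrArg Subtype.val (hh.1 (Subtype.ext exy))
    · obtain ⟨i, hi, e, hn⟩ := key2 y hy hyN
      rw [← exy, key1 ⟨x, hx, hxN⟩] at hn
      exact absurd (h _).2.2 hn
    · obtain ⟨i, hi, e, hn⟩ := key2 x hx hxN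
      rw [exy, key1 ⟨y, hy, hyN⟩] at hn
      exact absurd (h _).2.2 hn
    · obtain ⟨i, hi, e, -⟩ := key2 x hx hxN
      obtain ⟨j, hj, e', -⟩ := key2 y hy hyN
      rw [e, e'] at exy
      exact hm.inj hi hj exy
  · intro y hy
    by_cases hyN : y ∈ N
    · obtain ⟨a, ha⟩ := hh.2 ⟨y, hy, hyN⟩
      exact ⟨a, a.2.1, by change rotateSphere (lab a) a = y; rw [key1, ha]⟩
    · have : y ∈ mimg (fun s : S => rotEquiv s.1) m univ := by
        by_contra hc
        exact hyN (hBN ⟨hy, hc⟩)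
      obtain ⟨i, x, hi, -, e⟩ := mem_mimg.1 this
      change rotateSphere i.1 x = y at e
      have hxN : x ∉ N := by rwa [← hSN _ i.2, e]
      refine ⟨x, hm.left hi, ?_⟩
      change rotateSphere (lab x) x = y
      rw [hout x i hxN hi, e]
  · intro w
    have hmeas : MeasurableSet (⋃ i : S, ⋃ _ : i.1 = w, {x | m x = some i}) :=
      MeasurableSet.iUnion fun i => MeasurableSet.iUnion fun _ => hm.meas i
    refine (hAm.inter hmeas.nullMeasurableSet).congr ?_
    have hN : ∀ᵐ x ∂μ, x ∉ N := measure_eq_zero_iff_ae_notMem.1 hN0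
    filter_upwards [hN] with x hx
    refine propext ⟨?_, ?_⟩
    · rintro ⟨hxA, hxU⟩
      simp only [mem_iUnion] at hxU
      obtain ⟨i, rfl, hi⟩ := hxU
      exact ⟨hxA, hout x i hx hi⟩
    · rintro ⟨hxA, rfl⟩
      obtain ⟨i, hi, e, -⟩ := key2 x hxA hx
      refine ⟨hxA, ?_⟩
      simp only [mem_iUnion]
      exact ⟨i, e.symm, hi⟩

end Assembly

end SphereEq

/-- Let `n ≥ 3` and let `A, B ⊆ S^{n-1}` be measurable (w.r.t. the rotation-invariant Borel
probability measure `μ`) sets with non-empty interiors relative to the sphere and of the same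
measure.  Then `A` and `B` are equidecomposable using rotations with measurable pieces
(an exact measurable equidecomposition, no exceptional null sets removed). -/
theorem measurable_equidecomposition_sphere (n : ℕ) (hn : 3 ≤ n)
    (μ : Measure (Sph n)) [IsProbabilityMeasure μ]
    (hinv : ∀ γ : EucSp n ≃ₗᵢ[ℝ] EucSp n, IsRotation γ →
      ∀ U : Set (Sph n), μ (rotateSphere γ '' U) = μ U)
    (A B : Set (Sph n))
    (hAm : NullMeasurableSet A μ) (hBm : NullMeasurableSet B μ)
    (hAi : (interior A).Nonempty) (hBi : (interior B).Nonempty)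
    (hAB : μ A = μ B) :
    ∃ (m : ℕ) (γ : Fin m → (EucSp n ≃ₗᵢ[ℝ] EucSp n)) (P : Fin m → Set (Sph n)),
      (∀ i, IsRotation (γ i)) ∧
      (∀ i, NullMeasurableSet (P i) μ) ∧
      (∀ i j, i ≠ j → Disjoint (P i) (P j)) ∧
      (⋃ i, P i) = A ∧
      (∀ i j, i ≠ j → Disjoint (rotateSphere (γ i) '' P i) (rotateSphere (γ j) '' P j)) ∧
      (⋃ i, rotateSphere (γ i) '' P i) = B := by
  classical
  have hμ := SphereEq.rotInv_of_image hinv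
  obtain ⟨K₁, hK₁, hA₁⟩ := SphereEq.exists_nb_cover hn isOpen_interior hAi
  obtain ⟨K₂, hK₂, hB₂⟩ := SphereEq.exists_nb_cover hn isOpen_interior hBi
  have hK : ∀ k ∈ K₁ ∪ K₂, IsRotation k := fun k hk =>
    (Finset.mem_union.1 hk).elim (hK₁ k) (hK₂ k)
  have hKA : ∀ {V : Set (Sph n)}, interior A ⊆ V → SphereEq.nb (K₁ ∪ K₂) V = univ := fun hV =>
    eq_univ_of_univ_subset <| hA₁ ▸ (SphereEq.nb_mono_right _ hV).trans
      (SphereEq.nb_mono Finset.subset_union_left _)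
  have hKB : ∀ {V : Set (Sph n)}, interior B ⊆ V → SphereEq.nb (K₁ ∪ K₂) V = univ := fun hV =>
    eq_univ_of_univ_subset <| hB₂ ▸ (SphereEq.nb_mono_right _ hV).trans
      (SphereEq.nb_mono Finset.subset_union_right _)
  obtain ⟨A₀, hA₀, hA₀i, hA₀s, hA₀n⟩ := SphereEq.exists_measurable_part hAm
  obtain ⟨B₀, hB₀, hB₀i, hB₀s, hB₀n⟩ := SphereEq.exists_measurable_part hBm
  have eA : μ A₀ = μ A := (measure_mono hA₀s).antisymm (measure_mono_ae (ae_le_set.2 hA₀n))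
  have eB : μ B₀ = μ B := (measure_mono hB₀s).antisymm (measure_mono_ae (ae_le_set.2 hB₀n))
  obtain ⟨S, m, hS, hm, hmA, hmB⟩ := SphereEq.exists_almost_matching hn hμ hA₀ hB₀
    (eA.trans (hAB.trans eB.symm)) hK (hKA hA₀i) (hKB hB₀i)
  obtain ⟨T, hT, hbij⟩ := SphereEq.exists_bijective_trace hn hK
    (hKA interior_subset) (hKB interior_subset)
  have hST : ∀ s ∈ S ∪ T, IsRotation s := fun s hs =>
    (Finset.mem_union.1 hs).elim (hS s) (hT s)
  set g : S → Sph n ≃ᵐ Sph n := fun s => SphereEq.rotEquiv s.1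
  have hE : μ ((A \ SphereEq.mdom m) ∪ (B \ SphereEq.mimg g m univ)) = 0 := by
    refine measure_mono_null (t := (A \ A₀ ∪ A₀ \ SphereEq.mdom m) ∪
      (B \ B₀ ∪ B₀ \ SphereEq.mimg g m univ)) ?_ ?_
    · have hd : ∀ U V W : Set (Sph n), U \ W ⊆ U \ V ∪ V \ W := fun U V W x hx =>
        (em (x ∈ V)).elim (fun h => Or.inr ⟨h, hx.2⟩) fun h => Or.inl ⟨hx.1, h⟩
      exact union_subset_union (hd _ _ _)
        (hd _ _ _)
    · simp only [measure_union_null_iff]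
      exact ⟨⟨hA₀n, hmA⟩, hB₀n, hmB⟩
  obtain ⟨N, hEN, hN0, hN⟩ := SphereEq.exists_invariant_null hμ (S ∪ T) hST hE
  obtain ⟨h, hh, hhT⟩ := hbij N fun s hs => hN s (Finset.mem_union_right _ hs)
  have hm' : SphereEq.IsMatching g A B m :=
    ⟨hm.meas, fun e => hA₀s (hm.left e), fun e => hB₀s (hm.right e), hm.inj⟩
  obtain ⟨lab, hlab, hb, hlm⟩ := SphereEq.exists_labelling hAm hm' hN0
    (fun s hs => hN s (Finset.mem_union_left _ hs))
    (subset_union_left.trans hEN) (subset_union_right.trans hEN) hh hhT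
  exact SphereEq.exists_pieces (S ∪ T) hST lab (fun x hx => Finset.mem_union.2 (hlab x hx)) hb
    fun w _ => hlm w
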